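/- Let α,β,q1,q2>0 with α>β, 1<p<N/α, q1+q2>p−1 and q2<N(p−1)/(N−βp). Let ω be a nonnegative bounded Radon measure supported in a ball B_R(x0)⊂ℝ^N, extended by 0 outside B_R(x0). The following statements are equivalent (with constants allowed to depend on R): (a) there exists C1>0 with ω(K) ≤ C1·Cap_{G_{(αpq1+βpq2)/(q1+q2)}, (q1+q2)/(q1+q2−p+1)}(K) for every compact K⊂ℝ^N; (b) there exists C2>0 with ∫_K (W^{4R}_{α,p}[ω])^{q1}(W^{4R}_{β,p}[ω])^{q2} dx ≤ C2·Cap_{G_{(αpq1+βpq2)/(q1+q2)}, (q1+q2)/(q1+q2−p+1)}(K) for every compact K⊂ℝ^N; (c) there exists C3>0 with ∫_{ℝ^N} (W^{4R}_{(αq1+βq2)/(q1+q2), p}[χ_{B_t(x)}ω](y))^{q1+q2} dy ≤ C3·ω(B_t(x)) for every ball B_t(x)⊂ℝ^N; (d) there exists C4>0 with ∫_{ℝ^N} (W^{4R}_{α,p}[χ_{B_t(x)}ω](y))^{q1}(W^{4R}_{β,p}[χ_{B_t(x)}ω](y))^{q2} dy ≤ C4·ω(B_t(x)) for every ball B_t(x)⊂ℝ^N;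 (e) there exists C5>0 such that W^{4R}_{α,p}[(W^{4R}_{α,p}[ω])^{q1}(W^{4R}_{β,p}[ω])^{q2}] ≤ C5·W^{4R}_{α,p}[ω] and W^{4R}_{β,p}[(W^{4R}_{α,p}[ω])^{q1}(W^{4R}_{β,p}[ω])^{q2}] ≤ C5·W^{4R}_{β,p}[ω] hold a.e. in B_{2R}(x0). -/

import Mathlib

open MeasureTheory Metric Set Filter Bornology
open scoped ENNReal NNReal Topology RealInnerProductSpace

noncomputable section

/-- Euclidean space `ℝ^N`. -/
abbrev Euc (N : ℕ) : Type := EuclideanSpace ℝ (Fin N)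

/-- The `R`-truncated Wolff potential `W^R_{α,p}[μ](x)`; `R = ⊤` gives the full
Wolff potential `W_{α,p}[μ]`. -/
def wolff {N : ℕ} (α p : ℝ) (R : ℝ≥0∞) (μ : Measure (Euc N)) (x : Euc N) : ℝ≥0∞ :=
  ∫⁻ ρ in {ρ : ℝ | 0 < ρ ∧ ENNReal.ofReal ρ < R},
    (μ (ball x ρ) / ENNReal.ofReal (ρ ^ ((N : ℝ) - α * p))) ^ (1 / (p - 1)) /
      ENNReal.ofReal ρ

/-- The `R`-truncated Riesz potential `I^R_β[μ](x)`; `R = ⊤` gives `I_β[μ]`. -/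
def rieszPot {N : ℕ} (β : ℝ) (R : ℝ≥0∞) (μ : Measure (Euc N)) (x : Euc N) : ℝ≥0∞ :=
  ∫⁻ ρ in {ρ : ℝ | 0 < ρ ∧ ENNReal.ofReal ρ < R},
    μ (ball x ρ) / ENNReal.ofReal (ρ ^ ((N : ℝ) - β)) / ENNReal.ofReal ρ

/-- The Riesz capacity `Cap_{I_α,p}`. -/
def rieszCap (N : ℕ) (α p : ℝ) (O : Set (Euc N)) : ℝ≥0∞ :=
  ⨅ (g : Euc N → ℝ≥0∞) (_ : Measurable g)
    (_ : ∀ x ∈ O, 1 ≤ rieszPot α ⊤ (volume.withDensity g) x),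
    ∫⁻ x, g x ^ p

/-- The Bessel kernel of order `α` (up to the normalizing constant `c(N,α)`). -/
def besselKernel (N : ℕ) (α : ℝ) (x : Euc N) : ℝ :=
  ∫ t in Ioi (0 : ℝ),
    Real.exp (-(Real.pi * ‖x‖ ^ 2 / t) - t / (4 * Real.pi)) * t ^ ((α - (N : ℝ)) / 2) / t

/-- The Bessel capacity `Cap_{G_α,p}`. -/
def besselCap (N : ℕ) (α p : ℝ) (O : Set (Euc N)) : ℝ≥0∞ :=
  ⨅ (g : Euc N → ℝ≥0∞) (_ : Measurable g)
    (_ : ∀ x ∈ O, 1 ≤ ∫⁻ y, ENNReal.ofReal (besselKernel N α (x - y)) * g y),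
    ∫⁻ x, g x ^ p

/-- The `R`-truncated fractional maximal function `M^R_γ[μ]`. -/
def fracMax {N : ℕ} (γ : ℝ) (R : ℝ≥0∞) (μ : Measure (Euc N)) (x : Euc N) : ℝ≥0∞ :=
  ⨆ (t : ℝ) (_ : 0 < t) (_ : ENNReal.ofReal t < R),
    μ (ball x t) / ENNReal.ofReal (t ^ ((N : ℝ) - γ))

/-- The potential `L^R_{α,s}[μ]`. -/
def Lpot {N : ℕ} (α s : ℝ) (R : ℝ≥0∞) (μ : Measure (Euc N)) (x : Euc N) : ℝ≥0∞ :=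
  ∫⁻ t in {t : ℝ | 0 < t ∧ ENNReal.ofReal t < R},
    (μ (ball x t) / ENNReal.ofReal (t ^ ((N : ℝ) - α))) ^ s / ENNReal.ofReal t

/-- A mollifier: smooth, nonnegative, supported in the unit ball, of total mass one. -/
def IsMollifier {N : ℕ} (φ : Euc N → ℝ) : Prop :=
  ContDiff ℝ (⊤ : ℕ∞) φ ∧ (∀ x, 0 ≤ φ x) ∧ tsupport φ ⊆ ball 0 1 ∧ (∫ x, φ x) = 1

/-- The measure with density `φ_n * μ`, where `φ_n(x) = n^N φ(n x)`. -/
def mollified {N : ℕ} (φ : Euc N → ℝ) (n : ℕ) (μ : Measure (Euc N)) : Measure (Euc N) :=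
  volume.withDensity fun x =>
    ENNReal.ofReal (∫ y, (n : ℝ) ^ (N : ℕ) * φ ((n : ℝ) • (x - y)) ∂μ)

section

variable {N : ℕ} {L : ℝ}

/-- The dyadic scale `L / 2 ^ j`. -/
def dscale (L : ℝ) (j : ℕ) : ℝ := L / 2 ^ j

/-- The dyadic scale as an extended nonnegative real. -/
def escale (L : ℝ) (j : ℕ) : ℝ≥0∞ := ENNReal.ofReal (dscale L j)

lemma dscale_pos {L : ℝ} (hL : 0 < L) (j : ℕ) : 0 < dscale L j := by
  unfold dscale; positivity

lemma dscale_zero (L : ℝ) : dscale L 0 = L := by simp [dscale]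

lemma dscale_dscale (L : ℝ) (j i : ℕ) : dscale (dscale L j) i = dscale L (j + i) := by
  simp only [dscale, pow_add]; field_simp

lemma escale_dscale (L : ℝ) (j i : ℕ) : escale (dscale L j) i = escale L (j + i) := by
  simp only [escale, dscale_dscale]

lemma dscale_succ (L : ℝ) (j : ℕ) : dscale L j = 2 * dscale L (j + 1) := by
  simp only [dscale, pow_succ]; field_simp

lemma dscale_anti {L : ℝ} (hL : 0 < L) {i j : ℕ} (h : i ≤ j) : dscale L j ≤ dscale L i := by
  unfold dscale; gcongr; norm_num

lemma escale_anti {L : ℝ} (hL : 0 < L) {i j : ℕ} (h : i ≤ j) : escale L j ≤ escale L i :=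
  ENNReal.ofReal_le_ofReal (dscale_anti hL h)

lemma escale_ne_zero {L : ℝ} (hL : 0 < L) (j : ℕ) : escale L j ≠ 0 := by
  simp [escale, dscale_pos hL j]

lemma escale_ne_top (L : ℝ) (j : ℕ) : escale L j ≠ ∞ := ENNReal.ofReal_ne_top

lemma escale_add (L : ℝ) (j i : ℕ) :
    escale L (j + i) = escale L j * 2⁻¹ ^ i := by
  rw [escale, escale, ← dscale_dscale, dscale, ENNReal.ofReal_div_of_pos (by positivity),
    div_eq_mul_inv, ENNReal.ofReal_pow (by norm_num), ENNReal.inv_pow]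
  simp

lemma escale_rpow_ne_zero {L : ℝ} (hL : 0 < L) (j : ℕ) (a : ℝ) : escale L j ^ a ≠ 0 := by
  simp [ENNReal.rpow_eq_zero_iff, escale_ne_zero hL j, escale_ne_top L j]

lemma escale_rpow_ne_top {L : ℝ} (hL : 0 < L) (j : ℕ) (a : ℝ) : escale L j ^ a ≠ ∞ := by
  simp [ENNReal.rpow_eq_top_iff, escale_ne_zero hL j, escale_ne_top L j]

lemma escale_rpow_add {L : ℝ} (hL : 0 < L) (j : ℕ) (a b : ℝ) :
    escale L j ^ (a + b) = escale L j ^ a * escale L j ^ b :=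
  ENNReal.rpow_add _ _ (escale_ne_zero hL j) (escale_ne_top L j)

lemma escale_add_rpow (L : ℝ) (j i : ℕ) (a : ℝ) :
    escale L (j + i) ^ a = escale L j ^ a * ((2 : ℝ≥0∞) ^ (-a)) ^ i := by
  rw [escale_add L, ENNReal.mul_rpow_of_ne_top (escale_ne_top L j) (by simp),
    ← ENNReal.rpow_natCast, ← ENNReal.rpow_natCast, ← ENNReal.rpow_mul, mul_comm (i : ℝ),
    ENNReal.rpow_mul, ENNReal.inv_rpow, ENNReal.rpow_neg]

lemma escale_rpow_eq {L : ℝ} (hL : 0 < L) (j : ℕ) (a : ℝ) :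
    escale L j ^ a = ENNReal.ofReal (dscale L j ^ a) := by
  rw [escale, ENNReal.ofReal_rpow_of_pos (dscale_pos hL j)]

/-- The integer coordinates of the dyadic cell of generation `j` containing `x`. -/
def cellIndex {N : ℕ} (L : ℝ) (j : ℕ) (x : Euc N) : Fin N → ℤ :=
  fun i => ⌊x i / dscale L j⌋

/-- The dyadic cell of generation `j` containing `x`. -/
def cell {N : ℕ} (L : ℝ) (j : ℕ) (x : Euc N) : Set (Euc N) :=
  {y | cellIndex L j y = cellIndex L j x}

lemma measurable_cellIndex (L : ℝ) (j : ℕ) : Measurable (cellIndex (N := N) L j) := by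
  unfold cellIndex
  fun_prop

lemma cell_eq_preimage (L : ℝ) (j : ℕ) (x : Euc N) :
    cell L j x = cellIndex L j ⁻¹' {cellIndex L j x} := rfl

lemma mem_cell_self (L : ℝ) (j : ℕ) (x : Euc N) : x ∈ cell L j x := rfl

lemma cell_eq_of_mem {j : ℕ} {x y : Euc N} (h : y ∈ cell L j x) : cell L j y = cell L j x := by
  rw [cell_eq_preimage, cell_eq_preimage, show cellIndex L j y = cellIndex L j x from h]

lemma measurableSet_cell (L : ℝ) (j : ℕ) (x : Euc N) : MeasurableSet (cell L j x) :=
  measurable_cellIndex L j (measurableSet_singleton _)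

lemma cellIndex_dscale (L : ℝ) (j i : ℕ) (x : Euc N) :
    cellIndex (dscale L j) i x = cellIndex L (j + i) x := by
  unfold cellIndex; rw [dscale_dscale]

lemma cell_dscale (L : ℝ) (j i : ℕ) (x : Euc N) :
    cell (dscale L j) i x = cell L (j + i) x := by
  simp only [cell, cellIndex_dscale]

lemma cellIndex_eq_of_succ {j : ℕ} {x y : Euc N}
    (h : cellIndex L (j + 1) x = cellIndex L (j + 1) y) : cellIndex L j x = cellIndex L j y := by
  funext i
  have key : ∀ z : Euc N, cellIndex L j z i = cellIndex L (j + 1) z i / ((2 : ℕ) : ℤ) := by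
    intro z
    simp only [cellIndex]
    rw [← Int.floor_div_natCast, dscale_succ L j]
    congr 1; push_cast; rw [mul_comm, div_div]
  rw [key, key, h]

lemma cellIndex_eq_of_le {i j : ℕ} (hij : i ≤ j) {x y : Euc N}
    (h : cellIndex L j x = cellIndex L j y) : cellIndex L i x = cellIndex L i y := by
  induction j, hij using Nat.le_induction with
  | base => exact h
  | succ k _ ih => exact ih (cellIndex_eq_of_succ h)

lemma cell_anti {i j : ℕ} (hij : i ≤ j) (x : Euc N) : cell L j x ⊆ cell L i x :=
  fun _ hy => cellIndex_eq_of_le hij hy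

/-- A function is cell-constant at generation `j` if it depends only on the cell. -/
def CellConst {β : Type*} (L : ℝ) (j : ℕ) (f : Euc N → β) : Prop :=
  ∀ x y, cellIndex L j x = cellIndex L j y → f x = f y

lemma CellConst.exists_factor {β : Type*} [Nonempty β] {j : ℕ} {f : Euc N → β}
    (h : CellConst L j f) : ∃ g : (Fin N → ℤ) → β, f = g ∘ cellIndex L j := by
  have : Function.FactorsThrough f (cellIndex L j) := fun x y hxy => h x y hxy
  exact ⟨Function.extend (cellIndex L j) f fun _ => Classical.arbitrary β, by
    funext x; exact (this.extend_apply _ x).symm⟩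

lemma CellConst.measurable {β : Type*} [Nonempty β] [MeasurableSpace β] {j : ℕ}
    {f : Euc N → β} (h : CellConst L j f) : Measurable f := by
  obtain ⟨g, rfl⟩ := h.exists_factor
  exact (measurable_of_countable g).comp (measurable_cellIndex L j)

lemma CellConst.mono {β : Type*} {i j : ℕ} (hij : i ≤ j) {f : Euc N → β}
    (h : CellConst L i f) : CellConst L j f :=
  fun x y hxy => h x y (cellIndex_eq_of_le hij hxy)

lemma cellConst_cell (L : ℝ) (j : ℕ) : CellConst L j (cell (N := N) L j) :=
  fun x y h => by simp only [cell_eq_preimage, h]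

lemma CellConst.comp {β γ : Type*} {j : ℕ} {f : Euc N → β} (h : CellConst L j f) (g : β → γ) :
    CellConst L j (fun x => g (f x)) := fun x y hxy => by simp only [h x y hxy]

lemma CellConst.comp₂ {β γ δ : Type*} {j : ℕ} {f : Euc N → β} {f' : Euc N → γ}
    (h : CellConst L j f) (h' : CellConst L j f') (g : β → γ → δ) :
    CellConst L j (fun x => g (f x) (f' x)) :=
  fun x y hxy => by simp only [h x y hxy, h' x y hxy]

lemma CellConst.measurableSet {j : ℕ} {A : Set (Euc N)} (h : CellConst L j (· ∈ A)) :
    MeasurableSet A := by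
  have := h.measurable
  exact measurableSet_setOfPred.2 this

lemma CellConst.indicator {j : ℕ} {A : Set (Euc N)} (h : CellConst L j (· ∈ A))
    {f : Euc N → ℝ≥0∞} (hf : CellConst L j f) : CellConst L j (A.indicator f) := by
  intro x y hxy
  have h1 : (x ∈ A) = (y ∈ A) := h x y hxy
  by_cases hx : x ∈ A
  · rw [indicator_of_mem hx, indicator_of_mem (h1 ▸ hx), hf x y hxy]
  · rw [indicator_of_notMem hx, indicator_of_notMem (h1 ▸ hx)]

lemma cellConst_mem_cell (L : ℝ) (j : ℕ) (z : Euc N) : CellConst L j (· ∈ cell L j z) :=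
  fun x y hxy => by simp only [cell, mem_ofPred_eq, hxy]

lemma lintegral_cellIndex (L : ℝ) (j : ℕ) (ν : Measure (Euc N)) (g : (Fin N → ℤ) → ℝ≥0∞) :
    ∫⁻ x, g (cellIndex L j x) ∂ν = ∑' k, g k * ν (cellIndex L j ⁻¹' {k}) := by
  rw [← lintegral_map (measurable_of_countable g) (measurable_cellIndex L j),
    lintegral_countable']
  exact tsum_congr fun k => by
    rw [Measure.map_apply (measurable_cellIndex L j) (measurableSet_singleton k)]

/-- Two measures may exchange their roles at a fixed generation. -/
lemma lintegral_cell_swap {j : ℕ} {ψ : Euc N → ℝ≥0∞} (hψ : CellConst L j ψ)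
    (μ ν : Measure (Euc N)) :
    ∫⁻ x, ψ x * μ (cell L j x) ∂ν = ∫⁻ x, ψ x * ν (cell L j x) ∂μ := by
  obtain ⟨g, rfl⟩ := hψ.exists_factor
  have h1 := lintegral_cellIndex L j ν (fun k => g k * μ (cellIndex L j ⁻¹' {k}))
  have h2 := lintegral_cellIndex L j μ (fun k => g k * ν (cellIndex L j ⁻¹' {k}))
  simp only [Function.comp, cell_eq_preimage]
  rw [h1, h2]
  exact tsum_congr fun k => by ring

lemma lintegral_eq_tsum_cellIndex (L : ℝ) (j : ℕ) (ν : Measure (Euc N)) (f : Euc N → ℝ≥0∞) :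
    ∫⁻ x, f x ∂ν = ∑' k, ∫⁻ x in cellIndex L j ⁻¹' {k}, f x ∂ν := by
  rw [← lintegral_iUnion (fun k => measurable_cellIndex L j (measurableSet_singleton k))]
  · have : (⋃ k, cellIndex (N := N) L j ⁻¹' {k}) = univ := by
      ext x; simp
    rw [this, setLIntegral_univ]
  · intro a b hab
    exact (Disjoint.preimage _ (by simpa using hab))

/-- A measure comparison on all cells of one generation gives a comparison on unions of cells. -/
lemma lintegral_le_of_cell_le {j : ℕ} {μ ν : Measure (Euc N)} {f g : Euc N → ℝ≥0∞}
    (h : ∀ x, ∫⁻ y in cell L j x, f y ∂μ ≤ ∫⁻ y in cell L j x, g y ∂ν) :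
    ∫⁻ y, f y ∂μ ≤ ∫⁻ y, g y ∂ν := by
  rw [lintegral_eq_tsum_cellIndex L j, lintegral_eq_tsum_cellIndex L j ν]
  refine ENNReal.tsum_le_tsum fun k => ?_
  by_cases hk : ∃ x, cellIndex L j x = k
  · obtain ⟨x, rfl⟩ := hk
    exact h x
  · have : cellIndex (N := N) L j ⁻¹' {k} = ∅ := by
      ext x; simp only [mem_preimage, mem_singleton_iff, mem_empty_iff_false, iff_false]
      exact fun hx => hk ⟨x, hx⟩
    simp [this]

lemma volume_cell (hL : 0 < L) (j : ℕ) (x : Euc N) :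
    volume (cell L j x) = escale L j ^ (N : ℝ) := by
  have hd := dscale_pos hL j
  have : cell L j x = (MeasurableEquiv.toLp 2 (Fin N → ℝ)).symm ⁻¹'
      (Set.pi univ fun i => Ico (dscale L j * cellIndex L j x i)
        (dscale L j * (cellIndex L j x i + 1))) := by
    ext y
    simp only [cell, mem_ofPred_eq, mem_preimage, Set.mem_pi, mem_univ, forall_true_left, mem_Ico]
    rw [funext_iff]
    refine forall_congr' fun i => ?_
    rw [show cellIndex L j y i = ⌊y i / dscale L j⌋ from rfl, Int.floor_eq_iff,
      le_div_iff₀ hd, div_lt_iff₀ hd, mul_comm, mul_comm (_ + 1 : ℝ)]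
    rfl
  rw [this, (EuclideanSpace.volume_preserving_symm_measurableEquiv_toLp (Fin N)).measure_preimage
    (MeasurableSet.univ_pi fun i => measurableSet_Ico).nullMeasurableSet, volume_pi_pi]
  simp only [Real.volume_Ico]
  have : ∀ i : Fin N, dscale L j * (cellIndex L j x i + 1) - dscale L j * cellIndex L j x i
      = dscale L j := fun i => by ring
  simp [this, escale]

lemma dist_le_of_mem_cell (hL : 0 < L) {j : ℕ} {x y : Euc N} (h : y ∈ cell L j x) :
    dist y x ≤ N * dscale L j := by
  have hd := dscale_pos hL j
  have hc : ∀ i, |y i - x i| ≤ dscale L j := by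
    intro i
    have := congrFun (show cellIndex L j y = cellIndex L j x from h) i
    simp only [cellIndex] at this
    have h2 := Int.abs_sub_lt_one_of_floor_eq_floor this
    rw [← sub_div, abs_div, abs_of_pos hd, div_lt_one hd] at h2
    exact h2.le
  rw [dist_eq_norm, EuclideanSpace.norm_eq]
  have hs : ∑ i, ‖(y - x) i‖ ^ 2 ≤ (N * dscale L j) ^ 2 := by
    calc ∑ i, ‖(y - x) i‖ ^ 2 ≤ ∑ _i : Fin N, dscale L j ^ 2 := by
          refine Finset.sum_le_sum fun i _ => ?_
          have : ‖(y - x) i‖ ≤ dscale L j := by simpa using hc i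
          gcongr
      _ = N * dscale L j ^ 2 := by simp
      _ ≤ (N * dscale L j) ^ 2 := by
          rw [mul_pow]
          gcongr
          exact_mod_cast Nat.le_self_pow two_ne_zero N
  calc √(∑ i, ‖(y - x) i‖ ^ 2) ≤ √((N * dscale L j) ^ 2) := Real.sqrt_le_sqrt hs
    _ = _ := Real.sqrt_sq (by positivity)

lemma cell_subset_ball (hL : 0 < L) (j : ℕ) (x : Euc N) :
    cell L j x ⊆ ball x ((N + 1) * dscale L j) := by
  intro y hy
  have := dist_le_of_mem_cell hL hy
  have := dscale_pos hL j
  rw [mem_ball]; linarith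

/-- Translation by an integer vector times the scale. -/
def latticeShift (L : ℝ) (j : ℕ) (n : Fin N → ℤ) : Euc N :=
  WithLp.toLp 2 fun i => dscale L j * n i

lemma cellIndex_add_latticeShift (hL : 0 < L) (j : ℕ) (n : Fin N → ℤ) (x : Euc N) :
    cellIndex L j (x + latticeShift L j n) = cellIndex L j x + n := by
  funext i
  have hd := (dscale_pos hL j).ne'
  simp only [cellIndex, latticeShift, PiLp.add_apply, Pi.add_apply]
  rw [add_div, mul_div_cancel_left₀ _ hd, Int.floor_add_intCast]

/-- The integer vectors with entries of absolute value at most `m`. -/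
def latticeBox (N m : ℕ) : Finset (Fin N → ℤ) :=
  Fintype.piFinset fun _ => Finset.Icc (-(m : ℤ)) m

lemma ball_subset_iUnion_cell (hL : 0 < L) (j m : ℕ) (x : Euc N) :
    ball x (m * dscale L j) ⊆ ⋃ n ∈ latticeBox N m, cell L j (x + latticeShift L j n) := by
  intro y hy
  have hd := dscale_pos hL j
  refine mem_iUnion₂.2 ⟨cellIndex L j y - cellIndex L j x, ?_, ?_⟩
  · rw [latticeBox, Fintype.mem_piFinset]
    intro i
    have h1 : |y i - x i| < m * dscale L j := by
      calc |y i - x i| = ‖(y - x) i‖ := by simp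
        _ ≤ ‖y - x‖ := PiLp.norm_apply_le _ _
        _ < _ := by rwa [mem_ball, dist_eq_norm] at hy
    have h2 : |y i / dscale L j - x i / dscale L j| < m := by
      rw [← sub_div, abs_div, abs_of_pos hd, div_lt_iff₀ hd]; exact h1
    rw [abs_lt] at h2
    rw [Finset.mem_Icc]
    simp only [Pi.sub_apply, cellIndex]
    have a1 := Int.floor_le (y i / dscale L j)
    have a2 := Int.lt_floor_add_one (y i / dscale L j)
    have b1 := Int.floor_le (x i / dscale L j)
    have b2 := Int.lt_floor_add_one (x i / dscale L j)
    constructor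
    · have : (-(m : ℤ) - 1 : ℝ) < (⌊y i / dscale L j⌋ - ⌊x i / dscale L j⌋ : ℤ) := by
        push_cast; linarith
      have : -(m : ℤ) - 1 < ⌊y i / dscale L j⌋ - ⌊x i / dscale L j⌋ := by exact_mod_cast this
      omega
    · have : ((⌊y i / dscale L j⌋ - ⌊x i / dscale L j⌋ : ℤ) : ℝ) < (m : ℤ) + 1 := by
        push_cast; linarith
      have : ⌊y i / dscale L j⌋ - ⌊x i / dscale L j⌋ < (m : ℤ) + 1 := by exact_mod_cast this
      omega
  · show cellIndex L j y = cellIndex L j _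
    rw [cellIndex_add_latticeShift hL]; simp

lemma measurable_measure_cell (L : ℝ) (j : ℕ) (μ : Measure (Euc N)) :
    Measurable fun x => μ (cell L j x) :=
  ((cellConst_cell L j).comp μ).measurable

/-- Powers of masses of balls are controlled on average by powers of masses of cells. -/
lemma exists_lintegral_ball_rpow_le (N m : ℕ) {s : ℝ} (hs : 0 < s) :
    ∃ C : ℝ≥0∞, C ≠ ∞ ∧ ∀ (L : ℝ), 0 < L → ∀ (j : ℕ) (μ : Measure (Euc N)),
      ∫⁻ x, μ (ball x (m * dscale L j)) ^ s ≤ C * ∫⁻ x, μ (cell L j x) ^ s := by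
  set n := (latticeBox N m).card
  refine ⟨(n : ℝ≥0∞) ^ s * n, by finiteness, fun L hL j μ => ?_⟩
  have hpt : ∀ x, μ (ball x (m * dscale L j)) ^ s ≤
      (n : ℝ≥0∞) ^ s * ∑ k ∈ latticeBox N m, μ (cell L j (x + latticeShift L j k)) ^ s := by
    intro x
    obtain ⟨k0, hk0, hmax⟩ := (latticeBox N m).exists_max_image
      (fun k => μ (cell L j (x + latticeShift L j k)))
      ⟨0, by simp [latticeBox]⟩
    have : μ (ball x (m * dscale L j)) ≤ n * μ (cell L j (x + latticeShift L j k0)) := by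
      calc μ (ball x (m * dscale L j))
          ≤ μ (⋃ k ∈ latticeBox N m, cell L j (x + latticeShift L j k)) :=
            measure_mono (ball_subset_iUnion_cell hL j m x)
        _ ≤ ∑ k ∈ latticeBox N m, μ (cell L j (x + latticeShift L j k)) :=
            measure_biUnion_finset_le _ _
        _ ≤ _ := by
            refine (Finset.sum_le_card_nsmul _ _ _ hmax).trans_eq ?_
            rw [nsmul_eq_mul]
    calc _ ≤ (n * μ (cell L j (x + latticeShift L j k0))) ^ s := by gcongr
      _ = (n : ℝ≥0∞) ^ s * μ (cell L j (x + latticeShift L j k0)) ^ s :=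
          ENNReal.mul_rpow_of_nonneg _ _ hs.le
      _ ≤ _ := by
          gcongr
          exact Finset.single_le_sum (f := fun k => μ (cell L j (x + latticeShift L j k)) ^ s)
            (fun _ _ => zero_le) hk0
  have hm := (measurable_measure_cell L j μ).pow_const s
  calc _ ≤ ∫⁻ x, (n : ℝ≥0∞) ^ s *
        ∑ k ∈ latticeBox N m, μ (cell L j (x + latticeShift L j k)) ^ s := lintegral_mono hpt
    _ = (n : ℝ≥0∞) ^ s *
        ∑ k ∈ latticeBox N m, ∫⁻ x, μ (cell L j (x + latticeShift L j k)) ^ s := by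
        have hk : ∀ k, Measurable fun x => μ (cell L j (x + latticeShift L j k)) ^ s :=
          fun k => hm.comp (measurable_add_const _)
        rw [lintegral_const_mul _ (Finset.measurable_fun_sum _ fun k _ => hk k),
          lintegral_finsetSum _ fun k _ => hk k]
    _ = (n : ℝ≥0∞) ^ s * ∑ _k ∈ latticeBox N m, ∫⁻ x, μ (cell L j x) ^ s := by
        congr 1
        refine Finset.sum_congr rfl fun k _ => ?_
        exact lintegral_add_right_eq_self (fun x => μ (cell L j x) ^ s) _
    _ = _ := by simp [n, mul_assoc]

/-- The fractional density `μ(Q) ℓ(Q)^{-d}` of the dyadic cell `Q` of generation `j` at `x`. -/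
def cellDens (d L : ℝ) (μ : Measure (Euc N)) (j : ℕ) (x : Euc N) : ℝ≥0∞ :=
  μ (cell L j x) * escale L j ^ (-d)

/-- The dyadic energy of a measure. -/
def cellEnergy (d s L : ℝ) (μ : Measure (Euc N)) : ℝ≥0∞ :=
  ∑' j, ∫⁻ x, cellDens d L μ j x ^ s

/-- The testing condition on all measurable sets. -/
def CellTesting (d s L : ℝ) (μ : Measure (Euc N)) : Prop :=
  ∃ C : ℝ≥0∞, C ≠ ∞ ∧ ∀ E, MeasurableSet E → cellEnergy d s L (μ.restrict E) ≤ C * μ E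

lemma cellConst_cellDens (d L : ℝ) (μ : Measure (Euc N)) (j : ℕ) :
    CellConst L j (cellDens d L μ j) :=
  (cellConst_cell L j).comp fun Q => μ Q * escale L j ^ (-d)

lemma measurable_cellDens (d L : ℝ) (μ : Measure (Euc N)) (j : ℕ) :
    Measurable (cellDens d L μ j) := (cellConst_cellDens d L μ j).measurable

lemma lintegral_mul_cellDens (hL : 0 < L) (d : ℝ) (μ : Measure (Euc N)) {j : ℕ}
    {ψ : Euc N → ℝ≥0∞} (hψ : CellConst L j ψ) :
    ∫⁻ x, ψ x * cellDens d L μ j x = escale L j ^ (N - d) * ∫⁻ x, ψ x ∂μ := by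
  unfold cellDens
  simp only [← mul_assoc]
  rw [lintegral_mul_const' _ _ (escale_rpow_ne_top hL j _), lintegral_cell_swap hψ]
  simp only [volume_cell hL]
  rw [lintegral_mul_const' _ _ (escale_rpow_ne_top hL j _), sub_eq_add_neg, escale_rpow_add hL]
  ring

/-- Finite double sums with geometrically decaying weights. -/
lemma sum_mul_sum_le_of_geometric {r D : ℕ → ℝ≥0∞} {ρ : ℝ≥0∞}
    (hr : ∀ i k, r (i + k) ≤ r i * ρ ^ k) (n : ℕ) :
    ∑ j ∈ Finset.range n, r j * ∑ i ∈ Finset.range (j + 1), D i ≤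
      (1 - ρ)⁻¹ * ∑ i ∈ Finset.range n, r i * D i := by
  simp only [Finset.mul_sum]
  rw [Finset.sum_comm' (t' := Finset.range n) (s' := fun i => Finset.Ico i n)]
  · refine Finset.sum_le_sum fun i _ => ?_
    rw [← Finset.sum_mul, Finset.sum_Ico_eq_sum_range, ← mul_assoc, mul_comm _ (r i)]
    gcongr
    calc ∑ k ∈ Finset.range (n - i), r (i + k)
        ≤ ∑ k ∈ Finset.range (n - i), r i * ρ ^ k := Finset.sum_le_sum fun k _ => hr i k
      _ = r i * ∑ k ∈ Finset.range (n - i), ρ ^ k := by rw [Finset.mul_sum]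
      _ ≤ r i * ∑' k, ρ ^ k := by gcongr; exact ENNReal.sum_le_tsum _
      _ = _ := by rw [ENNReal.tsum_geometric]
  · intro j i
    simp only [Finset.mem_range, Finset.mem_Ico]
    omega

/-- The sum of the powers of the densities is dominated by the power of the maximal density. -/
lemma sum_lintegral_cellDens_rpow_le (hL : 0 < L) {d s : ℝ} (hs : 1 < s)
    (μ : Measure (Euc N)) (n : ℕ) :
    ∑ j ∈ Finset.range n, ∫⁻ x, cellDens d L μ j x ^ s ≤
      (1 - 2 ^ (-(N - d)))⁻¹ *
        ∫⁻ x, ((Finset.range n).sup fun j => cellDens d L μ j x) ^ s := by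
  set a := cellDens d L μ with ha
  set M : ℕ → Euc N → ℝ≥0∞ := fun n x => (Finset.range n).sup fun j => a j x with hM
  have hM0 : ∀ x, M 0 x = 0 := fun x => by simp [hM]
  have hMs : ∀ j x, M (j + 1) x = max (a j x) (M j x) := fun j x => by
    simp only [hM, Finset.range_add_one, Finset.sup_insert]
  have hMc : ∀ j, CellConst L j (M (j + 1)) ∧ CellConst L j (M j) := by
    intro j
    induction j with
    | zero =>
      have h0 : CellConst L 0 (M 0) := fun x y _ => by rw [hM0, hM0]
      refine ⟨?_, h0⟩
      intro x y hxy
      rw [hMs, hMs, ha, cellConst_cellDens d L μ 0 x y hxy, h0 x y hxy]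
    | succ k ih =>
      have h1 := ih.1.mono (Nat.le_succ k)
      refine ⟨?_, h1⟩
      intro x y hxy
      rw [hMs (k + 1), hMs (k + 1), ha, cellConst_cellDens d L μ (k + 1) x y hxy, h1 x y hxy]
  set δ : ℕ → Euc N → ℝ≥0∞ := fun j x => M (j + 1) x ^ (s - 1) - M j x ^ (s - 1) with hδ
  have hδc : ∀ j, CellConst L j (δ j) := fun j =>
    (hMc j).1.comp₂ (hMc j).2 fun u v => u ^ (s - 1) - v ^ (s - 1)
  have hsum : ∀ j x, M j x ^ (s - 1) ≤ ∑ i ∈ Finset.range j, δ i x := by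
    intro j x
    induction j with
    | zero => simp [hM0, sub_pos.2 hs]
    | succ k ih =>
      rw [Finset.sum_range_succ]
      calc M (k + 1) x ^ (s - 1) ≤ δ k x + M k x ^ (s - 1) := le_tsub_add
        _ ≤ δ k x + _ := by gcongr
        _ = _ := add_comm _ _
  have hpow : ∀ u : ℝ≥0∞, u ^ s = u ^ (s - 1) * u := fun u => by
    conv_lhs => rw [show s = (s - 1) + 1 by ring,
      ENNReal.rpow_add_of_nonneg _ _ (sub_pos.2 hs).le zero_le_one, ENNReal.rpow_one]
  have hstep : ∀ j x, δ j x * a j x + M j x ^ s ≤ M (j + 1) x ^ s := by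
    intro j x
    rcases le_total (a j x) (M j x) with h | h
    · have h1 : M (j + 1) x = M j x := by rw [hMs]; exact max_eq_right h
      simp [hδ, h1]
    · have h1 : M (j + 1) x = a j x := by rw [hMs]; exact max_eq_left h
      simp only [hδ, h1]
      rw [hpow (M j x), hpow (a j x)]
      calc _ ≤ (a j x ^ (s - 1) - M j x ^ (s - 1)) * a j x + M j x ^ (s - 1) * a j x := by gcongr
        _ = _ := by
            rw [← add_mul, tsub_add_cancel_of_le (ENNReal.rpow_le_rpow h (sub_pos.2 hs).le)]
  have htel : ∀ j x, ∑ i ∈ Finset.range j, δ i x * a i x ≤ M j x ^ s := by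
    intro j x
    induction j with
    | zero => simp
    | succ k ih =>
      rw [Finset.sum_range_succ]
      calc _ ≤ M k x ^ s + δ k x * a k x := by gcongr
        _ ≤ _ := by rw [add_comm]; exact hstep k x
  have hδm : ∀ j, Measurable (δ j) := fun j => (hδc j).measurable
  have ham : ∀ j, Measurable (a j) := fun j => measurable_cellDens d L μ j
  calc ∑ j ∈ Finset.range n, ∫⁻ x, a j x ^ s
      ≤ ∑ j ∈ Finset.range n, ∫⁻ x, M (j + 1) x ^ (s - 1) * a j x := by
        refine Finset.sum_le_sum fun j _ => lintegral_mono fun x => ?_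
        simp only [hpow (a j x)]
        gcongr
        rw [hMs]; exact le_max_left _ _
    _ = ∑ j ∈ Finset.range n, escale L j ^ (N - d) * ∫⁻ x, M (j + 1) x ^ (s - 1) ∂μ := by
        refine Finset.sum_congr rfl fun j _ => ?_
        exact lintegral_mul_cellDens hL d μ ((hMc j).1.comp (· ^ (s - 1)))
    _ ≤ ∑ j ∈ Finset.range n, escale L j ^ (N - d) *
          ∑ i ∈ Finset.range (j + 1), ∫⁻ x, δ i x ∂μ := by
        refine Finset.sum_le_sum fun j _ => ?_
        rw [← lintegral_finsetSum _ fun i _ => hδm i]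
        gcongr with x
        exact hsum (j + 1) x
    _ ≤ (1 - 2 ^ (-(N - d)))⁻¹ *
          ∑ i ∈ Finset.range n, escale L i ^ (N - d) * ∫⁻ x, δ i x ∂μ :=
        sum_mul_sum_le_of_geometric (fun i k => (escale_add_rpow L i k _).le) n
    _ = (1 - 2 ^ (-(N - d)))⁻¹ * ∫⁻ x, ∑ i ∈ Finset.range n, δ i x * a i x := by
        rw [lintegral_finsetSum (f := fun i x => δ i x * a i x) _ fun i _ => (hδm i).mul (ham i)]
        congr 1
        refine Finset.sum_congr rfl fun j _ => ?_
        exact (lintegral_mul_cellDens hL d μ (hδc j)).symm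
    _ ≤ _ := by
        gcongr with x
        exact htel n x

lemma inv_one_sub_two_rpow_neg_ne_top {a : ℝ} (ha : 0 < a) :
    (1 - (2 : ℝ≥0∞) ^ (-a))⁻¹ ≠ ∞ := by
  rw [ENNReal.inv_ne_top]
  have : (2 : ℝ≥0∞) ^ (-a) < 1 := ENNReal.rpow_lt_one_of_one_lt_of_neg (by norm_num) (by linarith)
  exact (tsub_pos_of_lt this).ne'

lemma cellEnergy_le_lintegral_iSup (hL : 0 < L) {d s : ℝ} (hs : 1 < s) (μ : Measure (Euc N)) :
    cellEnergy d s L μ ≤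
      (1 - 2 ^ (-(N - d)))⁻¹ * ∫⁻ x, (⨆ j, cellDens d L μ j x) ^ s := by
  unfold cellEnergy
  rw [ENNReal.tsum_eq_iSup_nat]
  refine iSup_le fun n => (sum_lintegral_cellDens_rpow_le hL hs μ n).trans ?_
  gcongr with x
  exact Finset.sup_le fun j _ => le_iSup (fun j => cellDens d L μ j x) j

/-- Packing principle: a bound on the cells where the leading term is present extends to all
cells. -/
lemma sum_lintegral_cell_le_of_packing {φ : ℕ → Euc N → ℝ≥0∞} (hφ : ∀ j, Measurable (φ j))
    {τ : Measure (Euc N)}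
    (h : ∀ j x, (∀ y ∈ cell L j x, φ j y = 0) ∨
      ∑' i, ∫⁻ y in cell L j x, φ (j + i) y ≤ τ (cell L j x)) (n j : ℕ) (x : Euc N) :
    ∑ i ∈ Finset.range n, ∫⁻ y in cell L j x, φ (j + i) y ≤ τ (cell L j x) := by
  induction n generalizing j x with
  | zero => simp
  | succ n ih =>
    rcases h j x with h0 | h0
    · rw [Finset.sum_range_succ', add_zero,
        setLIntegral_congr_fun (measurableSet_cell L j x) (g := fun _ => 0) h0,
        lintegral_zero, add_zero, ← lintegral_finsetSum _ fun i _ => hφ _]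
      have key : ∫⁻ y in cell L j x, ∑ i ∈ Finset.range n, φ (j + (i + 1)) y ≤
          ∫⁻ _ in cell L j x, 1 ∂τ := by
        refine lintegral_le_of_cell_le (L := L) (j := j + 1) fun z => ?_
        simp only [Measure.restrict_restrict (measurableSet_cell L (j + 1) z)]
        by_cases hz : z ∈ cell L j x
        · have : cell L (j + 1) z ∩ cell L j x = cell L (j + 1) z := by
            rw [inter_eq_left, ← cell_eq_of_mem hz]
            exact cell_anti (Nat.le_succ j) z
          rw [this, lintegral_finsetSum _ fun i _ => hφ _]
          have := ih (j + 1) z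
          simp only [setLIntegral_one]
          simpa only [add_assoc, add_comm 1] using this
        · have : cell L (j + 1) z ∩ cell L j x = ∅ := by
            rw [← disjoint_iff_inter_eq_empty, disjoint_left]
            intro y hy hyx
            apply hz
            have h1 : cell L j y = cell L j z := cell_eq_of_mem (cell_anti (Nat.le_succ j) z hy)
            rw [← cell_eq_of_mem hyx, h1]
            exact mem_cell_self L j z
          simp [this]
      simpa using key
    · exact (ENNReal.sum_le_tsum _).trans h0

lemma tsum_lintegral_cell_le_of_packing {φ : ℕ → Euc N → ℝ≥0∞} (hφ : ∀ j, Measurable (φ j))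
    {τ : Measure (Euc N)}
    (h : ∀ j x, (∀ y ∈ cell L j x, φ j y = 0) ∨
      ∑' i, ∫⁻ y in cell L j x, φ (j + i) y ≤ τ (cell L j x)) (j : ℕ) (x : Euc N) :
    ∑' i, ∫⁻ y in cell L j x, φ (j + i) y ≤ τ (cell L j x) := by
  rw [ENNReal.tsum_eq_iSup_nat]
  exact iSup_le fun n => sum_lintegral_cell_le_of_packing hφ h n j x

lemma tsum_lintegral_le_of_packing {φ : ℕ → Euc N → ℝ≥0∞} (hφ : ∀ j, Measurable (φ j))
    {τ : Measure (Euc N)}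
    (h : ∀ j x, (∀ y ∈ cell L j x, φ j y = 0) ∨
      ∑' i, ∫⁻ y in cell L j x, φ (j + i) y ≤ τ (cell L j x)) :
    ∑' j, ∫⁻ y, φ j y ≤ τ univ := by
  rw [← lintegral_tsum fun j => (hφ j).aemeasurable, ← setLIntegral_one, Measure.restrict_univ]
  refine lintegral_le_of_cell_le (L := L) (j := 0) fun x => ?_
  rw [lintegral_tsum fun j => (hφ j).aemeasurable, setLIntegral_one]
  have := tsum_lintegral_cell_le_of_packing hφ h 0 x
  simpa using this

lemma exists_dyadic_band {u h : ℝ≥0∞} (hu : u ≠ 0) (huh : u ≤ h) (hh : h ≠ ∞) :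
    ∃ k : ℕ, 2⁻¹ ^ (k + 1) * h < u ∧ u ≤ 2⁻¹ ^ k * h := by
  have hex : ∃ k : ℕ, 2⁻¹ ^ (k + 1) * h < u := by
    have ht : Tendsto (fun k : ℕ => (2⁻¹ : ℝ≥0∞) ^ k * h) atTop (𝓝 (0 * h)) :=
      ENNReal.Tendsto.mul_const (ENNReal.tendsto_pow_atTop_nhds_zero_of_lt_one
        (by norm_num)) (Or.inr hh)
    rw [zero_mul] at ht
    obtain ⟨k, hk⟩ := ((tendsto_add_atTop_iff_nat 1).2 ht |>.eventually_lt_const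
      (pos_iff_ne_zero.2 hu)).exists
    exact ⟨k, hk⟩
  classical
  refine ⟨Nat.find hex, Nat.find_spec hex, ?_⟩
  rcases Nat.eq_zero_or_pos (Nat.find hex) with h0 | h0
  · rw [h0]; simpa using huh
  · have := Nat.find_min hex (Nat.sub_lt h0 one_pos)
    rw [show Nat.find hex - 1 + 1 = Nat.find hex by omega] at this
    exact not_lt.1 this

/-- The factor by which a Carleson packing bound deteriorates. -/
def carlesonConst (s : ℝ) : ℝ≥0∞ := ∑' k : ℕ, ((2⁻¹ : ℝ≥0∞) ^ k) ^ s * 2 ^ (k + 1)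

lemma carlesonConst_ne_top {s : ℝ} (hs : 1 < s) : carlesonConst s ≠ ∞ := by
  have : ∀ k : ℕ, ((2⁻¹ : ℝ≥0∞) ^ k) ^ s * 2 ^ (k + 1) = 2 * ((2 : ℝ≥0∞) ^ (-(s - 1))) ^ k := by
    intro k
    rw [← ENNReal.rpow_natCast, ← ENNReal.rpow_natCast, ← ENNReal.rpow_natCast, ENNReal.inv_rpow,
      ENNReal.inv_rpow, ← ENNReal.rpow_neg, ← ENNReal.rpow_mul, ← ENNReal.rpow_mul,
      ← ENNReal.rpow_add _ _ (by norm_num) (by norm_num)]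
    nth_rw 2 [← ENNReal.rpow_one 2]
    rw [← ENNReal.rpow_add _ _ (by norm_num) (by norm_num)]
    congr 1; push_cast; ring
  unfold carlesonConst
  simp only [this]
  rw [ENNReal.tsum_mul_left, ENNReal.tsum_geometric]
  exact ENNReal.mul_ne_top (by norm_num) (inv_one_sub_two_rpow_neg_ne_top (by linarith))

/-- Carleson embedding in the form needed for the testing condition. -/
lemma cellEnergy_le_of_carleson {d s : ℝ} (hs : 1 < s) {κ : Measure (Euc N)}
    {h : ℕ → Euc N → ℝ≥0∞} {C : ℝ≥0∞} (hh : ∀ j x, h j x ≠ ∞)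
    (hκ : ∀ j x, κ (cell L j x) ≤ h j x) (hc : ∀ j, CellConst L j (h j))
    (hC : ∀ j x, ∑' i, ∫⁻ y in cell L j x, (h (j + i) y * escale L (j + i) ^ (-d)) ^ s ≤
      C * h j x) :
    cellEnergy d s L κ ≤ C * carlesonConst s * κ univ := by
  set B : ℕ → ℕ → Set (Euc N) := fun k j =>
    {x | 2⁻¹ ^ (k + 1) * h j x < κ (cell L j x) ∧ κ (cell L j x) ≤ 2⁻¹ ^ k * h j x} with hB
  have hBc : ∀ k j, CellConst L j (· ∈ B k j) := by
    intro k j x y hxy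
    simp only [hB, mem_ofPred_eq, hc j x y hxy, cellConst_cell L j x y hxy]
  set φ : ℕ → ℕ → Euc N → ℝ≥0∞ := fun k j => (B k j).indicator fun x => cellDens d L κ j x ^ s
  have hφm : ∀ k j, Measurable (φ k j) := fun k j =>
    ((measurable_cellDens d L κ j).pow_const s).indicator (hBc k j).measurableSet
  have hs0 : 0 < s := by linarith
  have hband : ∀ k, ∑' j, ∫⁻ x, φ k j x ≤ C * ((2⁻¹ ^ k) ^ s * 2 ^ (k + 1)) * κ univ := by
    intro k
    have := tsum_lintegral_le_of_packing (L := L) (φ := φ k) (hφm k)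
      (τ := (C * ((2⁻¹ ^ k) ^ s * 2 ^ (k + 1))) • κ) ?_
    · simpa using this
    intro j x
    by_cases hx : x ∈ B k j
    · right
      have h1 : ∀ i y, φ k (j + i) y ≤
          (2⁻¹ ^ k) ^ s * (h (j + i) y * escale L (j + i) ^ (-d)) ^ s := by
        intro i y
        refine indicator_apply_le' (fun hy => ?_) (fun _ => zero_le)
        rw [← ENNReal.mul_rpow_of_nonneg _ _ hs0.le, ← mul_assoc]
        unfold cellDens
        gcongr
        exact hy.2
      have h2 : h j x ≤ 2 ^ (k + 1) * κ (cell L j x) := by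
        calc h j x = 2 ^ (k + 1) * (2⁻¹ ^ (k + 1) * h j x) := by
              rw [← mul_assoc, ← mul_pow, ENNReal.mul_inv_cancel (by norm_num) (by norm_num),
                one_pow, one_mul]
          _ ≤ _ := by gcongr; exact hx.1.le
      calc ∑' i, ∫⁻ y in cell L j x, φ k (j + i) y
          ≤ ∑' i, (2⁻¹ ^ k) ^ s *
              ∫⁻ y in cell L j x, (h (j + i) y * escale L (j + i) ^ (-d)) ^ s := by
            refine ENNReal.tsum_le_tsum fun i => ?_
            rw [← lintegral_const_mul' _ _ (by finiteness)]
            exact lintegral_mono fun y => h1 i y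
        _ ≤ (2⁻¹ ^ k) ^ s * (C * (2 ^ (k + 1) * κ (cell L j x))) := by
            rw [ENNReal.tsum_mul_left]
            gcongr
            refine (hC j x).trans ?_
            gcongr
        _ = _ := by
            simp only [Measure.smul_apply, smul_eq_mul]; ring
    · left
      intro y hy
      refine indicator_of_notMem ?_ _
      have : (y ∈ B k j) = (x ∈ B k j) := hBc k j y x hy
      rwa [this]
  have hle : ∀ j x, cellDens d L κ j x ^ s ≤ ∑' k, φ k j x := by
    intro j x
    by_cases h0 : κ (cell L j x) = 0
    · simp [cellDens, h0, hs0]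
    · obtain ⟨k, hk⟩ := exists_dyadic_band h0 (hκ j x) (hh j x)
      refine le_trans ?_ (ENNReal.le_tsum k)
      have hx : x ∈ B k j := hk
      simp only [φ, indicator_of_mem hx, le_refl]
  calc cellEnergy d s L κ ≤ ∑' j, ∫⁻ x, ∑' k, φ k j x :=
        ENNReal.tsum_le_tsum fun j => lintegral_mono fun x => hle j x
    _ = ∑' j, ∑' k, ∫⁻ x, φ k j x := by
        refine tsum_congr fun j => ?_
        rw [lintegral_tsum fun k => (hφm k j).aemeasurable]
    _ = ∑' k, ∑' j, ∫⁻ x, φ k j x := ENNReal.tsum_comm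
    _ ≤ ∑' k : ℕ, C * ((2⁻¹ ^ k) ^ s * 2 ^ (k + 1)) * κ univ := ENNReal.tsum_le_tsum hband
    _ = _ := by rw [ENNReal.tsum_mul_right, ENNReal.tsum_mul_left, carlesonConst]

/-- The distance of two natural numbers. -/
def natGap (i j : ℕ) : ℕ := (i - j) + (j - i)

lemma natGap_comm (i j : ℕ) : natGap i j = natGap j i := by unfold natGap; omega

lemma natGap_add (i k : ℕ) : natGap i (i + k) = k := by unfold natGap; omega

lemma tsum_if_le (g : ℕ → ℝ≥0∞) (j : ℕ) :
    ∑' i, (if j ≤ i then g i else 0) = ∑' k, g (j + k) := by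
  rw [← ENNReal.summable.sum_add_tsum_nat_add' (k := j) (f := fun i => if j ≤ i then g i else 0)]
  rw [Finset.sum_eq_zero, zero_add]
  · refine tsum_congr fun k => ?_
    simp [add_comm]
  · intro i hi
    rw [Finset.mem_range] at hi
    simp [hi]

/-- A double series is bounded by the sums over its two halves. -/
lemma tsum_tsum_le_halves (H : ℕ → ℕ → ℝ≥0∞) :
    ∑' i, ∑' j, H i j ≤ (∑' i, ∑' k, H i (i + k)) + ∑' j, ∑' k, H (j + k) j := by
  have h1 : ∀ i j, H i j ≤ (if i ≤ j then H i j else 0) + (if j ≤ i then H i j else 0) := by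
    intro i j
    rcases le_total i j with h | h
    · rw [if_pos h]; exact le_self_add
    · rw [if_pos h]; exact le_add_self
  calc _ ≤ ∑' i, ∑' j, ((if i ≤ j then H i j else 0) + (if j ≤ i then H i j else 0)) :=
        ENNReal.tsum_le_tsum fun i => ENNReal.tsum_le_tsum fun j => h1 i j
    _ = (∑' i, ∑' j, if i ≤ j then H i j else 0) + ∑' i, ∑' j, if j ≤ i then H i j else 0 := by
        simp only [ENNReal.tsum_add]
    _ = _ := by
        congr 1
        · exact tsum_congr fun i => tsum_if_le (H i) i
        · rw [ENNReal.tsum_comm]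
          exact tsum_congr fun j => tsum_if_le (fun i => H i j) j

lemma tsum_inv_pow_natGap_le (B : ℝ≥0∞) (m : ℕ) :
    ∑' j, (B ^ natGap j m)⁻¹ ≤ 2 * (1 - B⁻¹)⁻¹ := by
  calc ∑' j, (B ^ natGap j m)⁻¹ = (∑ j ∈ Finset.range m, (B ^ natGap j m)⁻¹) +
        ∑' k, (B ^ natGap (k + m) m)⁻¹ := (ENNReal.summable.sum_add_tsum_nat_add' ..).symm
    _ ≤ (1 - B⁻¹)⁻¹ + (1 - B⁻¹)⁻¹ := by
        gcongr
        · rw [← Finset.sum_range_reflect, ← ENNReal.tsum_geometric]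
          calc _ ≤ ∑ j ∈ Finset.range m, B⁻¹ ^ (j + 1) := by
                refine Finset.sum_le_sum fun j hj => ?_
                rw [Finset.mem_range] at hj
                rw [show natGap (m - 1 - j) m = j + 1 by unfold natGap; omega, ENNReal.inv_pow]
            _ ≤ ∑' j, B⁻¹ ^ (j + 1) := ENNReal.sum_le_tsum _
            _ ≤ ∑' j, B⁻¹ ^ j :=
                ENNReal.tsum_comp_le_tsum_of_injective (add_left_injective 1) (fun j => B⁻¹ ^ j)
        · rw [← ENNReal.tsum_geometric]
          refine ENNReal.tsum_le_tsum fun k => ?_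
          rw [show natGap (k + m) m = k by unfold natGap; omega, ENNReal.inv_pow]
    _ = _ := by ring

lemma exists_sum_le_natGap_mul {B : ℝ≥0∞} (hB : 1 ≤ B) (hB' : B ≠ ∞) (v : ℕ → ℝ≥0∞)
    (n m : ℕ) : ∃ j ∈ Finset.range (n + 1), ∑ i ∈ Finset.range (n + 1), v i ≤
      2 * (1 - B⁻¹)⁻¹ * (B ^ natGap j m * v j) := by
  obtain ⟨j, hj, hmax⟩ := (Finset.range (n + 1)).exists_max_image
    (fun j => B ^ natGap j m * v j) ⟨0, by simp⟩
  have hB0 : B ≠ 0 := (zero_lt_one.trans_le hB).ne'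
  refine ⟨j, hj, ?_⟩
  calc ∑ i ∈ Finset.range (n + 1), v i
      ≤ ∑ i ∈ Finset.range (n + 1), (B ^ natGap i m)⁻¹ * (B ^ natGap j m * v j) := by
        refine Finset.sum_le_sum fun i hi => ?_
        calc v i = (B ^ natGap i m)⁻¹ * (B ^ natGap i m * v i) := by
              rw [← mul_assoc, ENNReal.inv_mul_cancel (pow_ne_zero _ hB0)
                (ENNReal.pow_ne_top hB'), one_mul]
          _ ≤ _ := by gcongr _ * ?_; exact hmax i hi
    _ = (∑ i ∈ Finset.range (n + 1), (B ^ natGap i m)⁻¹) * (B ^ natGap j m * v j) := by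
        rw [Finset.sum_mul]
    _ ≤ _ := by
        gcongr
        exact (ENNReal.sum_le_tsum _).trans (tsum_inv_pow_natGap_le B m)

lemma mul_le_of_forall_partial_sums {q1 q2 : ℝ} (hq1 : 0 < q1) (hq2 : 0 < q2)
    (u v : ℕ → ℝ≥0∞) {D : ℝ≥0∞}
    (h : ∀ n, (∑ i ∈ Finset.range (n + 1), u i) ^ q1 *
      (∑ j ∈ Finset.range (n + 1), v j) ^ q2 ≤ D) :
    (∑' i, u i) ^ q1 * (∑' j, v j) ^ q2 ≤ D := by
  have hpow : ∀ {r : ℝ}, 0 < r → ∀ f : ℕ → ℝ≥0∞, (∑' i, f i) ^ r =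
      ⨆ n, (∑ i ∈ Finset.range n, f i) ^ r := by
    intro r hr f
    rw [ENNReal.tsum_eq_iSup_nat]
    exact (ENNReal.orderIsoRpow r hr).map_iSup _
  rw [hpow hq1, hpow hq2, ENNReal.iSup_mul]
  refine iSup_le fun n => ?_
  rw [ENNReal.mul_iSup]
  refine iSup_le fun m => le_trans ?_ (h (max n m))
  gcongr <;> omega

/-- A product of powers of two series is controlled by an almost diagonal double series. -/
lemma exists_tsum_rpow_mul_tsum_rpow_le {q1 q2 ε : ℝ} (hq1 : 0 < q1) (hq2 : 0 < q2)
    (hε : 0 < ε) : ∃ C : ℝ≥0∞, C ≠ ∞ ∧ ∀ u v : ℕ → ℝ≥0∞,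
      (∑' i, u i) ^ q1 * (∑' j, v j) ^ q2 ≤
        C * ∑' i, ∑' j, ((2 : ℝ≥0∞) ^ ε) ^ natGap i j * (u i ^ q1 * v j ^ q2) := by
  set B : ℝ≥0∞ := 2 ^ (ε / (q1 + q2)) with hB
  have hq : 0 < q1 + q2 := by positivity
  have hη : 0 < ε / (q1 + q2) := by positivity
  have hB1 : 1 ≤ B := ENNReal.one_le_rpow (by norm_num) hη
  have hBt : B ≠ ∞ := by finiteness
  have hB0 : B ≠ 0 := (zero_lt_one.trans_le hB1).ne'
  have hBq : B ^ (q1 + q2) = 2 ^ ε := by rw [hB, ← ENNReal.rpow_mul, div_mul_cancel₀ _ hq.ne']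
  set G : ℝ≥0∞ := 2 * (1 - B⁻¹)⁻¹
  have hG : G ≠ ∞ := by
    refine ENNReal.mul_ne_top (by norm_num) ?_
    have := inv_one_sub_two_rpow_neg_ne_top hη
    rwa [ENNReal.rpow_neg] at this
  have hpowB : ∀ k : ℕ, (B ^ k) ^ q1 * (B ^ k) ^ q2 = (2 ^ ε) ^ k := by
    intro k
    rw [← ENNReal.rpow_add_of_nonneg _ _ hq1.le hq2.le, ← hBq, ← ENNReal.rpow_natCast,
      ← ENNReal.rpow_natCast, ← ENNReal.rpow_mul B, ← ENNReal.rpow_mul B, mul_comm]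
  refine ⟨G ^ q1 * G ^ q2, by finiteness, fun u v => ?_⟩
  refine mul_le_of_forall_partial_sums hq1 hq2 u v fun n => ?_
  obtain ⟨i0, hi0, hmax⟩ := (Finset.range (n + 1)).exists_max_image u ⟨0, by simp⟩
  obtain ⟨j1, hj1, hv⟩ := exists_sum_le_natGap_mul hB1 hBt v n i0
  obtain ⟨i1, hi1, hu⟩ := exists_sum_le_natGap_mul hB1 hBt u n j1
  have key : ∃ i j : ℕ, (B ^ natGap i1 j1 * u i1) ^ q1 * (B ^ natGap j1 i0 * v j1) ^ q2 ≤
      (2 ^ ε) ^ natGap i j * (u i ^ q1 * v j ^ q2) := by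
    have aux : ∀ (i : ℕ), natGap i1 j1 ≤ natGap i j1 → natGap j1 i0 ≤ natGap i j1 →
        u i1 ≤ u i → (B ^ natGap i1 j1 * u i1) ^ q1 * (B ^ natGap j1 i0 * v j1) ^ q2 ≤
      (2 ^ ε) ^ natGap i j1 * (u i ^ q1 * v j1 ^ q2) := by
      intro i h1 h2 h3
      calc _ ≤ (B ^ natGap i j1 * u i) ^ q1 * (B ^ natGap i j1 * v j1) ^ q2 := by
            gcongr
        _ = _ := by
            rw [ENNReal.mul_rpow_of_nonneg _ _ hq1.le, ENNReal.mul_rpow_of_nonneg _ _ hq2.le,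
              ← hpowB]
            ring
    rcases le_total (natGap j1 i0) (natGap i1 j1) with h | h
    · exact ⟨i1, j1, aux i1 le_rfl h le_rfl⟩
    · refine ⟨i0, j1, aux i0 ?_ ?_ (hmax i1 hi1)⟩
      · rwa [natGap_comm i0]
      · rw [natGap_comm i0]
  obtain ⟨i, j, hij⟩ := key
  calc _ ≤ (G * (B ^ natGap i1 j1 * u i1)) ^ q1 * (G * (B ^ natGap j1 i0 * v j1)) ^ q2 := by
        gcongr
    _ = G ^ q1 * G ^ q2 *
        ((B ^ natGap i1 j1 * u i1) ^ q1 * (B ^ natGap j1 i0 * v j1) ^ q2) := by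
        rw [ENNReal.mul_rpow_of_nonneg _ _ hq1.le, ENNReal.mul_rpow_of_nonneg _ _ hq2.le]; ring
    _ ≤ _ := by
        gcongr
        refine hij.trans ?_
        exact (ENNReal.le_tsum (f := fun j => ((2 : ℝ≥0∞) ^ ε) ^ natGap i j *
          (u i ^ q1 * v j ^ q2)) j).trans (ENNReal.le_tsum (f := fun i => ∑' j,
            ((2 : ℝ≥0∞) ^ ε) ^ natGap i j * (u i ^ q1 * v j ^ q2)) i)

lemma exists_tsum_rpow_le {q ε : ℝ} (hq : 0 < q) (hε : 0 < ε) :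
    ∃ C : ℝ≥0∞, C ≠ ∞ ∧ ∀ v : ℕ → ℝ≥0∞,
      (∑' j, v j) ^ q ≤ C * ∑' j, ((2 : ℝ≥0∞) ^ ε) ^ j * v j ^ q := by
  obtain ⟨C, hC, h⟩ := exists_tsum_rpow_mul_tsum_rpow_le one_pos hq hε
  refine ⟨C, hC, fun v => ?_⟩
  have := h (fun i => if i = 0 then 1 else 0) v
  rw [tsum_eq_single (f := fun i : ℕ => if i = 0 then (1 : ℝ≥0∞) else 0) 0
      (by intro b hb; simp [hb]),
    tsum_eq_single (f := fun i : ℕ => ∑' j, ((2 : ℝ≥0∞) ^ ε) ^ natGap i j *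
      ((if i = 0 then (1 : ℝ≥0∞) else 0) ^ (1 : ℝ) * v j ^ q)) 0
      (by intro b hb; simp [hb])] at this
  simpa [natGap] using this

lemma measurable_measure_ball (μ : Measure (Euc N)) [SFinite μ] (r : ℝ) :
    Measurable fun x => μ (ball x r) := by
  have hm : MeasurableSet {z : Euc N × Euc N | dist z.2 z.1 < r} :=
    measurableSet_lt (by fun_prop) measurable_const
  exact measurable_measure_prodMk_left hm

lemma lintegral_measure_ball_swap (μ ν : Measure (Euc N)) [SFinite μ] [SFinite ν]
    (f : Euc N → ℝ≥0∞) (hf : Measurable f) (r : ℝ) :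
    ∫⁻ z, ∫⁻ x in ball z r, f x ∂ν ∂μ = ∫⁻ x, f x * μ (ball x r) ∂ν := by
  have hm : MeasurableSet {z : Euc N × Euc N | dist z.2 z.1 < r} :=
    measurableSet_lt (by fun_prop) measurable_const
  calc ∫⁻ z, ∫⁻ x in ball z r, f x ∂ν ∂μ
      = ∫⁻ z, ∫⁻ x, {w : Euc N × Euc N | dist w.2 w.1 < r}.indicator (fun w => f w.2) (z, x)
          ∂ν ∂μ := by
        refine lintegral_congr fun z => ?_
        rw [← lintegral_indicator measurableSet_ball]
        rfl
    _ = ∫⁻ x, ∫⁻ z, {w : Euc N × Euc N | dist w.2 w.1 < r}.indicator (fun w => f w.2) (z, x)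
          ∂μ ∂ν := by
        refine lintegral_lintegral_swap ?_
        exact ((hf.comp measurable_snd).indicator hm).aemeasurable
    _ = _ := by
        refine lintegral_congr fun x => ?_
        rw [← setLIntegral_const, ← lintegral_indicator measurableSet_ball]
        refine lintegral_congr fun z => ?_
        simp only [indicator, mem_ofPred_eq, mem_ball, dist_comm z x]

lemma volume_ball_eq (x : Euc N) {r : ℝ} (hr : 0 < r) :
    volume (ball x r) = volume (ball (0 : Euc N) 1) * ENNReal.ofReal r ^ (N : ℝ) := by
  rw [Measure.addHaar_ball_of_pos _ x hr, mul_comm]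
  simp [ENNReal.ofReal_pow hr.le]

lemma volume_ball_dscale (hL : 0 < L) (j : ℕ) (x : Euc N) :
    volume (ball x (dscale L j)) = volume (ball (0 : Euc N) 1) * escale L j ^ (N : ℝ) :=
  volume_ball_eq x (dscale_pos hL j)

lemma volume_unit_ball_ne_zero (N : ℕ) : volume (ball (0 : Euc N) 1) ≠ 0 :=
  (measure_ball_pos _ _ one_pos).ne'

lemma volume_unit_ball_ne_top (N : ℕ) : volume (ball (0 : Euc N) 1) ≠ ∞ := measure_ball_lt_top.ne

/-- The summands of the discretized Wolff potential. -/
def ballTerm (e z L : ℝ) (μ : Measure (Euc N)) (j : ℕ) (x : Euc N) : ℝ≥0∞ :=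
  μ (ball x (dscale L j)) ^ e * escale L j ^ (-z)

lemma measurable_ballTerm (e z L : ℝ) (μ : Measure (Euc N)) [SFinite μ] (j : ℕ) :
    Measurable (ballTerm e z L μ j) :=
  ((measurable_measure_ball μ _).pow_const e).mul_const _

/-- Averages over a ball of powers of masses of smaller balls. -/
lemma setLIntegral_ball_rpow_le (hL : 0 < L) (μ : Measure (Euc N)) [SFinite μ] {κ : ℝ}
    (hκ : 0 < κ) (i k : ℕ) (z : Euc N) :
    ∫⁻ x in ball z (dscale L i), μ (ball x (dscale L (i + k))) ^ κ ≤
      volume (ball (0 : Euc N) 1) * escale L i ^ (N : ℝ) *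
        ((2 : ℝ≥0∞) ^ (-(N * min 1 κ))) ^ k * μ (ball z (2 * dscale L i)) ^ κ := by
  set t := dscale L i
  set r := dscale L (i + k) with hr
  set V := volume (ball (0 : Euc N) 1)
  set m := μ (ball z (2 * t)) with hm
  have hrt : r ≤ t := dscale_anti hL (Nat.le_add_right i k)
  have hsub : ∀ x ∈ ball z t, ball x r ⊆ ball z (2 * t) := by
    intro x hx
    refine ball_subset_ball' ?_
    rw [mem_ball] at hx
    linarith
  have hX0 : V * escale L i ^ (N : ℝ) ≠ 0 :=
    mul_ne_zero (volume_unit_ball_ne_zero N) (escale_rpow_ne_zero hL i _)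
  have hXt : V * escale L i ^ (N : ℝ) ≠ ∞ :=
    ENNReal.mul_ne_top (volume_unit_ball_ne_top N) (escale_rpow_ne_top hL i _)
  have hI : ∫⁻ x in ball z t, μ (ball x r) ≤
      V * escale L i ^ (N : ℝ) * ((2 : ℝ≥0∞) ^ (-(N : ℝ))) ^ k * m := by
    calc ∫⁻ x in ball z t, μ (ball x r)
        ≤ ∫⁻ x in ball z t, 1 * μ.restrict (ball z (2 * t)) (ball x r) := by
          refine setLIntegral_mono' measurableSet_ball fun x hx => ?_
          rw [Measure.restrict_apply measurableSet_ball, inter_eq_left.2 (hsub x hx), one_mul]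
      _ ≤ ∫⁻ x, 1 * μ.restrict (ball z (2 * t)) (ball x r) := setLIntegral_le_lintegral _ _
      _ = ∫⁻ y, ∫⁻ _ in ball y r, 1 ∂volume ∂(μ.restrict (ball z (2 * t))) :=
          (lintegral_measure_ball_swap _ _ _ measurable_const _).symm
      _ = V * escale L (i + k) ^ (N : ℝ) * m := by
          simp only [setLIntegral_one, hr, volume_ball_dscale hL]
          rw [lintegral_const, Measure.restrict_apply_univ]
      _ = _ := by rw [escale_add_rpow]; ring
  rcases le_total 1 κ with h1 | h1
  · rw [min_eq_left h1, mul_one]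
    have hpow : ∀ u : ℝ≥0∞, u ^ κ = u ^ (κ - 1) * u := fun u => by
      conv_lhs => rw [show κ = (κ - 1) + 1 by ring,
        ENNReal.rpow_add_of_nonneg _ _ (sub_nonneg.2 h1) zero_le_one, ENNReal.rpow_one]
    calc ∫⁻ x in ball z t, μ (ball x r) ^ κ ≤ ∫⁻ x in ball z t, m ^ (κ - 1) * μ (ball x r) := by
          refine setLIntegral_mono' measurableSet_ball fun x hx => ?_
          rw [hpow]
          exact mul_le_mul_left (ENNReal.rpow_le_rpow (measure_mono (hsub x hx))
            (sub_nonneg.2 h1)) _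
      _ = m ^ (κ - 1) * ∫⁻ x in ball z t, μ (ball x r) :=
          lintegral_const_mul _ (measurable_measure_ball μ r)
      _ ≤ m ^ (κ - 1) * (V * escale L i ^ (N : ℝ) * ((2 : ℝ≥0∞) ^ (-(N : ℝ))) ^ k * m) := by
          gcongr
      _ = _ := by rw [hpow m]; ring
  · rw [min_eq_right h1]
    have hH := ENNReal.lintegral_mul_norm_pow_le (μ := volume.restrict (ball z t))
      (f := fun x => μ (ball x r)) (g := fun _ => 1)
      (measurable_measure_ball μ r).aemeasurable aemeasurable_const hκ.le (sub_nonneg.2 h1)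
      (by ring)
    simp only [ENNReal.one_rpow, mul_one] at hH
    refine hH.trans ?_
    rw [setLIntegral_one, volume_ball_dscale hL]
    calc _ ≤ (V * escale L i ^ (N : ℝ) * ((2 : ℝ≥0∞) ^ (-(N : ℝ))) ^ k * m) ^ κ *
          (V * escale L i ^ (N : ℝ)) ^ (1 - κ) := by gcongr
      _ = (V * escale L i ^ (N : ℝ)) ^ κ * (V * escale L i ^ (N : ℝ)) ^ (1 - κ) *
          (((2 : ℝ≥0∞) ^ (-(N : ℝ))) ^ k) ^ κ * m ^ κ := by
          rw [ENNReal.mul_rpow_of_nonneg _ _ hκ.le, ENNReal.mul_rpow_of_nonneg _ _ hκ.le]; ring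
      _ = _ := by
          rw [← ENNReal.rpow_add _ _ hX0 hXt, add_sub_cancel, ENNReal.rpow_one]
          congr 2
          rw [← ENNReal.rpow_natCast, ← ENNReal.rpow_natCast, ← ENNReal.rpow_mul,
            ← ENNReal.rpow_mul, ← ENNReal.rpow_mul]
          congr 1; ring

/-- Averaging identity. -/
lemma lintegral_lintegral_ball (f : Euc N → ℝ≥0∞) (hf : Measurable f) (hL : 0 < L) (i : ℕ) :
    ∫⁻ z, ∫⁻ x in ball z (dscale L i), f x =
      (volume (ball (0 : Euc N) 1) * escale L i ^ (N : ℝ)) * ∫⁻ x, f x := by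
  rw [lintegral_measure_ball_swap _ _ f hf]
  simp only [volume_ball_dscale hL]
  rw [lintegral_mul_const _ hf, mul_comm]

lemma lintegral_ball_rpow_mul_rpow_le (hL : 0 < L) (μ : Measure (Euc N)) [SFinite μ] {κ κ' : ℝ}
    (hκ : 0 < κ) (hκ' : 0 < κ') (i k : ℕ) :
    ∫⁻ x, μ (ball x (dscale L i)) ^ κ' * μ (ball x (dscale L (i + k))) ^ κ ≤
      ((2 : ℝ≥0∞) ^ (-(N * min 1 κ))) ^ k * ∫⁻ z, μ (ball z (2 * dscale L i)) ^ (κ' + κ) := by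
  set V := volume (ball (0 : Euc N) 1)
  have hX0 : V * escale L i ^ (N : ℝ) ≠ 0 :=
    mul_ne_zero (volume_unit_ball_ne_zero N) (escale_rpow_ne_zero hL i _)
  have hXt : V * escale L i ^ (N : ℝ) ≠ ∞ :=
    ENNReal.mul_ne_top (volume_unit_ball_ne_top N) (escale_rpow_ne_top hL i _)
  have hm : ∀ (j : ℕ) (a : ℝ), Measurable fun x => μ (ball x (dscale L j)) ^ a := fun j a =>
    (measurable_measure_ball μ _).pow_const a
  rw [← ENNReal.mul_le_mul_iff_right hX0 hXt, ← lintegral_lintegral_ball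
    (fun x => μ (ball x (dscale L i)) ^ κ' * μ (ball x (dscale L (i + k))) ^ κ)
    ((hm _ _).mul (hm _ _)) hL]
  calc _ ≤ ∫⁻ z, μ (ball z (2 * dscale L i)) ^ κ' *
        ∫⁻ x in ball z (dscale L i), μ (ball x (dscale L (i + k))) ^ κ := by
        refine lintegral_mono fun z => ?_
        rw [← lintegral_const_mul _ (hm _ _)]
        refine setLIntegral_mono' measurableSet_ball fun x hx => ?_
        gcongr
        refine ball_subset_ball' ?_
        rw [mem_ball] at hx
        linarith
    _ ≤ ∫⁻ z, (V * escale L i ^ (N : ℝ) * ((2 : ℝ≥0∞) ^ (-(N * min 1 κ))) ^ k) *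
          μ (ball z (2 * dscale L i)) ^ (κ' + κ) := by
        refine lintegral_mono fun z => ?_
        calc _ ≤ _ := mul_le_mul_right (setLIntegral_ball_rpow_le hL μ hκ i k z) _
          _ = _ := by rw [ENNReal.rpow_add_of_nonneg _ _ hκ'.le hκ.le]; ring
    _ = _ := by
        rw [lintegral_const_mul _ ((measurable_measure_ball μ _).pow_const _)]; ring

lemma lintegral_cellDens_rpow (hL : 0 < L) {d s : ℝ} (hs : 0 < s) (μ : Measure (Euc N)) (j : ℕ) :
    ∫⁻ x, cellDens d L μ j x ^ s = escale L j ^ (-(d * s)) * ∫⁻ x, μ (cell L j x) ^ s := by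
  rw [← lintegral_const_mul' _ _ (escale_rpow_ne_top hL j _)]
  refine lintegral_congr fun x => ?_
  rw [cellDens, ENNReal.mul_rpow_of_nonneg _ _ hs.le, ← ENNReal.rpow_mul, mul_comm, neg_mul]

lemma exists_lintegral_ball_le_cellDens (N m : ℕ) {d s : ℝ} (hs : 0 < s) :
    ∃ C : ℝ≥0∞, C ≠ ∞ ∧ ∀ (L : ℝ), 0 < L → ∀ (j : ℕ) (μ : Measure (Euc N)),
      escale L j ^ (-(d * s)) * ∫⁻ x, μ (ball x (m * dscale L j)) ^ s ≤
        C * ∫⁻ x, cellDens d L μ j x ^ s := by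
  obtain ⟨C, hC, h⟩ := exists_lintegral_ball_rpow_le N m hs
  refine ⟨C, hC, fun L hL j μ => ?_⟩
  rw [lintegral_cellDens_rpow hL hs]
  calc _ ≤ _ := mul_le_mul_right (h L hL j μ) _
    _ = _ := by ring

lemma two_rpow_mul_two_rpow_neg_pow (a b : ℝ) (k : ℕ) :
    ((2 : ℝ≥0∞) ^ a) ^ k * ((2 : ℝ≥0∞) ^ b) ^ k = ((2 : ℝ≥0∞) ^ (a + b)) ^ k := by
  rw [← mul_pow, ENNReal.rpow_add _ _ (by norm_num) (by norm_num)]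

/-- Two-scale estimate when the singular factor lives at the smaller scale. -/
lemma lintegral_ballTerm_mul_le_of_ge {e q1 q2 x1 y1 d s : ℝ} (he : 0 < e) (hq1 : 0 < q1)
    (hq2 : 0 < q2) (hs : s = e * (q1 + q2)) (hd : q1 * x1 + q2 * y1 = d * s) (hL : 0 < L)
    (μ : Measure (Euc N)) [SFinite μ] (i k : ℕ) :
    ∫⁻ x, ballTerm e x1 L μ i x ^ q1 * ballTerm e y1 L μ (i + k) x ^ q2 ≤
      ((2 : ℝ≥0∞) ^ (-(N * min 1 (e * q2) - q2 * y1))) ^ k *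
        (escale L i ^ (-(d * s)) * ∫⁻ x, μ (ball x ((2 : ℕ) * dscale L i)) ^ s) := by
  calc _ = ∫⁻ x, escale L i ^ (-(d * s)) * ((2 : ℝ≥0∞) ^ (q2 * y1)) ^ k *
        (μ (ball x (dscale L i)) ^ (e * q1) * μ (ball x (dscale L (i + k))) ^ (e * q2)) := by
        refine lintegral_congr fun x => ?_
        unfold ballTerm
        rw [ENNReal.mul_rpow_of_nonneg _ _ hq1.le, ENNReal.mul_rpow_of_nonneg _ _ hq2.le,
          ← ENNReal.rpow_mul, ← ENNReal.rpow_mul, ← ENNReal.rpow_mul, ← ENNReal.rpow_mul,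
          escale_add_rpow, ← hd, show -(q1 * x1 + q2 * y1) = -x1 * q1 + -y1 * q2 by ring,
          escale_rpow_add hL, show -(-y1 * q2) = q2 * y1 by ring]
        ring
    _ = escale L i ^ (-(d * s)) * ((2 : ℝ≥0∞) ^ (q2 * y1)) ^ k *
        ∫⁻ x, μ (ball x (dscale L i)) ^ (e * q1) * μ (ball x (dscale L (i + k))) ^ (e * q2) :=
        lintegral_const_mul' _ _ (ENNReal.mul_ne_top (escale_rpow_ne_top hL _ _) (by finiteness))
    _ ≤ escale L i ^ (-(d * s)) * ((2 : ℝ≥0∞) ^ (q2 * y1)) ^ k *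
        (((2 : ℝ≥0∞) ^ (-(N * min 1 (e * q2)))) ^ k *
          ∫⁻ z, μ (ball z (2 * dscale L i)) ^ (e * q1 + e * q2)) := by
        gcongr
        exact lintegral_ball_rpow_mul_rpow_le hL μ (by positivity) (by positivity) i k
    _ = _ := by
        rw [hs, mul_add, show -(N * min 1 (e * q2) - q2 * y1) =
          q2 * y1 + -(N * min 1 (e * q2)) by ring, ← two_rpow_mul_two_rpow_neg_pow]
        push_cast
        ring

/-- Two-scale estimate when the regular factor lives at the smaller scale. -/
lemma ballTerm_mul_le_of_le {e q1 q2 x1 y1 d s : ℝ} (he : 0 < e) (hq1 : 0 < q1)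
    (hq2 : 0 < q2) (hs : s = e * (q1 + q2)) (hd : q1 * x1 + q2 * y1 = d * s) (hL : 0 < L)
    (μ : Measure (Euc N)) (j k : ℕ) (x : Euc N) :
    ballTerm e x1 L μ (j + k) x ^ q1 * ballTerm e y1 L μ j x ^ q2 ≤
      ((2 : ℝ≥0∞) ^ (-(q1 * q2 * (y1 - x1) / (q1 + q2)))) ^ k *
        (escale L (j + k) ^ (-(d * s)) * μ (ball x (dscale L (j + k))) ^ s +
          escale L j ^ (-(d * s)) * μ (ball x (dscale L j)) ^ s) := by
  set f : ℕ → ℝ≥0∞ := fun i => escale L i ^ (-(d * s)) * μ (ball x (dscale L i)) ^ s with hf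
  set δ := q1 * q2 * (y1 - x1) / (q1 + q2) with hδ
  have hq : 0 < q1 + q2 := by positivity
  have hθ1 : 0 ≤ q1 / (q1 + q2) := by positivity
  have hθ2 : 0 ≤ q2 / (q1 + q2) := by positivity
  have hfp : ∀ (i : ℕ) (q : ℝ), 0 ≤ q / (q1 + q2) → f i ^ (q / (q1 + q2)) =
      escale L i ^ (-(d * s) * (q / (q1 + q2))) * μ (ball x (dscale L i)) ^ (e * q) := by
    intro i q hq'
    rw [hf]
    simp only
    rw [ENNReal.mul_rpow_of_nonneg _ _ hq', ← ENNReal.rpow_mul, ← ENNReal.rpow_mul]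
    congr 2
    rw [hs]; field_simp
  have hmean : f (j + k) ^ (q1 / (q1 + q2)) * f j ^ (q2 / (q1 + q2)) ≤ f (j + k) + f j := by
    calc _ ≤ (f (j + k) + f j) ^ (q1 / (q1 + q2)) * (f (j + k) + f j) ^ (q2 / (q1 + q2)) := by
          gcongr
          · exact le_self_add
          · exact le_add_self
      _ = _ := by
          rw [← ENNReal.rpow_add_of_nonneg _ _ hθ1 hθ2, ← add_div, div_self hq.ne',
            ENNReal.rpow_one]
  have e1 : -x1 * q1 = -(d * s) * (q1 / (q1 + q2)) + δ := by
    rw [← hd, hδ]; field_simp; ring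
  have e2 : -y1 * q2 = -(d * s) * (q2 / (q1 + q2)) + -δ := by
    rw [← hd, hδ]; field_simp; ring
  calc _ = (escale L (j + k) ^ δ * escale L j ^ (-δ)) *
        (f (j + k) ^ (q1 / (q1 + q2)) * f j ^ (q2 / (q1 + q2))) := by
        rw [hfp _ _ hθ1, hfp _ _ hθ2]
        unfold ballTerm
        rw [ENNReal.mul_rpow_of_nonneg _ _ hq1.le, ENNReal.mul_rpow_of_nonneg _ _ hq2.le,
          ← ENNReal.rpow_mul, ← ENNReal.rpow_mul, ← ENNReal.rpow_mul, ← ENNReal.rpow_mul,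
          e1, e2, escale_rpow_add hL, escale_rpow_add hL]
        ring
    _ = ((2 : ℝ≥0∞) ^ (-δ)) ^ k * (f (j + k) ^ (q1 / (q1 + q2)) * f j ^ (q2 / (q1 + q2))) := by
        congr 1
        rw [escale_add_rpow, mul_comm, ← mul_assoc, ← escale_rpow_add hL]
        simp
    _ ≤ _ := by gcongr

/-- The dyadic Wolff-type inequality. -/
theorem exists_lintegral_tsum_ballTerm_le {e q1 q2 x1 y1 d s : ℝ} (he : 0 < e) (hq1 : 0 < q1)
    (hq2 : 0 < q2) (hxy : x1 < y1) (hs : s = e * (q1 + q2))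
    (hd : q1 * x1 + q2 * y1 = d * s) (hN : q2 * y1 < N * min 1 (e * q2)) :
    ∃ C : ℝ≥0∞, C ≠ ∞ ∧ ∀ L : ℝ, 0 < L → ∀ (μ : Measure (Euc N)) [SFinite μ],
      ∫⁻ x, (∑' j, ballTerm e x1 L μ j x) ^ q1 * (∑' j, ballTerm e y1 L μ j x) ^ q2 ≤
        C * cellEnergy d s L μ := by
  have hs0 : 0 < s := by rw [hs]; positivity
  set η := N * min 1 (e * q2) - q2 * y1 with hη
  set δ := q1 * q2 * (y1 - x1) / (q1 + q2) with hδ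
  have hη0 : 0 < η := by rw [hη]; linarith
  have hδ0 : 0 < δ := by
    have := sub_pos.2 hxy
    rw [hδ]; positivity
  obtain ⟨ε, hε, hεη, hεδ⟩ : ∃ ε > 0, ε < η ∧ ε < δ := by
    refine ⟨min η δ / 2, by positivity, ?_, ?_⟩
    · have := min_le_left η δ; linarith
    · have := min_le_right η δ; linarith
  obtain ⟨C0, hC0, h0⟩ := exists_tsum_rpow_mul_tsum_rpow_le hq1 hq2 hε
  obtain ⟨C1, hC1, h1⟩ := exists_lintegral_ball_le_cellDens N 1 (d := d) hs0
  obtain ⟨C2, hC2, h2⟩ := exists_lintegral_ball_le_cellDens N 2 (d := d) hs0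
  set G1 : ℝ≥0∞ := (1 - 2 ^ (-(η - ε)))⁻¹ with hG1
  set G2 : ℝ≥0∞ := (1 - 2 ^ (-(δ - ε)))⁻¹ with hG2
  have hG1t : G1 ≠ ∞ := inv_one_sub_two_rpow_neg_ne_top (by linarith)
  have hG2t : G2 ≠ ∞ := inv_one_sub_two_rpow_neg_ne_top (by linarith)
  refine ⟨C0 * (G1 * C2 + (G2 * C1 + G2 * C1)), by finiteness, fun L hL μ _ => ?_⟩
  set B : ℝ≥0∞ := 2 ^ ε
  have hmeas : ∀ i j, Measurable fun x => B ^ natGap i j *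
      (ballTerm e x1 L μ i x ^ q1 * ballTerm e y1 L μ j x ^ q2) := fun i j =>
    ((((measurable_ballTerm e x1 L μ i).pow_const q1).mul
      ((measurable_ballTerm e y1 L μ j).pow_const q2))).const_mul _
  set H : ℕ → ℕ → ℝ≥0∞ := fun i j => ∫⁻ x, B ^ natGap i j *
      (ballTerm e x1 L μ i x ^ q1 * ballTerm e y1 L μ j x ^ q2) with hH
  set F : ℕ → ℝ≥0∞ := fun i => ∫⁻ x, cellDens d L μ i x ^ s with hF
  have hH1 : ∀ i k, H i (i + k) ≤ (2 ^ (-(η - ε))) ^ k * (C2 * F i) := by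
    intro i k
    simp only [hH, natGap_add]
    rw [lintegral_const_mul' _ _ (by finiteness)]
    calc _ ≤ B ^ k * (((2 : ℝ≥0∞) ^ (-η)) ^ k *
        (escale L i ^ (-(d * s)) * ∫⁻ x, μ (ball x ((2 : ℕ) * dscale L i)) ^ s)) := by
          gcongr
          exact lintegral_ballTerm_mul_le_of_ge he hq1 hq2 hs hd hL μ i k
      _ ≤ B ^ k * (((2 : ℝ≥0∞) ^ (-η)) ^ k * (C2 * F i)) := by
          exact mul_le_mul_right (mul_le_mul_right (h2 L hL i μ) _) _
      _ = _ := by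
          rw [← mul_assoc, two_rpow_mul_two_rpow_neg_pow, show ε + -η = -(η - ε) by ring]
  have hH2 : ∀ j k, H (j + k) j ≤ (2 ^ (-(δ - ε))) ^ k * (C1 * F (j + k)) +
      (2 ^ (-(δ - ε))) ^ k * (C1 * F j) := by
    intro j k
    simp only [hH, natGap_comm (j + k), natGap_add]
    rw [lintegral_const_mul' _ _ (by finiteness)]
    have hm : ∀ i, Measurable fun x => escale L i ^ (-(d * s)) * μ (ball x (dscale L i)) ^ s :=
      fun i => ((measurable_measure_ball μ _).pow_const s).const_mul _
    have hb : ∀ i, ∫⁻ x, escale L i ^ (-(d * s)) * μ (ball x (dscale L i)) ^ s ≤ C1 * F i := by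
      intro i
      rw [lintegral_const_mul' _ _ (escale_rpow_ne_top hL _ _)]
      have := h1 L hL i μ
      simpa using this
    calc _ ≤ B ^ k * (∫⁻ x, ((2 : ℝ≥0∞) ^ (-δ)) ^ k *
        (escale L (j + k) ^ (-(d * s)) * μ (ball x (dscale L (j + k))) ^ s +
          escale L j ^ (-(d * s)) * μ (ball x (dscale L j)) ^ s)) := by
          exact mul_le_mul_right (lintegral_mono fun x =>
            ballTerm_mul_le_of_le he hq1 hq2 hs hd hL μ j k x) _
      _ = B ^ k * (((2 : ℝ≥0∞) ^ (-δ)) ^ k *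
        ((∫⁻ x, escale L (j + k) ^ (-(d * s)) * μ (ball x (dscale L (j + k))) ^ s) +
          ∫⁻ x, escale L j ^ (-(d * s)) * μ (ball x (dscale L j)) ^ s)) := by
          rw [lintegral_const_mul' _ _ (by finiteness), lintegral_add_left (hm _)]
      _ ≤ B ^ k * (((2 : ℝ≥0∞) ^ (-δ)) ^ k * (C1 * F (j + k) + C1 * F j)) := by
          gcongr
          · exact hb _
          · exact hb _
      _ = _ := by
          rw [← mul_assoc, two_rpow_mul_two_rpow_neg_pow, show ε + -δ = -(δ - ε) by ring, mul_add]
  calc ∫⁻ x, (∑' j, ballTerm e x1 L μ j x) ^ q1 * (∑' j, ballTerm e y1 L μ j x) ^ q2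
      ≤ ∫⁻ x, C0 * ∑' i, ∑' j, B ^ natGap i j *
          (ballTerm e x1 L μ i x ^ q1 * ballTerm e y1 L μ j x ^ q2) :=
        lintegral_mono fun x => h0 _ _
    _ = C0 * ∑' i, ∑' j, H i j := by
        rw [lintegral_const_mul' _ _ hC0, lintegral_tsum fun i =>
          (Measurable.tsum fun j => hmeas i j).aemeasurable]
        congr 1
        exact tsum_congr fun i => lintegral_tsum fun j => (hmeas i j).aemeasurable
    _ ≤ C0 * ((∑' i, ∑' k, H i (i + k)) + ∑' j, ∑' k, H (j + k) j) := by
        gcongr; exact tsum_tsum_le_halves H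
    _ ≤ C0 * ((∑' i, ∑' k, (2 ^ (-(η - ε))) ^ k * (C2 * F i)) + ∑' j, ∑' k,
          ((2 ^ (-(δ - ε))) ^ k * (C1 * F (j + k)) + (2 ^ (-(δ - ε))) ^ k * (C1 * F j))) := by
        gcongr with i k j k
        · exact hH1 i k
        · exact hH2 j k
    _ ≤ C0 * (G1 * C2 * ∑' i, F i + (G2 * C1 * ∑' i, F i + G2 * C1 * ∑' i, F i)) := by
        simp only [ENNReal.tsum_add]
        gcongr
        · simp only [ENNReal.tsum_mul_right, ENNReal.tsum_geometric, ENNReal.tsum_mul_left]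
          rw [mul_assoc]
        · rw [ENNReal.tsum_comm]
          simp only [ENNReal.tsum_mul_left]
          calc ∑' k : ℕ, (2 ^ (-(δ - ε))) ^ k * (C1 * ∑' j, F (j + k))
              ≤ ∑' k : ℕ, (2 ^ (-(δ - ε))) ^ k * (C1 * ∑' j, F j) := by
                exact ENNReal.tsum_le_tsum fun k => mul_le_mul_right (mul_le_mul_right
                  (ENNReal.tsum_comp_le_tsum_of_injective (add_left_injective k) F) _) _
            _ = _ := by rw [ENNReal.tsum_mul_right, ENNReal.tsum_geometric, mul_assoc]
        · simp only [ENNReal.tsum_mul_right, ENNReal.tsum_geometric, ENNReal.tsum_mul_left]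
          rw [mul_assoc]
    _ = _ := by
        rw [cellEnergy]; ring

/-- Hölder's inequality for series. -/
lemma tsum_rpow_mul_rpow_le (f g : ℕ → ℝ≥0∞) {a b : ℝ} (ha : 0 ≤ a) (hb : 0 ≤ b)
    (hab : a + b = 1) : ∑' i, f i ^ a * g i ^ b ≤ (∑' i, f i) ^ a * (∑' i, g i) ^ b := by
  have := ENNReal.lintegral_mul_norm_pow_le (μ := Measure.count) (f := f) (g := g)
    (measurable_of_countable f).aemeasurable (measurable_of_countable g).aemeasurable ha hb hab
  simpa only [lintegral_count] using this

/-- The dyadic Riesz-type inequality. -/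
theorem exists_lintegral_tsum_ball_le {d s : ℝ} (hdN : d < N) (hs : 1 < s) :
    ∃ C : ℝ≥0∞, C ≠ ∞ ∧ ∀ L : ℝ, 0 < L → ∀ (μ : Measure (Euc N)) [SFinite μ],
      ∫⁻ x, (∑' j, μ (ball x (dscale L j)) * escale L j ^ (-d)) ^ s ≤
        C * cellEnergy d s L μ := by
  set σ := N - d with hσ
  have hσ0 : 0 < σ := by rw [hσ]; linarith
  have hq1 : 0 < s - 1 / 2 := by linarith
  set x1 := d - σ / (4 * (s - 1 / 2)) with hx1
  set y1 := N - σ / 2 with hy1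
  have hx1d : x1 < d := by
    rw [hx1]
    have : 0 < σ / (4 * (s - 1 / 2)) := by positivity
    linarith
  have hsum : (s - 1 / 2) * x1 + 1 / 2 * y1 = d * s := by
    have : (s - 1 / 2) * (σ / (4 * (s - 1 / 2))) = σ / 4 := by
      rw [mul_div_assoc', mul_comm 4, mul_div_mul_left _ _ hq1.ne']
    rw [hx1, mul_sub, this, hy1, hσ]; ring
  obtain ⟨C, hC, h⟩ := exists_lintegral_tsum_ballTerm_le (N := N) (e := 1) (q1 := s - 1 / 2)
    (q2 := 1 / 2) (x1 := x1) (y1 := y1) (d := d) (s := s) one_pos hq1 (by norm_num)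
    (by linarith) (by ring) hsum (by
      rw [one_mul, min_eq_right (by norm_num : (1 / 2 : ℝ) ≤ 1)]; linarith)
  refine ⟨C, hC, fun L hL μ _ => (lintegral_mono fun x => ?_).trans (h L hL μ)⟩
  have hs0 : 0 < s := by linarith
  have hθ1 : 0 ≤ (s - 1 / 2) / s := by positivity
  have hθ2 : 0 ≤ 1 / 2 / s := by positivity
  have hθ : (s - 1 / 2) / s + 1 / 2 / s = 1 := by field_simp; ring
  have key := tsum_rpow_mul_rpow_le (fun j => ballTerm 1 x1 L μ j x)
    (fun j => ballTerm 1 y1 L μ j x) hθ1 hθ2 hθ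
  clear_value x1 y1
  have hexp : -d = -x1 * ((s - 1 / 2) / s) + -y1 * (1 / 2 / s) := by
    have h1 : -x1 * ((s - 1 / 2) / s) + -y1 * (1 / 2 / s) =
        -((s - 1 / 2) * x1 + 1 / 2 * y1) / s := by ring
    rw [h1, hsum, ← neg_mul, mul_div_cancel_right₀ _ hs0.ne']
  have hterm : ∀ j, ballTerm 1 x1 L μ j x ^ ((s - 1 / 2) / s) *
      ballTerm 1 y1 L μ j x ^ (1 / 2 / s) = μ (ball x (dscale L j)) * escale L j ^ (-d) := by
    intro j
    unfold ballTerm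
    rw [ENNReal.mul_rpow_of_nonneg _ _ hθ1, ENNReal.mul_rpow_of_nonneg _ _ hθ2,
      ENNReal.rpow_one, ← ENNReal.rpow_mul, ← ENNReal.rpow_mul]
    have hm : μ (ball x (dscale L j)) = μ (ball x (dscale L j)) ^ ((s - 1 / 2) / s) *
        μ (ball x (dscale L j)) ^ (1 / 2 / s) := by
      rw [← ENNReal.rpow_add_of_nonneg _ _ hθ1 hθ2, hθ, ENNReal.rpow_one]
    rw [hexp, escale_rpow_add hL]
    conv_rhs => rw [hm]
    exact mul_mul_mul_comm (_ : ℝ≥0∞) _ _ _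
  simp only [hterm] at key
  calc _ ≤ ((∑' j, ballTerm 1 x1 L μ j x) ^ ((s - 1 / 2) / s) *
        (∑' j, ballTerm 1 y1 L μ j x) ^ (1 / 2 / s)) ^ s := by gcongr
    _ = _ := by
        rw [ENNReal.mul_rpow_of_nonneg _ _ hs0.le, ← ENNReal.rpow_mul, ← ENNReal.rpow_mul,
          div_mul_cancel₀ _ hs0.ne', div_mul_cancel₀ _ hs0.ne']

lemma exp_neg_le_rpow {m : ℝ} (hm : 0 < m) :
    ∃ C > 0, ∀ u : ℝ, 0 < u → Real.exp (-u) ≤ C * u ^ (-m) := by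
  refine ⟨m ^ m, by positivity, fun u hu => ?_⟩
  have h1 : u / m ≤ Real.exp (u / m) := (by linarith [Real.add_one_le_exp (u / m)])
  have h2 : (u / m) ^ m ≤ Real.exp u := by
    calc (u / m) ^ m ≤ Real.exp (u / m) ^ m := by gcongr
      _ = Real.exp u := by rw [← Real.exp_mul, div_mul_cancel₀ _ hm.ne']
  rw [Real.exp_neg, Real.rpow_neg hu.le, ← div_eq_mul_inv, inv_le_comm₀ (Real.exp_pos _)
    (by positivity), inv_div, ← Real.div_rpow hu.le hm.le]
  exact h2

/-- The integrand in the definition of the Bessel kernel. -/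
def besselIntegrand (N : ℕ) (σ r t : ℝ) : ℝ :=
  Real.exp (-(Real.pi * r ^ 2 / t) - t / (4 * Real.pi)) * t ^ ((σ - (N : ℝ)) / 2) / t

lemma besselIntegrand_nonneg (σ r : ℝ) {t : ℝ} (ht : 0 < t) : 0 ≤ besselIntegrand N σ r t := by
  unfold besselIntegrand; positivity

lemma exists_besselIntegrand_le (σ : ℝ) {m : ℝ} (hm : 0 < m) :
    ∃ C > 0, ∀ r t : ℝ, 0 < r → 0 < t → besselIntegrand N σ r t ≤
      C * r ^ (-(2 * m)) * (t ^ (m + (σ - N) / 2 - 1) * Real.exp (-(1 / (4 * Real.pi)) * t)) := by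
  obtain ⟨C, hC, h⟩ := exp_neg_le_rpow hm
  refine ⟨C * Real.pi ^ (-m), by positivity, fun r t hr ht => ?_⟩
  have h1 := h (Real.pi * r ^ 2 / t) (by positivity)
  rw [Real.div_rpow (by positivity) ht.le, Real.mul_rpow (by positivity) (by positivity),
    ← Real.rpow_natCast, ← Real.rpow_mul hr.le, Real.rpow_neg ht.le, div_inv_eq_mul] at h1
  unfold besselIntegrand
  rw [sub_eq_add_neg (-(_)), Real.exp_add, Real.rpow_sub ht, Real.rpow_add ht, Real.rpow_one]
  have e1 : -(t / (4 * Real.pi)) = -(1 / (4 * Real.pi)) * t := by ring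
  have e2 : ((2 : ℕ) : ℝ) * -m = -(2 * m) := by push_cast; ring
  rw [e1]
  rw [e2] at h1
  calc _ ≤ C * (Real.pi ^ (-m) * r ^ (-(2 * m)) * t ^ m) *
        Real.exp (-(1 / (4 * Real.pi)) * t) * t ^ ((σ - (N : ℝ)) / 2) / t := by
        gcongr
        exact_mod_cast h1
    _ = _ := by ring

lemma integrableOn_gamma_weight {σ : ℝ} (hσ : 0 < σ) :
    IntegrableOn (fun t : ℝ => t ^ (σ / 2 - 1) * Real.exp (-(1 / (4 * Real.pi)) * t)) (Ioi 0) := by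
  have := integrableOn_rpow_mul_exp_neg_mul_rpow (p := 1) (s := σ / 2 - 1)
    (b := 1 / (4 * Real.pi)) (by linarith) one_pos (by positivity)
  simpa using this

lemma continuousOn_besselIntegrand (σ r : ℝ) :
    ContinuousOn (besselIntegrand N σ r) (Ioi 0) := by
  unfold besselIntegrand
  intro t ht
  have ht' : t ≠ 0 := ne_of_gt ht
  apply ContinuousAt.continuousWithinAt
  have : ContinuousAt (fun t : ℝ => t ^ ((σ - (N : ℝ)) / 2)) t :=
    Real.continuousAt_rpow_const _ _ (Or.inl ht')
  fun_prop (disch := assumption)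

lemma integrableOn_besselIntegrand {σ r : ℝ} (hσ : 0 < σ) (hN : 0 < N) (hr : 0 < r) :
    IntegrableOn (besselIntegrand N σ r) (Ioi 0) := by
  obtain ⟨C, hC, h⟩ := exists_besselIntegrand_le (N := N) σ (m := N / 2) (by positivity)
  have hg := (integrableOn_gamma_weight hσ).const_mul (C * r ^ (-(2 * (N / 2 : ℝ))))
  refine Integrable.mono' hg ((continuousOn_besselIntegrand σ r).aestronglyMeasurable
    measurableSet_Ioi) ?_
  filter_upwards [ae_restrict_mem measurableSet_Ioi] with t ht
  rw [Real.norm_of_nonneg (besselIntegrand_nonneg σ r ht)]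
  have h' := h r t hr ht
  rwa [show (N : ℝ) / 2 + (σ - N) / 2 - 1 = σ / 2 - 1 by ring] at h'

lemma exists_besselKernel_le_decay {σ : ℝ} (hσ : 0 < σ) (hN : 0 < N) :
    ∃ C > 0, ∀ x : Euc N, x ≠ 0 → besselKernel N σ x ≤ C * ‖x‖ ^ (-(N : ℝ)) := by
  obtain ⟨C, hC, h⟩ := exists_besselIntegrand_le (N := N) σ (m := N / 2) (by positivity)
  set I := ∫ t in Ioi (0 : ℝ), t ^ (σ / 2 - 1) * Real.exp (-(1 / (4 * Real.pi)) * t)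
  have hI : 0 ≤ I := setIntegral_nonneg measurableSet_Ioi fun t ht => by
    have : 0 < t := ht
    positivity
  refine ⟨C * (I + 1), by positivity, fun x hx => ?_⟩
  have hr : 0 < ‖x‖ := norm_pos_iff.2 hx
  have hg := (integrableOn_gamma_weight hσ).const_mul (C * ‖x‖ ^ (-(2 * (N / 2 : ℝ))))
  calc besselKernel N σ x = ∫ t in Ioi (0 : ℝ), besselIntegrand N σ ‖x‖ t := rfl
    _ ≤ ∫ t in Ioi (0 : ℝ), C * ‖x‖ ^ (-(2 * (N / 2 : ℝ))) *
        (t ^ (σ / 2 - 1) * Real.exp (-(1 / (4 * Real.pi)) * t)) := by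
      refine integral_mono_of_nonneg ?_ hg ?_
      · filter_upwards [ae_restrict_mem measurableSet_Ioi] with t ht
        exact besselIntegrand_nonneg σ _ ht
      · filter_upwards [ae_restrict_mem measurableSet_Ioi] with t ht
        have h' := h ‖x‖ t hr ht
        rwa [show (N : ℝ) / 2 + (σ - N) / 2 - 1 = σ / 2 - 1 by ring] at h'
    _ = C * I * ‖x‖ ^ (-(N : ℝ)) := by
      rw [integral_const_mul, show -(2 * (N / 2 : ℝ)) = -N by ring]; ring
    _ ≤ _ := by gcongr; linarith

lemma exists_besselKernel_le_riesz {σ : ℝ} (hσN : σ < N) :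
    ∃ C > 0, ∀ x : Euc N, x ≠ 0 → besselKernel N σ x ≤ C * ‖x‖ ^ (-((N : ℝ) - σ)) := by
  set d := (N : ℝ) - σ with hd
  have hd0 : 0 < d := by rw [hd]; linarith
  obtain ⟨C, hC, h⟩ := exists_besselIntegrand_le (N := N) σ (m := d / 2 + 1) (by positivity)
  refine ⟨C + 2 / d, by positivity, fun x hx => ?_⟩
  have hr : 0 < ‖x‖ := norm_pos_iff.2 hx
  set r := ‖x‖
  have hr2 : 0 < r ^ 2 := by positivity
  have hsplit : Ioi (0 : ℝ) = Ioc 0 (r ^ 2) ∪ Ioi (r ^ 2) := (Ioc_union_Ioi_eq_Ioi hr2.le).symm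
  have i2 : IntegrableOn (fun t : ℝ => t ^ (-(d / 2) - 1)) (Ioi (r ^ 2)) :=
    integrableOn_Ioi_rpow_of_lt (by linarith) hr2
  have b1 : ∀ t ∈ Ioc 0 (r ^ 2), besselIntegrand N σ r t ≤ C * r ^ (-(d + 2)) := by
    intro t ht
    refine (h r t hr ht.1).trans ?_
    rw [show d / 2 + 1 + (σ - N) / 2 - 1 = 0 by rw [hd]; ring, Real.rpow_zero, one_mul,
      show -(2 * (d / 2 + 1)) = -(d + 2) by ring]
    refine mul_le_of_le_one_right (by positivity) (Real.exp_le_one_iff.2 ?_)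
    have : 0 < 1 / (4 * Real.pi) * t := mul_pos (by positivity) ht.1
    linarith
  have b2 : ∀ t ∈ Ioi (r ^ 2), besselIntegrand N σ r t ≤ t ^ (-(d / 2) - 1) := by
    intro t ht
    have ht0 : 0 < t := hr2.trans ht
    unfold besselIntegrand
    rw [Real.rpow_sub_one ht0.ne', show (σ - N) / 2 = -(d / 2) by rw [hd]; ring]
    gcongr
    refine mul_le_of_le_one_left (by positivity) (Real.exp_le_one_iff.2 ?_)
    have : 0 < Real.pi * r ^ 2 / t := by positivity
    have : 0 < t / (4 * Real.pi) := by positivity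
    linarith
  set g : ℝ → ℝ := fun t => if t ≤ r ^ 2 then C * r ^ (-(d + 2)) else t ^ (-(d / 2) - 1)
  have g1 : EqOn g (fun _ => C * r ^ (-(d + 2))) (Ioc 0 (r ^ 2)) := fun t ht => if_pos ht.2
  have g2 : EqOn g (fun t => t ^ (-(d / 2) - 1)) (Ioi (r ^ 2)) := fun t ht => if_neg (not_le.2 ht)
  have j1 : IntegrableOn g (Ioc 0 (r ^ 2)) := by
    rw [integrableOn_congr_fun g1 measurableSet_Ioc]
    exact integrableOn_const (by simp)
  have j2 : IntegrableOn g (Ioi (r ^ 2)) := by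
    rwa [integrableOn_congr_fun g2 measurableSet_Ioi]
  calc besselKernel N σ x = ∫ t in Ioi (0 : ℝ), besselIntegrand N σ r t := rfl
    _ ≤ ∫ t in Ioi (0 : ℝ), g t := by
      refine integral_mono_of_nonneg ?_ ?_ ?_
      · filter_upwards [ae_restrict_mem measurableSet_Ioi] with t ht
        exact besselIntegrand_nonneg σ _ ht
      · rw [hsplit]; exact j1.union j2
      · filter_upwards [ae_restrict_mem measurableSet_Ioi] with t ht
        rcases le_or_gt t (r ^ 2) with h' | h'
        · rw [g1 ⟨ht, h'⟩]; exact b1 t ⟨ht, h'⟩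
        · rw [g2 h']; exact b2 t h'
    _ = C * r ^ (-(d + 2)) * r ^ 2 + (2 / d) * (r ^ 2) ^ (-(d / 2)) := by
      rw [hsplit, setIntegral_union Ioc_disjoint_Ioi_same measurableSet_Ioi j1 j2,
        setIntegral_congr_fun measurableSet_Ioc g1, setIntegral_congr_fun measurableSet_Ioi g2,
        integral_Ioi_rpow_of_lt (by linarith) hr2, setIntegral_const]
      congr 1
      · simp [hr2.le, mul_comm]
      · rw [show -(d / 2) - 1 + 1 = -(d / 2) by ring]
        field_simp
    _ = _ := by
      rw [← Real.rpow_natCast, mul_assoc, ← Real.rpow_add hr, ← Real.rpow_mul hr.le]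
      push_cast
      rw [show -(d + 2) + 2 = -d by ring, show (2 : ℝ) * -(d / 2) = -d by ring]
      ring

lemma exists_le_besselKernel {σ : ℝ} (hσ : 0 < σ) (hσN : σ < N) (ρ : ℝ) :
    ∃ c > 0, ∀ x : Euc N, x ≠ 0 → ‖x‖ ≤ ρ →
      c * ‖x‖ ^ (-((N : ℝ) - σ)) ≤ besselKernel N σ x := by
  have hN : 0 < N := by exact_mod_cast hσ.trans hσN
  set d := (N : ℝ) - σ with hd
  have hd0 : 0 < d := by rw [hd]; linarith
  refine ⟨Real.exp (-Real.pi - 2 * ρ ^ 2 / (4 * Real.pi)) * 2 ^ (-(d / 2) - 1), by positivity,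
    fun x hx hxρ => ?_⟩
  have hr : 0 < ‖x‖ := norm_pos_iff.2 hx
  set r := ‖x‖
  have hr2 : 0 < r ^ 2 := by positivity
  have hsub : Icc (r ^ 2) (2 * r ^ 2) ⊆ Ioi (0 : ℝ) := fun t ht => lt_of_lt_of_le hr2 ht.1
  have hInt := integrableOn_besselIntegrand (N := N) hσ hN hr
  set k := Real.exp (-Real.pi - 2 * ρ ^ 2 / (4 * Real.pi)) * (2 * r ^ 2) ^ (-(d / 2) - 1) with hk
  calc _ = ∫ _t in Icc (r ^ 2) (2 * r ^ 2), k := by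
        rw [setIntegral_const]
        simp only [measureReal_def, Real.volume_Icc, smul_eq_mul]
        have e : r ^ (-d) = r ^ 2 * (r ^ 2) ^ (-(d / 2) - 1) := by
          rw [Real.rpow_sub_one hr2.ne', mul_div_cancel₀ _ hr2.ne', ← Real.rpow_natCast,
            ← Real.rpow_mul hr.le]
          congr 1
          push_cast
          ring
        rw [ENNReal.toReal_ofReal (by linarith), hk, Real.mul_rpow (by norm_num) hr2.le, e]
        ring
    _ ≤ ∫ t in Icc (r ^ 2) (2 * r ^ 2), besselIntegrand N σ r t := by
        refine setIntegral_mono_on (integrableOn_const (by simp)) (hInt.mono_set hsub)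
          measurableSet_Icc fun t ht => ?_
        have ht0 : 0 < t := hsub ht
        unfold besselIntegrand
        rw [mul_div_assoc, ← Real.rpow_sub_one ht0.ne',
          show (σ - N) / 2 - 1 = -(d / 2) - 1 by rw [hd]; ring, hk]
        have e1 : Real.pi * r ^ 2 / t ≤ Real.pi := by
          rw [div_le_iff₀ ht0]; gcongr; exact ht.1
        have e2 : t / (4 * Real.pi) ≤ 2 * ρ ^ 2 / (4 * Real.pi) := by
          gcongr
          exact ht.2.trans (by gcongr)
        refine mul_le_mul (Real.exp_le_exp.2 (by linarith)) ?_ (by positivity) (by positivity)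
        exact Real.rpow_le_rpow_of_nonpos ht0 ht.2 (by linarith)
    _ ≤ ∫ t in Ioi (0 : ℝ), besselIntegrand N σ r t := by
        refine setIntegral_mono_set hInt ?_ hsub.eventuallyLE
        filter_upwards [ae_restrict_mem measurableSet_Ioi] with t ht
        exact besselIntegrand_nonneg σ _ ht
    _ = _ := rfl

lemma exists_dscale_lt (L : ℝ) {r : ℝ} (hr : 0 < r) : ∃ j, dscale L j < r := by
  have : Tendsto (fun j : ℕ => L * ((1 / 2 : ℝ)) ^ j) atTop (𝓝 (L * 0)) :=
    (tendsto_pow_atTop_nhds_zero_of_lt_one (by norm_num) (by norm_num)).const_mul L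
  rw [mul_zero] at this
  obtain ⟨j, hj⟩ := (this.eventually_lt_const hr).exists
  refine ⟨j, ?_⟩
  simpa [dscale, div_eq_mul_inv] using hj

lemma exists_dscale_band (L : ℝ) {r : ℝ} (hr : 0 < r) (hrL : r < L) :
    ∃ j, dscale L (j + 1) ≤ r ∧ r < dscale L j := by
  obtain ⟨j, hj⟩ := exists_dscale_lt L hr
  have hex : ∃ j, dscale L j ≤ r := ⟨j, hj.le⟩
  classical
  have h0 : Nat.find hex ≠ 0 := by
    intro h
    have := Nat.find_spec hex
    rw [h, dscale_zero] at this
    linarith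
  obtain ⟨m, hm⟩ := Nat.exists_eq_succ_of_ne_zero h0
  refine ⟨m, ?_, ?_⟩
  · have := Nat.find_spec hex
    rwa [hm] at this
  · exact not_le.1 (Nat.find_min hex (by omega))

lemma sum_escale_rpow_neg_le (L d : ℝ) (n : ℕ) :
    ∑ j ∈ Finset.range (n + 1), escale L j ^ (-d) ≤
      (1 - (2 : ℝ≥0∞) ^ (-d))⁻¹ * escale L n ^ (-d) := by
  have h2 : (2 : ℝ≥0∞) ^ d * 2 ^ (-d) = 1 := by
    rw [← ENNReal.rpow_add _ _ (by norm_num) (by norm_num)]; simp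
  calc ∑ j ∈ Finset.range (n + 1), escale L j ^ (-d)
      = ∑ j ∈ Finset.range (n + 1), escale L (n - j) ^ (-d) :=
        (Finset.sum_range_reflect (fun j => escale L j ^ (-d)) (n + 1)).symm
    _ = ∑ j ∈ Finset.range (n + 1), escale L n ^ (-d) * ((2 : ℝ≥0∞) ^ (-d)) ^ j := by
        refine Finset.sum_congr rfl fun j hj => ?_
        have hjn : j ≤ n := by simpa [Nat.lt_succ_iff] using hj
        conv_rhs => rw [← Nat.sub_add_cancel hjn, escale_add_rpow]
        rw [neg_neg, mul_assoc, ← mul_pow, h2, one_pow, mul_one]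
    _ ≤ ∑' j, escale L n ^ (-d) * ((2 : ℝ≥0∞) ^ (-d)) ^ j := ENNReal.sum_le_tsum _
    _ = _ := by rw [ENNReal.tsum_mul_left, ENNReal.tsum_geometric, mul_comm]

lemma sum_ite_escale_rpow_neg_le {d : ℝ} (hd : 0 < d) {b : ℝ} (n : ℕ) :
    ∑ j ∈ Finset.range n, (if b ≤ dscale L j then escale L j ^ (-d) else 0) ≤
      (1 - (2 : ℝ≥0∞) ^ (-d))⁻¹ * ENNReal.ofReal b ^ (-d) := by
  induction n with
  | zero => simp
  | succ n ih =>
    by_cases h : b ≤ dscale L n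
    · calc _ ≤ ∑ j ∈ Finset.range (n + 1), escale L j ^ (-d) := by
            refine Finset.sum_le_sum fun j _ => ?_
            split_ifs <;> simp
        _ ≤ (1 - (2 : ℝ≥0∞) ^ (-d))⁻¹ * escale L n ^ (-d) := sum_escale_rpow_neg_le L d n
        _ ≤ _ := by
            refine mul_le_mul_right ?_ _
            rw [ENNReal.rpow_neg (escale L n), ENNReal.rpow_neg (ENNReal.ofReal b),
              ENNReal.inv_le_inv]
            exact ENNReal.rpow_le_rpow (ENNReal.ofReal_le_ofReal h) hd.le
    · rw [Finset.sum_range_succ, if_neg h, add_zero]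
      exact ih

/-- A dyadic upper bound for the Bessel kernel. -/
lemma exists_besselKernel_le_tsum {σ : ℝ} (hσ : 0 < σ) (hσN : σ < N) (hL : 0 < L) :
    ∃ C : ℝ≥0∞, C ≠ ∞ ∧ ∀ x y : Euc N, x ≠ y →
      ENNReal.ofReal (besselKernel N σ (x - y)) ≤
        C * ((∑' j, (ball x (dscale L j)).indicator (fun _ => escale L j ^ (-((N : ℝ) - σ))) y) +
          ENNReal.ofReal ((1 + ‖x - y‖) ^ (-(N : ℝ)))) := by
  have hN : 0 < N := by exact_mod_cast hσ.trans hσN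
  set d := (N : ℝ) - σ with hd
  have hd0 : 0 < d := by rw [hd]; linarith
  obtain ⟨C1, hC1, h1⟩ := exists_besselKernel_le_riesz hσN
  obtain ⟨C2, hC2, h2⟩ := exists_besselKernel_le_decay hσ hN
  refine ⟨ENNReal.ofReal (C1 * 2 ^ d + C2 * (1 / L + 1) ^ (N : ℝ)), ENNReal.ofReal_ne_top,
    fun x y hxy => ?_⟩
  have hr : 0 < ‖x - y‖ := norm_pos_iff.2 (sub_ne_zero.2 hxy)
  rcases lt_or_ge ‖x - y‖ L with h | h
  · obtain ⟨j, hj1, hj2⟩ := exists_dscale_band L hr h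
    have hmem : y ∈ ball x (dscale L j) := by rwa [mem_ball, dist_comm, dist_eq_norm]
    calc ENNReal.ofReal (besselKernel N σ (x - y))
        ≤ ENNReal.ofReal ((C1 * 2 ^ d) * dscale L j ^ (-d)) := by
          refine ENNReal.ofReal_le_ofReal ((h1 _ (sub_ne_zero.2 hxy)).trans ?_)
          rw [mul_assoc]
          gcongr
          have hjp := dscale_pos hL (j + 1)
          calc ‖x - y‖ ^ (-d) ≤ dscale L (j + 1) ^ (-d) :=
                Real.rpow_le_rpow_of_nonpos hjp hj1 (by linarith)
            _ = 2 ^ d * dscale L j ^ (-d) := by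
                rw [dscale_succ L j, Real.mul_rpow (by norm_num) hjp.le, ← mul_assoc,
                  ← Real.rpow_add (by norm_num)]
                simp
      _ = ENNReal.ofReal (C1 * 2 ^ d) *
          (ball x (dscale L j)).indicator (fun _ => escale L j ^ (-d)) y := by
          rw [ENNReal.ofReal_mul (by positivity), indicator_of_mem hmem, escale_rpow_eq hL]
      _ ≤ _ := by
          refine mul_le_mul' (ENNReal.ofReal_le_ofReal ?_) (le_add_right (ENNReal.le_tsum j))
          have : 0 ≤ C2 * (1 / L + 1) ^ (N : ℝ) := by positivity
          linarith
  · calc ENNReal.ofReal (besselKernel N σ (x - y))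
        ≤ ENNReal.ofReal (C2 * (1 / L + 1) ^ (N : ℝ) * (1 + ‖x - y‖) ^ (-(N : ℝ))) := by
          refine ENNReal.ofReal_le_ofReal ((h2 _ (sub_ne_zero.2 hxy)).trans ?_)
          rw [mul_assoc]
          gcongr
          rw [Real.rpow_neg (by positivity), Real.rpow_neg (by positivity), ← div_eq_mul_inv,
            ← Real.div_rpow (by positivity) (by positivity),
            ← Real.inv_rpow (by positivity)]
          gcongr
          rw [inv_eq_one_div, div_le_div_iff₀ hr (by positivity)]
          have : 1 ≤ 1 / L * ‖x - y‖ := by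
            rw [one_div, ← div_eq_inv_mul, le_div_iff₀ hL]; linarith
          linarith
      _ ≤ _ := by
          rw [ENNReal.ofReal_mul (by positivity)]
          refine mul_le_mul' (ENNReal.ofReal_le_ofReal ?_) le_add_self
          have : 0 ≤ C1 * 2 ^ d := by positivity
          linarith

/-- A dyadic lower bound for the Bessel kernel. -/
lemma exists_tsum_le_besselKernel {σ : ℝ} (hσ : 0 < σ) (hσN : σ < N) (hL : 0 < L) :
    ∃ C : ℝ≥0∞, C ≠ ∞ ∧ ∀ x y : Euc N, x ≠ y →
      ∑' j, (cell L j x).indicator (fun _ => escale L j ^ (-((N : ℝ) - σ))) y ≤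
        C * ENNReal.ofReal (besselKernel N σ (x - y)) := by
  have hN : 0 < N := by exact_mod_cast hσ.trans hσN
  set d := (N : ℝ) - σ with hd
  have hd0 : 0 < d := by rw [hd]; linarith
  obtain ⟨c, hc, h1⟩ := exists_le_besselKernel hσ hσN (N * L)
  set A : ℝ≥0∞ := (1 - (2 : ℝ≥0∞) ^ (-d))⁻¹
  have hA : A ≠ ∞ := inv_one_sub_two_rpow_neg_ne_top hd0
  refine ⟨A * ENNReal.ofReal ((N : ℝ) ^ d * c⁻¹), by finiteness, fun x y hxy => ?_⟩
  have hr : 0 < ‖x - y‖ := norm_pos_iff.2 (sub_ne_zero.2 hxy)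
  have hmem : ∀ j, y ∈ cell L j x → ‖x - y‖ ≤ N * dscale L j := by
    intro j hj
    have := dist_le_of_mem_cell hL hj
    rwa [dist_comm, dist_eq_norm] at this
  by_cases hex : y ∈ cell L 0 x
  · have hρ : ‖x - y‖ ≤ N * L := by simpa [dscale_zero] using hmem 0 hex
    have hk := h1 (x - y) (sub_ne_zero.2 hxy) hρ
    calc _ ≤ ∑' j, (if ‖x - y‖ / N ≤ dscale L j then escale L j ^ (-d) else 0) := by
          refine ENNReal.tsum_le_tsum fun j => ?_
          by_cases hj : y ∈ cell L j x
          · rw [indicator_of_mem hj, if_pos]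
            rw [div_le_iff₀ (by positivity), mul_comm]
            exact hmem j hj
          · rw [indicator_of_notMem hj]; exact zero_le
      _ ≤ A * ENNReal.ofReal (‖x - y‖ / N) ^ (-d) := by
          rw [ENNReal.tsum_eq_iSup_nat]
          exact iSup_le fun n => sum_ite_escale_rpow_neg_le hd0 n
      _ ≤ _ := by
          rw [mul_assoc]
          gcongr
          rw [ENNReal.ofReal_rpow_of_pos (by positivity), ← ENNReal.ofReal_mul (by positivity)]
          refine ENNReal.ofReal_le_ofReal ?_
          calc (‖x - y‖ / N) ^ (-d) = N ^ d * c⁻¹ * (c * ‖x - y‖ ^ (-d)) := by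
                rw [Real.div_rpow hr.le (by positivity),
                  Real.rpow_neg (x := (N : ℝ)) (by positivity), div_inv_eq_mul]
                field_simp
            _ ≤ _ := by gcongr
  · refine le_of_eq_of_le (ENNReal.tsum_eq_zero.2 fun j => ?_) zero_le
    exact indicator_of_notMem (fun hj => hex (cell_anti (Nat.zero_le j) x hj)) _

lemma cellDens_withDensity (d : ℝ) {g : Euc N → ℝ≥0∞} (j : ℕ) (x : Euc N) (hL : 0 < L) :
    cellDens d L (volume.withDensity g) j x =
      ∫⁻ y, (cell L j x).indicator (fun _ => escale L j ^ (-d)) y * g y := by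
  rw [cellDens, withDensity_apply _ (measurableSet_cell L j x), mul_comm,
    ← lintegral_const_mul' _ _ (escale_rpow_ne_top hL j _),
    ← lintegral_indicator (measurableSet_cell L j x)]
  refine lintegral_congr fun y => ?_
  by_cases hy : y ∈ cell L j x
  · simp only [indicator_of_mem hy]
  · simp only [indicator_of_notMem hy, zero_mul]

lemma ae_ne_of_pos (hN : 0 < N) (x : Euc N) : ∀ᵐ y : Euc N, x ≠ y := by
  have : Nonempty (Fin N) := ⟨⟨0, hN⟩⟩
  have : (volume : Measure (Euc N)) {x} = 0 := measure_singleton x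
  filter_upwards [compl_mem_ae_iff.2 this] with y hy
  exact fun h => hy h.symm

/-- A measure controlled by the Bessel capacity satisfies a weak-type bound for the dyadic Riesz
potential. -/
lemma exists_measure_le_tsum_cellDens_le {σ s' : ℝ} (hσ : 0 < σ) (hσN : σ < N) (hs' : 0 < s')
    (hL : 0 < L) {μ : Measure (Euc N)} [IsFiniteMeasure μ] {C₁ : ℝ≥0∞} (hC₁ : C₁ ≠ ∞)
    (hcap : ∀ K, IsCompact K → μ K ≤ C₁ * besselCap N σ s' K) :
    ∃ B : ℝ≥0∞, B ≠ ∞ ∧ ∀ g : Euc N → ℝ≥0∞, Measurable g → ∀ t : ℝ≥0∞, t ≠ 0 → t ≠ ∞ →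
      μ {x | t ≤ ∑' j, cellDens (N - σ) L (volume.withDensity g) j x} ≤
        B * t ^ (-s') * ∫⁻ x, g x ^ s' := by
  have hN : 0 < N := by exact_mod_cast hσ.trans hσN
  obtain ⟨C, hC, hker⟩ := exists_tsum_le_besselKernel hσ hσN hL
  refine ⟨C₁ * C ^ s', by finiteness, fun g hg t ht0 ht => ?_⟩
  have hmeas : MeasurableSet {x | t ≤ ∑' j, cellDens (N - σ) L (volume.withDensity g) j x} :=
    measurableSet_le measurable_const (Measurable.tsum fun j => measurable_cellDens _ _ _ j)
  rw [hmeas.measure_eq_iSup_isCompact]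
  refine iSup₂_le fun K hK => iSup_le fun hKc => (hcap K hKc).trans ?_
  have hpt : ∀ x, ∑' j, cellDens (N - σ) L (volume.withDensity g) j x ≤
      C * ∫⁻ y, ENNReal.ofReal (besselKernel N σ (x - y)) * g y := by
    intro x
    simp only [cellDens_withDensity _ _ _ hL]
    rw [← lintegral_tsum (f := fun j y => (cell L j x).indicator
      (fun _ => escale L j ^ (-((N : ℝ) - σ))) y * g y) fun j => ((measurable_const.indicator
        (measurableSet_cell L j x)).mul hg).aemeasurable, ← lintegral_const_mul' _ _ hC]
    simp only [ENNReal.tsum_mul_right, ← mul_assoc]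
    refine lintegral_mono_ae ?_
    filter_upwards [ae_ne_of_pos hN x] with y hy
    gcongr
    exact hker x y hy
  have htest : besselCap N σ s' K ≤ ∫⁻ x, (C / t * g x) ^ s' := by
    refine iInf_le_of_le _ (iInf_le_of_le (hg.const_mul _) (iInf_le _ fun x hx => ?_))
    have h1 := le_trans (hK hx) (hpt x)
    have hCt : C / t ≠ ∞ := ENNReal.div_ne_top hC ht0
    calc (1 : ℝ≥0∞) ≤ (C * ∫⁻ y, ENNReal.ofReal (besselKernel N σ (x - y)) * g y) / t := by
          rwa [ENNReal.le_div_iff_mul_le (Or.inl ht0) (Or.inl ht), one_mul]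
      _ = C / t * ∫⁻ y, ENNReal.ofReal (besselKernel N σ (x - y)) * g y := by
          rw [ENNReal.mul_div_right_comm]
      _ = _ := by
          rw [← lintegral_const_mul' _ _ hCt]
          exact lintegral_congr fun y => by ring
  calc C₁ * besselCap N σ s' K ≤ C₁ * ∫⁻ x, (C / t * g x) ^ s' := by gcongr
    _ = _ := by
      simp only [ENNReal.mul_rpow_of_nonneg _ _ hs'.le]
      rw [lintegral_const_mul _ (hg.pow_const _), div_eq_mul_inv,
        ENNReal.mul_rpow_of_nonneg _ _ hs'.le, ENNReal.inv_rpow, ← ENNReal.rpow_neg]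
      ring

lemma le_add_tsum_indicator_le {t : ℝ≥0∞} (ht0 : t ≠ 0) (F : ℝ≥0∞) :
    F ≤ t + ∑' k : ℕ, if 2 ^ k * t ≤ F then 2 ^ (k + 1) * t else 0 := by
  rcases le_or_gt F t with h | h
  · exact le_add_right h
  rcases eq_or_ne F ∞ with rfl | hF
  · have : ∀ k : ℕ, (if 2 ^ k * t ≤ ∞ then 2 ^ (k + 1) * t else 0) = 2 ^ (k + 1) * t := fun k =>
      if_pos le_top
    simp only [this, ENNReal.tsum_mul_right]
    have h2 : ∑' k : ℕ, (2 : ℝ≥0∞) ^ (k + 1) = ∞ := by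
      refine top_unique ?_
      calc (∞ : ℝ≥0∞) = ∑' _ : ℕ, 1 := (ENNReal.tsum_const_eq_top_of_ne_zero one_ne_zero).symm
        _ ≤ _ := ENNReal.tsum_le_tsum fun k => one_le_pow₀ (by norm_num)
    rw [h2, ENNReal.top_mul ht0, add_top]
  · obtain ⟨k, hk1, hk2⟩ := exists_dyadic_band ht0 h.le hF
    have e : ∀ m : ℕ, (2 : ℝ≥0∞) ^ m * 2⁻¹ ^ m = 1 := fun m => by
      rw [← mul_pow, ENNReal.mul_inv_cancel (by norm_num) (by norm_num), one_pow]
    have hF1 : F ≤ 2 ^ (k + 1) * t := by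
      calc F = 2 ^ (k + 1) * (2⁻¹ ^ (k + 1) * F) := by rw [← mul_assoc, e, one_mul]
        _ ≤ _ := by gcongr
    have hF2 : 2 ^ k * t ≤ F := by
      calc 2 ^ k * t ≤ 2 ^ k * (2⁻¹ ^ k * F) := by gcongr
        _ = F := by rw [← mul_assoc, e, one_mul]
    refine hF1.trans (le_add_left (le_trans ?_ (ENNReal.le_tsum k)))
    rw [if_pos hF2]

lemma exists_setLIntegral_tsum_cellDens_le {d s' : ℝ} (hs' : 1 < s') {μ : Measure (Euc N)}
    {B : ℝ≥0∞} (hB : B ≠ ∞)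
    (h : ∀ g : Euc N → ℝ≥0∞, Measurable g → ∀ t : ℝ≥0∞, t ≠ 0 → t ≠ ∞ →
      μ {x | t ≤ ∑' j, cellDens d L (volume.withDensity g) j x} ≤
        B * t ^ (-s') * ∫⁻ x, g x ^ s') :
    ∃ B' : ℝ≥0∞, B' ≠ ∞ ∧ ∀ g : Euc N → ℝ≥0∞, Measurable g → ∀ t : ℝ≥0∞, t ≠ 0 → t ≠ ∞ →
      ∀ E, ∫⁻ x in E, ∑' j, cellDens d L (volume.withDensity g) j x ∂μ ≤
        t * μ E + B' * t ^ (-(s' - 1)) * ∫⁻ x, g x ^ s' := by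
  refine ⟨2 * B * (1 - 2 ^ (-(s' - 1)))⁻¹, ?_, fun g hg t ht0 ht E => ?_⟩
  · have := inv_one_sub_two_rpow_neg_ne_top (a := s' - 1) (by linarith)
    finiteness
  set F : Euc N → ℝ≥0∞ := fun x => ∑' j, cellDens d L (volume.withDensity g) j x with hF
  have hFm : Measurable F := Measurable.tsum fun j => measurable_cellDens _ _ _ j
  set Y := ∫⁻ x, g x ^ s'
  have hset : ∀ k : ℕ, MeasurableSet {x | 2 ^ k * t ≤ F x} := fun k =>
    measurableSet_le measurable_const hFm
  calc ∫⁻ x in E, F x ∂μ ≤ ∫⁻ x in E, t + ∑' k : ℕ,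
        {x | 2 ^ k * t ≤ F x}.indicator (fun _ => 2 ^ (k + 1) * t) x ∂μ := by
        refine lintegral_mono fun x => (le_add_tsum_indicator_le ht0 (F x)).trans_eq ?_
        simp only [indicator_apply, mem_ofPred_eq]
    _ = t * μ E + ∑' k : ℕ, 2 ^ (k + 1) * t * μ.restrict E {x | 2 ^ k * t ≤ F x} := by
        rw [lintegral_add_left measurable_const, lintegral_tsum fun k =>
          (measurable_const.indicator (hset k)).aemeasurable, setLIntegral_const]
        congr 1
        exact tsum_congr fun k => lintegral_indicator_const (hset k) _
    _ ≤ t * μ E + ∑' k : ℕ, 2 ^ (k + 1) * t * (B * (2 ^ k * t) ^ (-s') * Y) := by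
        gcongr with k
        exact (Measure.restrict_apply_le _ _).trans
          (h g hg _ (mul_ne_zero (by simp) ht0) (by finiteness))
    _ = t * μ E + ∑' k : ℕ, (2 * B * t ^ (-(s' - 1)) * Y) * (2 ^ (-(s' - 1))) ^ k := by
        congr 1
        refine tsum_congr fun k => ?_
        have e1 : t * t ^ (-s') = t ^ (-(s' - 1)) := by
          rw [show -(s' - 1) = 1 + -s' by ring, ENNReal.rpow_add _ _ ht0 ht, ENNReal.rpow_one]
        have e2 : (2 : ℝ≥0∞) ^ k * (2 ^ k) ^ (-s') = (2 ^ (-(s' - 1))) ^ k := by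
          rw [← ENNReal.rpow_natCast, ← ENNReal.rpow_natCast, ← ENNReal.rpow_mul,
            ← ENNReal.rpow_mul, ← ENNReal.rpow_add _ _ (by norm_num) (by norm_num)]
          congr 1; ring
        rw [ENNReal.mul_rpow_of_ne_top (by finiteness) ht, ← e1, ← e2]
        ring
    _ = _ := by
        rw [ENNReal.tsum_mul_left, ENNReal.tsum_geometric]
        ring

lemma lintegral_cellDens_rpow_ne_top (hL : 0 < L) (d : ℝ) {s : ℝ} (hs : 1 ≤ s)
    (μ : Measure (Euc N)) [IsFiniteMeasure μ] (j : ℕ) :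
    ∫⁻ x, cellDens d L μ j x ^ s ≠ ∞ := by
  have h1 := lintegral_mul_cellDens hL d μ (j := j) (ψ := fun _ => 1) (fun _ _ _ => rfl)
  simp only [one_mul, lintegral_one] at h1
  refine ne_top_of_le_ne_top (b := (μ univ * escale L j ^ (-d)) ^ (s - 1) *
    ∫⁻ x, cellDens d L μ j x) ?_ ?_
  · rw [h1]
    have := escale_rpow_ne_top hL j (-d)
    have := escale_rpow_ne_top hL j (N - d)
    have : 0 ≤ s - 1 := by linarith
    finiteness
  · rw [← lintegral_const_mul _ (measurable_cellDens d L μ j)]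
    refine lintegral_mono fun x => ?_
    nth_rw 1 [show s = (s - 1) + 1 by ring]
    rw [ENNReal.rpow_add_of_nonneg _ _ (by linarith) zero_le_one, ENNReal.rpow_one]
    gcongr
    exact mul_le_mul_left (measure_mono (subset_univ _)) _

/-- A finite measure controlled by the Bessel capacity satisfies the testing condition. -/
theorem cellTesting_of_le_besselCap {σ s : ℝ} (hσ : 0 < σ) (hσN : σ < N) (hs : 1 < s)
    (hL : 0 < L) {μ : Measure (Euc N)} [IsFiniteMeasure μ] {C₁ : ℝ≥0∞} (hC₁ : C₁ ≠ ∞)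
    (hcap : ∀ K, IsCompact K → μ K ≤ C₁ * besselCap N σ (s / (s - 1)) K) :
    CellTesting (N - σ) s L μ := by
  set d := (N : ℝ) - σ with hd
  have hs1 : 0 < s - 1 := by linarith
  set s' := s / (s - 1) with hs'
  have hs'1 : 1 < s' := by rw [hs', one_lt_div hs1]; linarith
  obtain ⟨B, hB, h1⟩ := exists_measure_le_tsum_cellDens_le hσ hσN (by linarith) hL hC₁ hcap
  obtain ⟨B', hB', h2⟩ := exists_setLIntegral_tsum_cellDens_le hs'1 hB h1
  obtain ⟨t, ht0, ht, htB⟩ : ∃ t : ℝ≥0∞, t ≠ 0 ∧ t ≠ ∞ ∧ B' * t ^ (-(s' - 1)) ≤ 2⁻¹ := by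
    refine ⟨(2 * B' + 1) ^ (1 / (s' - 1)), ?_, ?_, ?_⟩
    · exact (ENNReal.rpow_pos (by simp) (by finiteness)).ne'
    · have : 0 ≤ 1 / (s' - 1) := by have : 0 < s' - 1 := by linarith
                                    positivity
      finiteness
    · rw [← ENNReal.rpow_mul, show 1 / (s' - 1) * -(s' - 1) = -1 by
        have : s' - 1 ≠ 0 := by linarith
        field_simp, ENNReal.rpow_neg_one, ← div_eq_mul_inv]
      refine ENNReal.div_le_of_le_mul ?_
      calc B' = 2⁻¹ * (2 * B') := by
            rw [← mul_assoc, ENNReal.inv_mul_cancel (by norm_num) (by norm_num), one_mul]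
        _ ≤ _ := by gcongr; exact le_self_add
  set A : ℝ≥0∞ := (1 - 2 ^ (-((N : ℝ) - d)))⁻¹ with hA
  have hAt : A ≠ ∞ := inv_one_sub_two_rpow_neg_ne_top (by rw [hd]; linarith)
  refine ⟨A * (2 * t), by finiteness, fun E hE => ?_⟩
  unfold cellEnergy
  rw [ENNReal.tsum_eq_iSup_nat]
  refine iSup_le fun n => (sum_lintegral_cellDens_rpow_le hL hs _ n).trans ?_
  rw [← hA, mul_assoc]
  refine mul_le_mul_right ?_ _
  set a := cellDens d L (μ.restrict E) with ha
  set M : Euc N → ℝ≥0∞ := fun x => (Finset.range n).sup fun j => a j x with hM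
  have ham : ∀ j, Measurable (a j) := fun j => measurable_cellDens d L _ j
  have hMm : Measurable M := by
    simp only [hM, Finset.sup_eq_iSup]
    exact Measurable.iSup fun j => Measurable.iSup fun _ => ham j
  set Y := ∫⁻ x, M x ^ s with hY
  have hMle : ∀ x, ∀ r : ℝ, 0 < r → M x ^ r ≤ ∑ j ∈ Finset.range n, a j x ^ r := by
    intro x r hr
    rcases (Finset.range n).eq_empty_or_nonempty with h0 | h0
    · simp [hM, h0, hr]
    · obtain ⟨j, hj, hjM⟩ := Finset.exists_mem_eq_sup _ h0 fun j => a j x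
      simp only [hM]
      rw [hjM]
      exact Finset.single_le_sum (f := fun j => a j x ^ r) (fun _ _ => zero_le) hj
  have hYt : Y ≠ ∞ := by
    refine ne_top_of_le_ne_top (b := ∑ j ∈ Finset.range n, ∫⁻ x, a j x ^ s) ?_ ?_
    · exact ENNReal.sum_ne_top.2 fun j _ => lintegral_cellDens_rpow_ne_top hL d hs.le _ j
    · rw [← lintegral_finsetSum _ fun j _ => (ham j).pow_const s]
      exact lintegral_mono fun x => hMle x s (by linarith)
  set g : Euc N → ℝ≥0∞ := fun x => M x ^ (s - 1) with hg
  have hgm : Measurable g := hMm.pow_const _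
  have hgY : ∫⁻ x, g x ^ s' = Y := by
    refine lintegral_congr fun x => ?_
    rw [hg, ← ENNReal.rpow_mul, hs', mul_div_cancel₀ _ hs1.ne']
  have hYle : Y ≤ ∫⁻ x in E, ∑' j, cellDens d L (volume.withDensity g) j x ∂μ := by
    calc Y ≤ ∫⁻ x, g x * ∑' j, a j x := by
          refine lintegral_mono fun x => ?_
          nth_rw 1 [show s = (s - 1) + 1 by ring]
          rw [ENNReal.rpow_add_of_nonneg _ _ hs1.le zero_le_one]
          refine mul_le_mul_right ((hMle x 1 one_pos).trans ?_) _
          simp only [ENNReal.rpow_one]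
          exact ENNReal.sum_le_tsum _
      _ = ∫⁻ x, ∑' j, a j x ∂(volume.withDensity g) :=
          (lintegral_withDensity_eq_lintegral_mul _ hgm (Measurable.tsum ham)).symm
      _ = ∑' j, ∫⁻ x, a j x ∂(volume.withDensity g) := lintegral_tsum fun j => (ham j).aemeasurable
      _ = ∑' j, ∫⁻ x in E, cellDens d L (volume.withDensity g) j x ∂μ := by
          refine tsum_congr fun j => ?_
          simp only [ha, cellDens]
          rw [lintegral_mul_const' _ _ (escale_rpow_ne_top hL j _),
            lintegral_mul_const' _ _ (escale_rpow_ne_top hL j _)]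
          congr 1
          have := lintegral_cell_swap (L := L) (j := j) (ψ := fun _ => 1) (fun _ _ _ => rfl)
            (μ.restrict E) (volume.withDensity g)
          simpa only [one_mul] using this
      _ = _ := (lintegral_tsum fun j => (measurable_cellDens _ _ _ j).aemeasurable).symm
  have h3 := hYle.trans (h2 g hgm t ht0 ht E)
  rw [hgY] at h3
  have h4 : Y ≤ t * μ E + 2⁻¹ * Y := h3.trans (by gcongr)
  have h5 : 2⁻¹ * Y ≤ t * μ E := by
    have hh : 2⁻¹ * Y + 2⁻¹ * Y = Y := by rw [← add_mul, ENNReal.inv_two_add_inv_two, one_mul]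
    refine ENNReal.le_of_add_le_add_right (a := 2⁻¹ * Y) (by finiteness) ?_
    rwa [hh]
  calc Y = 2 * (2⁻¹ * Y) := by
        rw [← mul_assoc, ENNReal.mul_inv_cancel (by norm_num) (by norm_num), one_mul]
    _ ≤ 2 * (t * μ E) := by gcongr
    _ = _ := by ring

lemma lintegral_tail_mul_le {s : ℝ} (hN : 0 < N) (hs : 1 < s) :
    ∃ C : ℝ≥0∞, C ≠ ∞ ∧ ∀ (g : Euc N → ℝ≥0∞), Measurable g → ∀ x : Euc N,
      ∫⁻ y, ENNReal.ofReal ((1 + ‖x - y‖) ^ (-(N : ℝ))) * g y ≤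
        C * (∫⁻ y, g y ^ (s / (s - 1))) ^ (1 / (s / (s - 1))) := by
  have hN' : (0 : ℝ) < N := by exact_mod_cast hN
  have hpq : s.HolderConjugate (s / (s - 1)) := Real.HolderConjugate.conjExponent hs
  set h : Euc N → ℝ≥0∞ := fun z => ENNReal.ofReal ((1 + ‖z‖) ^ (-((N : ℝ) * s))) with hh
  have hfin : ∫⁻ z, h z ≠ ∞ := by
    refine (finite_integral_one_add_norm (E := Euc N) (μ := volume) ?_).ne
    rw [finrank_euclideanSpace_fin]
    nlinarith
  refine ⟨(∫⁻ z, h z) ^ (1 / s), ENNReal.rpow_ne_top_of_nonneg (by positivity) hfin,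
    fun g hg x => ?_⟩
  refine (ENNReal.lintegral_mul_le_Lp_mul_Lq volume hpq
    (f := fun y => ENNReal.ofReal ((1 + ‖x - y‖) ^ (-(N : ℝ)))) (g := g) ?_ hg.aemeasurable).trans
    (le_of_eq ?_)
  · fun_prop
  congr 2
  rw [← lintegral_sub_left_eq_self h x]
  refine lintegral_congr fun y => ?_
  rw [hh, ENNReal.ofReal_rpow_of_pos (by positivity), ← Real.rpow_mul (by positivity)]
  congr 2; ring

lemma lintegral_tsum_ball_indicator (d : ℝ) (g : Euc N → ℝ≥0∞) (hg : Measurable g) (x : Euc N) :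
    ∫⁻ y, (∑' j, (ball x (dscale L j)).indicator (fun _ => escale L j ^ (-d)) y) * g y =
      ∑' j, escale L j ^ (-d) * ∫⁻ y in ball x (dscale L j), g y := by
  simp_rw [← ENNReal.tsum_mul_right]
  rw [lintegral_tsum (f := fun j y => (ball x (dscale L j)).indicator
    (fun _ => escale L j ^ (-d)) y * g y) fun j =>
    ((measurable_const.indicator measurableSet_ball).mul hg).aemeasurable]
  refine tsum_congr fun j => ?_
  rw [← lintegral_const_mul _ hg, ← lintegral_indicator measurableSet_ball]
  refine lintegral_congr fun y => ?_
  by_cases hy : y ∈ ball x (dscale L j) <;> simp [hy]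

lemma le_rpow_mul_of_le_mul_rpow {s : ℝ} (hs : 1 < s) {a A Y : ℝ≥0∞} (ha : a ≠ ∞)
    (h : a ≤ A * (Y ^ (1 / (s / (s - 1))) * a ^ (1 / s))) : a ≤ A ^ (s / (s - 1)) * Y := by
  have hs1 : 0 < s - 1 := by linarith
  have hs' : 0 < s / (s - 1) := by positivity
  rcases eq_or_ne a 0 with rfl | ha0
  · exact zero_le
  have h1 : a ^ (1 / (s / (s - 1))) ≤ A * Y ^ (1 / (s / (s - 1))) := by
    refine (ENNReal.mul_le_mul_iff_left (c := a ^ (1 / s)) ?_ ?_).1 ?_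
    · exact (ENNReal.rpow_pos (pos_iff_ne_zero.2 ha0) ha).ne'
    · exact ENNReal.rpow_ne_top_of_nonneg (by positivity) ha
    · rw [← ENNReal.rpow_add _ _ ha0 ha, show 1 / (s / (s - 1)) + 1 / s = 1 by field_simp; ring,
        ENNReal.rpow_one, mul_assoc]
      exact h
  have h2 := ENNReal.rpow_le_rpow h1 hs'.le
  rwa [ENNReal.mul_rpow_of_nonneg _ _ hs'.le, ← ENNReal.rpow_mul, ← ENNReal.rpow_mul,
    one_div_mul_cancel hs'.ne', ENNReal.rpow_one, ENNReal.rpow_one] at h2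

/-- Energy bounds imply capacity bounds. -/
theorem exists_measure_univ_le_besselCap {σ s : ℝ} (hσ : 0 < σ) (hσN : σ < N) (hs : 1 < s)
    (hL : 0 < L) {C₀ M : ℝ≥0∞} (hC₀ : C₀ ≠ ∞) (hM : M ≠ ∞) :
    ∃ C : ℝ≥0∞, C ≠ ∞ ∧ ∀ (κ : Measure (Euc N)), κ univ ≤ M →
      cellEnergy (N - σ) s L κ ≤ C₀ * κ univ → ∀ K, (∀ᵐ x ∂κ, x ∈ K) →
        κ univ ≤ C * besselCap N σ (s / (s - 1)) K := by
  have hN : 0 < N := by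
    have : (0 : ℝ) < N := hσ.trans hσN
    exact_mod_cast this
  have hs1 : 0 < s - 1 := by linarith
  have hpq : s.HolderConjugate (s / (s - 1)) := Real.HolderConjugate.conjExponent hs
  set s' := s / (s - 1) with hs'
  have hs'0 : 0 < s' := by positivity
  obtain ⟨C1, hC1, h1⟩ := exists_besselKernel_le_tsum hσ hσN hL
  obtain ⟨C2, hC2, h2⟩ := exists_lintegral_tsum_ball_le (N := N) (d := N - σ) (by linarith) hs
  obtain ⟨Cf, hCf, h3⟩ := lintegral_tail_mul_le hN hs
  have hcf : (C2 * C₀) ^ (1 / s) ≠ ∞ :=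
    ENNReal.rpow_ne_top_of_nonneg (by positivity) (by finiteness)
  refine ⟨(2 * C1 * (C2 * C₀) ^ (1 / s)) ^ s' + M * (2 * (C1 * Cf)) ^ s' + 1, by finiteness,
    fun κ hκM hE K hK => ?_⟩
  have hκfin : IsFiniteMeasure κ := ⟨hκM.trans_lt hM.lt_top⟩
  rw [mul_comm, ← ENNReal.div_le_iff (by simp) (by finiteness)]
  refine le_iInf fun g => le_iInf fun hg => le_iInf fun hgK => ?_
  refine ENNReal.div_le_of_le_mul' ?_
  set Y := ∫⁻ x, g x ^ s' with hY
  have hpt : ∀ x ∈ K, 1 ≤ C1 * (∑' j, escale L j ^ (-((N : ℝ) - σ)) *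
      ∫⁻ y in ball x (dscale L j), g y) + C1 * Cf * Y ^ (1 / s') := by
    intro x hx
    refine (hgK x hx).trans ?_
    calc _ ≤ ∫⁻ y, C1 * ((∑' j, (ball x (dscale L j)).indicator
            (fun _ => escale L j ^ (-((N : ℝ) - σ))) y) * g y +
            ENNReal.ofReal ((1 + ‖x - y‖) ^ (-(N : ℝ))) * g y) := by
          refine lintegral_mono_ae ?_
          filter_upwards [ae_ne_of_pos hN x] with y hy
          rw [← add_mul, ← mul_assoc]
          exact mul_le_mul_left (h1 x y hy) _
      _ ≤ _ := by
          rw [lintegral_const_mul' _ _ hC1, lintegral_add_right _ (by fun_prop),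
            lintegral_tsum_ball_indicator _ g hg, mul_add, mul_assoc C1 Cf]
          gcongr
          exact h3 g hg x
  have hInt : κ univ ≤ C1 * (∫⁻ x, g x * ∑' j, κ (ball x (dscale L j)) *
      escale L j ^ (-((N : ℝ) - σ))) + C1 * Cf * Y ^ (1 / s') * κ univ := by
    calc κ univ = ∫⁻ x, 1 ∂κ := by simp
      _ ≤ ∫⁻ x, (C1 * (∑' j, escale L j ^ (-((N : ℝ) - σ)) *
            ∫⁻ y in ball x (dscale L j), g y) + C1 * Cf * Y ^ (1 / s')) ∂κ :=
          lintegral_mono_ae (hK.mono hpt)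
      _ = _ := by
          rw [lintegral_add_right _ measurable_const, lintegral_const,
            lintegral_const_mul' _ _ hC1]
          congr 2
          have hme : ∀ j, Measurable fun x => ∫⁻ y in ball x (dscale L j), g y := by
            intro j
            have := measurable_measure_ball (volume.withDensity g) (dscale L j)
            simpa only [withDensity_apply _ measurableSet_ball] using this
          rw [lintegral_tsum fun j => ((hme j).const_mul _).aemeasurable]
          simp_rw [← ENNReal.tsum_mul_left]
          rw [lintegral_tsum (f := fun j x => g x * (κ (ball x (dscale L j)) *
            escale L j ^ (-((N : ℝ) - σ)))) fun j =>
            (hg.mul ((measurable_measure_ball κ _).mul_const _)).aemeasurable]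
          refine tsum_congr fun j => ?_
          rw [lintegral_const_mul _ (hme j), lintegral_measure_ball_swap κ volume g hg,
            ← lintegral_const_mul' _ _ (escale_rpow_ne_top hL j _)]
          exact lintegral_congr fun x => by ring
  rcases le_or_gt (C1 * Cf * Y ^ (1 / s')) 2⁻¹ with hsm | hbig
  · have h5 : κ univ ≤ 2 * C1 * (∫⁻ x, g x * ∑' j, κ (ball x (dscale L j)) *
      escale L j ^ (-((N : ℝ) - σ))) := by
      have h4 := hInt.trans (add_le_add_right (mul_le_mul_left hsm _) _)
      have hh : 2⁻¹ * κ univ + 2⁻¹ * κ univ = κ univ := by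
        rw [← add_mul, ENNReal.inv_two_add_inv_two, one_mul]
      have h6 : 2⁻¹ * κ univ ≤ C1 * (∫⁻ x, g x * ∑' j, κ (ball x (dscale L j)) *
          escale L j ^ (-((N : ℝ) - σ))) := by
        refine ENNReal.le_of_add_le_add_right (a := 2⁻¹ * κ univ) (by finiteness) ?_
        rwa [hh]
      calc κ univ = 2 * (2⁻¹ * κ univ) := by
            rw [← mul_assoc, ENNReal.mul_inv_cancel (by norm_num) (by norm_num), one_mul]
        _ ≤ _ := by rw [mul_assoc 2]; exact mul_le_mul_right h6 _
    have h7 : (∫⁻ x, g x * ∑' j, κ (ball x (dscale L j)) * escale L j ^ (-((N : ℝ) - σ))) ≤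
        Y ^ (1 / s') * (C2 * (C₀ * κ univ)) ^ (1 / s) := by
      refine (ENNReal.lintegral_mul_le_Lp_mul_Lq volume hpq.symm hg.aemeasurable
        (Measurable.tsum fun j =>
          (measurable_measure_ball κ _).mul_const _).aemeasurable).trans ?_
      refine mul_le_mul_right (ENNReal.rpow_le_rpow ?_ (by positivity)) _
      exact (h2 L hL κ).trans (mul_le_mul_right hE _)
    refine (le_rpow_mul_of_le_mul_rpow hs (A := 2 * C1 * (C2 * C₀) ^ (1 / s)) (Y := Y)
      (by finiteness) (h5.trans ((mul_le_mul_right h7 _).trans (le_of_eq ?_)))).trans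
      (mul_le_mul_left (le_add_right le_self_add) _)
    rw [← mul_assoc C2, ENNReal.mul_rpow_of_nonneg _ _ (by positivity)]
    ring
  · have h8 : 1 ≤ (2 * (C1 * Cf)) ^ s' * Y := by
      have h9 : 1 ≤ 2 * (C1 * Cf) * Y ^ (1 / s') := by
        calc (1 : ℝ≥0∞) = 2 * 2⁻¹ := (ENNReal.mul_inv_cancel (by norm_num) (by norm_num)).symm
          _ ≤ _ := by rw [mul_assoc 2]; exact mul_le_mul_right hbig.le _
      have h10 := ENNReal.rpow_le_rpow h9 hs'0.le
      rwa [ENNReal.one_rpow, ENNReal.mul_rpow_of_nonneg _ _ hs'0.le, ← ENNReal.rpow_mul,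
        one_div_mul_cancel hs'0.ne', ENNReal.rpow_one] at h10
    calc κ univ ≤ M * 1 := by rwa [mul_one]
      _ ≤ M * ((2 * (C1 * Cf)) ^ s' * Y) := mul_le_mul_right h8 _
      _ ≤ _ := by
          rw [← mul_assoc]
          exact mul_le_mul_left (le_add_right le_add_self) _

/-- The testing condition implies the capacity condition. -/
theorem exists_le_besselCap_of_cellTesting {σ s : ℝ} (hσ : 0 < σ) (hσN : σ < N) (hs : 1 < s)
    (hL : 0 < L) {μ : Measure (Euc N)} [IsFiniteMeasure μ] (h : CellTesting (N - σ) s L μ) :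
    ∃ C : ℝ≥0∞, C ≠ ∞ ∧ ∀ K, MeasurableSet K → μ K ≤ C * besselCap N σ (s / (s - 1)) K := by
  obtain ⟨C₀, hC₀, h⟩ := h
  obtain ⟨C, hC, hcap⟩ := exists_measure_univ_le_besselCap hσ hσN hs hL hC₀ (measure_ne_top μ univ)
  refine ⟨C, hC, fun K hK => ?_⟩
  have := hcap (μ.restrict K) (by simpa using measure_mono (μ := μ) (subset_univ K))
    (by simpa using h K hK) K (ae_restrict_mem hK)
  simpa using this

lemma wolff_integrand_eq {e κ ρ : ℝ} (he : 0 ≤ e) (hρ : 0 < ρ) (m : ℝ≥0∞) :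
    (m / ENNReal.ofReal (ρ ^ κ)) ^ e / ENNReal.ofReal ρ =
      m ^ e * ENNReal.ofReal (ρ ^ (-(e * κ) - 1)) := by
  have h1 : (ENNReal.ofReal (ρ ^ κ) ^ e)⁻¹ * (ENNReal.ofReal ρ)⁻¹ =
      ENNReal.ofReal (ρ ^ (-(e * κ) - 1)) := by
    rw [ENNReal.ofReal_rpow_of_pos (by positivity), ← ENNReal.ofReal_inv_of_pos (by positivity),
      ← ENNReal.ofReal_inv_of_pos hρ, ← ENNReal.ofReal_mul (by positivity), ← Real.rpow_mul hρ.le,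
      ← Real.rpow_neg hρ.le, ← Real.rpow_neg_one ρ, ← Real.rpow_add hρ]
    congr 2; ring
  rw [ENNReal.div_rpow_of_nonneg _ _ he, div_eq_mul_inv, div_eq_mul_inv, mul_assoc, h1]

lemma wolff_ofReal_eq {α p : ℝ} (hp : 1 < p) (μ : Measure (Euc N)) (x : Euc N) :
    wolff α p (ENNReal.ofReal L) μ x = ∫⁻ ρ in Ioo 0 L, μ (ball x ρ) ^ (1 / (p - 1)) *
      ENNReal.ofReal (ρ ^ (-(1 / (p - 1) * ((N : ℝ) - α * p)) - 1)) := by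
  have hset : {ρ : ℝ | 0 < ρ ∧ ENNReal.ofReal ρ < ENNReal.ofReal L} = Ioo 0 L := by
    ext ρ
    simp only [mem_ofPred_eq, mem_Ioo]
    refine and_congr_right fun h => ?_
    constructor
    · intro h'
      by_contra! hL
      exact absurd h' (not_lt.2 (ENNReal.ofReal_le_ofReal hL))
    · exact fun h' => (ENNReal.ofReal_lt_ofReal_iff (h.trans h')).2 h'
  have he : 0 ≤ 1 / (p - 1) := by
    have : 0 < p - 1 := by linarith
    positivity
  rw [wolff, hset]
  exact setLIntegral_congr_fun measurableSet_Ioo fun ρ hρ => wolff_integrand_eq he hρ.1 _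

lemma measurable_measure_ball_prod (μ : Measure (Euc N)) [SFinite μ] :
    Measurable fun z : Euc N × ℝ => μ (ball z.1 z.2) := by
  have hm : MeasurableSet {w : (Euc N × ℝ) × Euc N | dist w.2 w.1.1 < w.1.2} :=
    measurableSet_lt (by fun_prop) (by fun_prop)
  exact measurable_measure_prodMk_left hm

lemma measurable_wolff {α p : ℝ} (hp : 1 < p) (μ : Measure (Euc N)) [SFinite μ] :
    Measurable (wolff α p (ENNReal.ofReal L) μ) := by
  have h : wolff α p (ENNReal.ofReal L) μ = _ := funext fun x => wolff_ofReal_eq hp μ x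
  rw [h]
  refine Measurable.lintegral_prod_right' (f := fun z : Euc N × ℝ =>
    μ (ball z.1 z.2) ^ (1 / (p - 1)) *
      ENNReal.ofReal (z.2 ^ (-(1 / (p - 1) * ((N : ℝ) - α * p)) - 1))) ?_
  exact ((measurable_measure_ball_prod μ).pow_const _).mul (by fun_prop)

lemma Ioo_eq_iUnion_dscale (hL : 0 < L) :
    Ioo 0 L = ⋃ j : ℕ, Ico (dscale L (j + 1)) (dscale L j) := by
  ext ρ
  simp only [mem_Ioo, mem_iUnion, mem_Ico]
  constructor
  · exact fun h => exists_dscale_band L h.1 h.2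
  · rintro ⟨j, h1, h2⟩
    exact ⟨(dscale_pos hL _).trans_le h1,
      h2.trans_le ((dscale_anti hL (Nat.zero_le j)).trans_eq (dscale_zero L))⟩

lemma wolff_eq_tsum {α p : ℝ} (hp : 1 < p) (hL : 0 < L) (μ : Measure (Euc N)) (x : Euc N) :
    wolff α p (ENNReal.ofReal L) μ x = ∑' j : ℕ, ∫⁻ ρ in Ico (dscale L (j + 1)) (dscale L j),
      μ (ball x ρ) ^ (1 / (p - 1)) *
        ENNReal.ofReal (ρ ^ (-(1 / (p - 1) * ((N : ℝ) - α * p)) - 1)) := by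
  rw [wolff_ofReal_eq hp, Ioo_eq_iUnion_dscale hL, lintegral_iUnion fun _ => measurableSet_Ico]
  exact Antitone.pairwise_disjoint_on_Ico_succ (f := dscale L) fun i j h => dscale_anti hL h

lemma volume_Ico_dscale (j : ℕ) :
    volume (Ico (dscale L (j + 1)) (dscale L j)) = escale L (j + 1) := by
  rw [Real.volume_Ico, escale]
  congr 1
  rw [dscale_succ L j]; ring

/-- The Wolff potential is bounded by its dyadic discretization. -/
lemma wolff_le_tsum_ballTerm {α p z : ℝ} (hp : 1 < p) (hz : z = 1 / (p - 1) * ((N : ℝ) - α * p))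
    (hz0 : 0 < z) (hL : 0 < L) (μ : Measure (Euc N)) (x : Euc N) :
    wolff α p (ENNReal.ofReal L) μ x ≤ 2 ^ z * ∑' j, ballTerm (1 / (p - 1)) z L μ j x := by
  have he : 0 ≤ 1 / (p - 1) := by
    have : 0 < p - 1 := by linarith
    positivity
  rw [wolff_eq_tsum hp hL, ← hz, ← ENNReal.tsum_mul_left]
  refine ENNReal.tsum_le_tsum fun j => ?_
  have hpos := dscale_pos hL (j + 1)
  calc _ ≤ ∫⁻ ρ in Ico (dscale L (j + 1)) (dscale L j), μ (ball x (dscale L j)) ^ (1 / (p - 1)) *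
        escale L (j + 1) ^ (-z - 1) := by
        refine setLIntegral_mono measurable_const fun ρ hρ => ?_
        rw [escale_rpow_eq hL]
        refine mul_le_mul' (ENNReal.rpow_le_rpow
          (measure_mono (ball_subset_ball hρ.2.le)) he) (ENNReal.ofReal_le_ofReal ?_)
        exact Real.rpow_le_rpow_of_nonpos hpos hρ.1 (by linarith)
    _ = _ := by
        have h1 : escale L (j + 1) ^ (-z - 1) * escale L (j + 1) = escale L j ^ (-z) * 2 ^ z := by
          nth_rw 2 [← ENNReal.rpow_one (escale L (j + 1))]
          rw [← escale_rpow_add hL, show -z - 1 + 1 = -z by ring, escale_add_rpow, neg_neg, pow_one]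
        rw [setLIntegral_const, volume_Ico_dscale, ballTerm, mul_assoc, h1]
        ring

/-- The Wolff potential dominates its dyadic discretization without the top scale. -/
lemma tsum_ballTerm_le_wolff {α p z : ℝ} (hp : 1 < p) (hz : z = 1 / (p - 1) * ((N : ℝ) - α * p))
    (hz0 : 0 < z) (hL : 0 < L) (μ : Measure (Euc N)) (x : Euc N) :
    ∑' j, ballTerm (1 / (p - 1)) z L μ (j + 1) x ≤
      2 ^ (z + 1) * wolff α p (ENNReal.ofReal L) μ x := by
  have he : 0 ≤ 1 / (p - 1) := by
    have : 0 < p - 1 := by linarith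
    positivity
  rw [wolff_eq_tsum hp hL, ← hz, ← ENNReal.tsum_mul_left]
  refine ENNReal.tsum_le_tsum fun j => ?_
  have hpos := dscale_pos hL (j + 1)
  rw [← lintegral_const_mul' _ _ (ENNReal.rpow_ne_top_of_nonneg (by linarith) (by norm_num))]
  calc _ = ∫⁻ ρ in Ico (dscale L (j + 1)) (dscale L j), 2 ^ (z + 1) *
        (μ (ball x (dscale L (j + 1))) ^ (1 / (p - 1)) * escale L j ^ (-z - 1)) := by
        have h1 : escale L (j + 1) ^ (-z) =
            2 ^ (z + 1) * escale L j ^ (-z - 1) * escale L (j + 1) := by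
          have := escale_add_rpow L j 1 (-z - 1)
          rw [pow_one, show -(-z - 1) = z + 1 by ring] at this
          rw [mul_comm (2 ^ (z + 1)), ← this]
          nth_rw 3 [← ENNReal.rpow_one (escale L (j + 1))]
          rw [← escale_rpow_add hL, show -z - 1 + 1 = -z by ring]
        rw [setLIntegral_const, volume_Ico_dscale, ballTerm, h1]
        ring
    _ ≤ _ := by
        refine setLIntegral_mono' measurableSet_Ico fun ρ hρ => ?_
        rw [escale_rpow_eq hL]
        refine mul_le_mul_right (mul_le_mul' (ENNReal.rpow_le_rpow
          (measure_mono (ball_subset_ball hρ.1)) he) (ENNReal.ofReal_le_ofReal ?_)) _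
        exact Real.rpow_le_rpow_of_nonpos (hpos.trans_le hρ.1) hρ.2.le (by linarith)

/-- Single-scale lower bound for Wolff potentials. -/
lemma ballTerm_le_wolff {α p z : ℝ} (hp : 1 < p) (hz : z = 1 / (p - 1) * ((N : ℝ) - α * p))
    (hz0 : 0 < z) (hL : 0 < L) (μ : Measure (Euc N)) {j : ℕ} (hj : 1 ≤ j) (x : Euc N) :
    ballTerm (1 / (p - 1)) z L μ j x ≤ 2 ^ (z + 1) * wolff α p (ENNReal.ofReal L) μ x := by
  obtain ⟨i, rfl⟩ := Nat.exists_eq_add_of_le' hj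
  exact (ENNReal.le_tsum (f := fun i => ballTerm (1 / (p - 1)) z L μ (i + 1) x) i).trans
    (tsum_ballTerm_le_wolff hp hz hz0 hL μ x)

/-- Interpolation of Wolff potentials. -/
lemma wolff_rpow_le_mul {α β p q1 q2 : ℝ} (hp : 1 < p) (hq1 : 0 < q1) (hq2 : 0 < q2)
    (μ : Measure (Euc N)) [SFinite μ] (x : Euc N) :
    wolff ((α * q1 + β * q2) / (q1 + q2)) p (ENNReal.ofReal L) μ x ^ (q1 + q2) ≤
      wolff α p (ENNReal.ofReal L) μ x ^ q1 * wolff β p (ENNReal.ofReal L) μ x ^ q2 := by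
  have hq : 0 < q1 + q2 := by positivity
  set e := 1 / (p - 1) with he
  have hm : ∀ t : ℝ, Measurable fun ρ : ℝ => μ (ball x ρ) ^ e * ENNReal.ofReal (ρ ^ t) := fun t =>
    (((measurable_measure_ball_prod μ).comp measurable_prodMk_left).pow_const _).mul (by fun_prop)
  have h1 : wolff ((α * q1 + β * q2) / (q1 + q2)) p (ENNReal.ofReal L) μ x ≤
      wolff α p (ENNReal.ofReal L) μ x ^ (q1 / (q1 + q2)) *
        wolff β p (ENNReal.ofReal L) μ x ^ (q2 / (q1 + q2)) := by
    simp only [wolff_ofReal_eq hp, ← he]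
    refine le_trans (le_of_eq ?_) (ENNReal.lintegral_mul_norm_pow_le (hm _).aemeasurable
      (hm _).aemeasurable (by positivity) (by positivity) (by field_simp))
    refine setLIntegral_congr_fun measurableSet_Ioo fun ρ hρ => ?_
    have hρ0 := hρ.1
    have ha : 0 ≤ q1 / (q1 + q2) := by positivity
    have hb : 0 ≤ q2 / (q1 + q2) := by positivity
    rw [ENNReal.mul_rpow_of_nonneg _ _ ha, ENNReal.mul_rpow_of_nonneg _ _ hb,
      mul_mul_mul_comm, ← ENNReal.rpow_add_of_nonneg _ _ ha hb,
      show q1 / (q1 + q2) + q2 / (q1 + q2) = 1 by field_simp, ENNReal.rpow_one,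
      ENNReal.ofReal_rpow_of_pos (by positivity), ENNReal.ofReal_rpow_of_pos (by positivity),
      ← ENNReal.ofReal_mul (by positivity), ← Real.rpow_mul hρ0.le, ← Real.rpow_mul hρ0.le,
      ← Real.rpow_add hρ0]
    congr 3
    field_simp
    ring
  refine (ENNReal.rpow_le_rpow h1 hq.le).trans (le_of_eq ?_)
  rw [ENNReal.mul_rpow_of_nonneg _ _ hq.le, ← ENNReal.rpow_mul, ← ENNReal.rpow_mul,
    div_mul_cancel₀ _ hq.ne', div_mul_cancel₀ _ hq.ne']

lemma cell_subset_of_mem {i j : ℕ} (hij : i ≤ j) {x y : Euc N} (hy : y ∈ cell L i x) :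
    cell L j y ⊆ cell L i x :=
  (cell_anti hij y).trans (cell_eq_of_mem hy).subset

lemma cellDens_dscale_restrict_cell (d : ℝ) (μ : Measure (Euc N)) (j : ℕ) (x : Euc N) (i : ℕ)
    (y : Euc N) : cellDens d (dscale L j) (μ.restrict (cell L j x)) i y =
      (cell L j x).indicator (cellDens d L μ (j + i)) y := by
  unfold cellDens
  rw [cell_dscale, escale_dscale, Measure.restrict_apply (measurableSet_cell _ _ _)]
  by_cases hy : y ∈ cell L j x
  · rw [indicator_of_mem hy,
      inter_eq_left.2 (cell_subset_of_mem (Nat.le_add_right j i) hy)]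
  · rw [indicator_of_notMem hy]
    have : cell L (j + i) y ∩ cell L j x = ∅ := by
      refine eq_empty_iff_forall_notMem.2 fun z hz => hy ?_
      have h1 : z ∈ cell L j y := cell_anti (Nat.le_add_right j i) y hz.1
      rw [← cell_eq_of_mem hz.2, cell_eq_of_mem h1]
      exact mem_cell_self L j y
    rw [this, measure_empty, zero_mul]

lemma indicator_rpow {s : ℝ} (hs : 0 < s) (A : Set (Euc N)) (f : Euc N → ℝ≥0∞) (y : Euc N) :
    A.indicator f y ^ s = A.indicator (fun y => f y ^ s) y := by
  by_cases hy : y ∈ A <;> simp [hy, hs]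

/-- Localized comparison of the dyadic energy with the dyadic maximal function. -/
lemma tsum_setLIntegral_cellDens_rpow_le (hL : 0 < L) {d s : ℝ} (hs : 1 < s)
    (μ : Measure (Euc N)) (j : ℕ) (x : Euc N) :
    ∑' i, ∫⁻ y in cell L j x, cellDens d L μ (j + i) y ^ s ≤
      (1 - 2 ^ (-(N - d)))⁻¹ * ∫⁻ y in cell L j x, (⨆ i, cellDens d L μ (j + i) y) ^ s := by
  have hs0 : 0 < s := by linarith
  have h := cellEnergy_le_lintegral_iSup (dscale_pos hL j) (d := d) hs (μ.restrict (cell L j x))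
  unfold cellEnergy at h
  simp only [cellDens_dscale_restrict_cell] at h
  have e1 : ∀ y, (⨆ i, (cell L j x).indicator (cellDens d L μ (j + i)) y) =
      (cell L j x).indicator (fun y => ⨆ i, cellDens d L μ (j + i) y) y := by
    intro y
    by_cases hy : y ∈ cell L j x <;> simp [hy]
  simp only [e1, indicator_rpow hs0, lintegral_indicator (measurableSet_cell L j x)] at h
  exact h

lemma cellTesting_of_tsum_setLIntegral_le {d s : ℝ} (hs : 1 < s) {μ : Measure (Euc N)}
    [IsFiniteMeasure μ] {C : ℝ≥0∞} (hC : C ≠ ∞)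
    (h : ∀ j x, ∑' i, ∫⁻ y in cell L j x, cellDens d L μ (j + i) y ^ s ≤ C * μ (cell L j x)) :
    CellTesting d s L μ := by
  refine ⟨C * carlesonConst s, ENNReal.mul_ne_top hC (carlesonConst_ne_top hs), fun E hE => ?_⟩
  have := cellEnergy_le_of_carleson (d := d) hs (κ := μ.restrict E)
    (h := fun j x => μ (cell L j x)) (fun j x => measure_ne_top _ _)
    (fun j x => Measure.restrict_apply_le _ _) (fun j => (cellConst_cell L j).comp μ) h
  simpa using this

/-- The testing condition at fine scales implies the testing condition at coarse scales. -/
lemma CellTesting.of_dscale (hL : 0 < L) {d s : ℝ} (hs : 1 < s) {μ : Measure (Euc N)}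
    [IsFiniteMeasure μ] {m : ℕ} (h : CellTesting d s (dscale L m) μ) : CellTesting d s L μ := by
  obtain ⟨C, hC, h⟩ := h
  set D : ℕ → ℝ≥0∞ := fun j => (μ univ * escale L j ^ (-d)) ^ (s - 1) * escale L j ^ (N - d)
  have hD : ∀ j, D j ≠ ∞ := by
    intro j
    have := escale_rpow_ne_top hL j (-d)
    have := escale_rpow_ne_top hL j (N - d)
    have : 0 ≤ s - 1 := by linarith
    finiteness
  refine ⟨∑ j ∈ Finset.range m, D j + C,
    ENNReal.add_ne_top.2 ⟨ENNReal.sum_ne_top.2 fun j _ => hD j, hC⟩, fun E hE => ?_⟩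
  unfold cellEnergy
  rw [← ENNReal.summable.sum_add_tsum_nat_add' (k := m), add_mul, Finset.sum_mul]
  refine add_le_add (Finset.sum_le_sum fun j _ => ?_) ?_
  · have h1 := lintegral_mul_cellDens hL d (μ.restrict E) (j := j) (ψ := fun _ => 1)
      (fun _ _ _ => rfl)
    simp only [one_mul, lintegral_one, Measure.restrict_apply_univ] at h1
    calc _ ≤ ∫⁻ x, (μ univ * escale L j ^ (-d)) ^ (s - 1) * cellDens d L (μ.restrict E) j x := by
          refine lintegral_mono fun x => ?_
          nth_rw 1 [show s = (s - 1) + 1 by ring]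
          rw [ENNReal.rpow_add_of_nonneg _ _ (by linarith) zero_le_one, ENNReal.rpow_one]
          refine mul_le_mul_left (ENNReal.rpow_le_rpow (mul_le_mul_left ?_ _) (by linarith)) _
          exact (Measure.restrict_apply_le _ _).trans (measure_mono (subset_univ _))
      _ = _ := by
          rw [lintegral_const_mul _ (measurable_cellDens _ _ _ _), h1, mul_assoc]
  · refine le_trans (le_of_eq ?_) (h E hE)
    unfold cellEnergy cellDens
    refine tsum_congr fun j => ?_
    simp only [cell_dscale, escale_dscale, add_comm j m]

lemma mul_dscale_dscale_le (hL : 0 < L) {k : ℝ} {m : ℕ} (hk : k ≤ 2 ^ m) (j : ℕ) :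
    k * dscale (dscale L (m + 1)) j ≤ dscale L (j + 1) := by
  rw [dscale_dscale]
  have : dscale L (j + 1) = 2 ^ m * dscale L (m + 1 + j) := by
    unfold dscale
    rw [show m + 1 + j = m + (j + 1) by ring, pow_add 2 m]
    field_simp
  rw [this]
  exact mul_le_mul_of_nonneg_right hk (dscale_pos hL _).le

/-- The measure whose density is the power of the dyadic maximal function. -/
def maxDensMeasure (d s L : ℝ) (μ : Measure (Euc N)) : Measure (Euc N) :=
  volume.withDensity fun x => (⨆ j, cellDens d L μ j x) ^ s

lemma maxDensMeasure_apply (d s L : ℝ) (μ : Measure (Euc N)) {E : Set (Euc N)}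
    (hE : MeasurableSet E) :
    maxDensMeasure d s L μ E = ∫⁻ x in E, (⨆ j, cellDens d L μ j x) ^ s :=
  withDensity_apply _ hE

lemma tsum_setLIntegral_le_maxDensMeasure (hL : 0 < L) {d s : ℝ} (hs : 1 < s)
    (μ : Measure (Euc N)) (j : ℕ) (x : Euc N) :
    ∑' i, ∫⁻ y in cell L j x, cellDens d L μ (j + i) y ^ s ≤
      (1 - 2 ^ (-(N - d)))⁻¹ * maxDensMeasure d s L μ (cell L j x) := by
  refine (tsum_setLIntegral_cellDens_rpow_le hL hs μ j x).trans (mul_le_mul_right ?_ _)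
  rw [maxDensMeasure_apply _ _ _ _ (measurableSet_cell _ _ _)]
  refine lintegral_mono fun y => ENNReal.rpow_le_rpow ?_ (by linarith)
  exact iSup_le fun i => le_iSup (fun j => cellDens d L μ j y) (j + i)

lemma cellDens_rpow_mul_le (hL : 0 < L) {d s : ℝ} (hs : 1 < s) {μ : Measure (Euc N)}
    {C : ℝ≥0∞} (hfin : maxDensMeasure d s L μ univ ≠ ∞)
    (h : ∀ E, MeasurableSet E → cellEnergy d s L ((maxDensMeasure d s L μ).restrict E) ≤
      C * maxDensMeasure d s L μ E) (j : ℕ) (x : Euc N) :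
    cellDens d L μ j x ^ (s - 1) * escale L j ^ (N - d) ≤ C ^ (1 / s) := by
  have hs0 : 0 < s := by linarith
  have hs1 : 0 < s - 1 := by linarith
  set ν := maxDensMeasure d s L μ with hν
  set P := cell L j x with hP
  have hPm : MeasurableSet P := measurableSet_cell _ _ _
  set a := cellDens d L μ j x with ha
  have hνfin : ν P ≠ ∞ := ne_top_of_le_ne_top hfin (measure_mono (subset_univ _))
  have h0 := escale_ne_zero hL j
  have ht := escale_ne_top L j
  have h1 : a ^ s * escale L j ^ (N : ℝ) ≤ ν P := by
    rw [hν, maxDensMeasure_apply _ _ _ _ hPm, ← volume_cell hL j x, ← setLIntegral_const]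
    refine setLIntegral_mono' hPm fun y hy => ENNReal.rpow_le_rpow ?_ hs0.le
    rw [ha, ← cellConst_cellDens d L μ j y x hy]
    exact le_iSup (fun j => cellDens d L μ j y) j
  have h2 : (ν P * escale L j ^ (-d)) ^ s * escale L j ^ (N : ℝ) ≤ C * ν P := by
    refine le_trans ?_ (h P hPm)
    refine le_trans ?_ (ENNReal.le_tsum j)
    rw [← volume_cell hL j x, ← setLIntegral_const]
    refine le_trans (setLIntegral_mono' hPm fun y hy => ?_) (setLIntegral_le_lintegral P _)
    refine ENNReal.rpow_le_rpow ?_ hs0.le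
    unfold cellDens
    rw [cell_eq_of_mem hy, Measure.restrict_apply hPm, inter_self]
  have h3 : ν P ^ (s - 1) * escale L j ^ (N - d * s) ≤ C := by
    rcases eq_or_ne (ν P) 0 with hz | hz
    · rw [hz, ENNReal.zero_rpow_of_pos hs1, zero_mul]; exact zero_le
    refine (ENNReal.mul_le_mul_iff_left hz hνfin).1 (le_trans (le_of_eq ?_) h2)
    rw [ENNReal.mul_rpow_of_nonneg _ _ hs0.le, ← ENNReal.rpow_mul,
      mul_assoc (ν P ^ s), ← escale_rpow_add hL, mul_right_comm]
    congr 1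
    · nth_rw 2 [← ENNReal.rpow_one (ν P)]
      rw [← ENNReal.rpow_add_of_nonneg _ _ hs1.le zero_le_one]
      congr 1; ring
    · congr 1; ring
  have h4 : (a ^ (s - 1) * escale L j ^ (N - d)) ^ s ≤ C := by
    refine le_trans (le_of_eq ?_) ((mul_le_mul_left (ENNReal.rpow_le_rpow h1 hs1.le) _).trans h3)
    rw [ENNReal.mul_rpow_of_nonneg _ _ hs0.le, ENNReal.mul_rpow_of_nonneg _ _ hs1.le,
      ← ENNReal.rpow_mul, ← ENNReal.rpow_mul, ← ENNReal.rpow_mul, ← ENNReal.rpow_mul, mul_assoc,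
      ← escale_rpow_add hL]
    congr 2 <;> ring
  calc _ = ((a ^ (s - 1) * escale L j ^ (N - d)) ^ s) ^ (1 / s) := by
        rw [← ENNReal.rpow_mul, mul_one_div_cancel hs0.ne', ENNReal.rpow_one]
    _ ≤ _ := ENNReal.rpow_le_rpow h4 (by positivity)

/-- Contribution of the cells of small density. -/
lemma tsum_setLIntegral_small_le (hL : 0 < L) {d s : ℝ} (hs : 1 < s)
    (μ : Measure (Euc N)) (lam : ℝ≥0∞) (j : ℕ) (x : Euc N) :
    ∑' i, ∫⁻ y in cell L j x, {y | cellDens d L μ (j + i) y ≤ lam}.indicator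
        (fun y => cellDens d L μ (j + i) y ^ s) y ≤
      (1 - 2 ^ (-(N - d)))⁻¹ * (lam ^ (s - 1) * escale L j ^ (N - d) * μ (cell L j x)) := by
  have hs1 : 0 < s - 1 := by linarith
  set P := cell L j x with hP
  have hPm : MeasurableSet P := measurableSet_cell _ _ _
  have hterm : ∀ i, ∫⁻ y in P, {y | cellDens d L μ (j + i) y ≤ lam}.indicator
        (fun y => cellDens d L μ (j + i) y ^ s) y ≤
      lam ^ (s - 1) * escale L j ^ (N - d) * μ P * (2 ^ (-(N - d))) ^ i := by
    intro i
    have hm := measurable_cellDens d L μ (j + i)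
    calc _ ≤ ∫⁻ y in P, lam ^ (s - 1) * cellDens d L μ (j + i) y := by
          refine lintegral_mono (indicator_le fun y hy => ?_)
          nth_rw 1 [show s = (s - 1) + 1 by ring]
          rw [ENNReal.rpow_add_of_nonneg _ _ hs1.le zero_le_one, ENNReal.rpow_one]
          exact mul_le_mul_left (ENNReal.rpow_le_rpow hy hs1.le) _
      _ = lam ^ (s - 1) * (escale L (j + i) ^ (N - d) * μ P) := by
          rw [lintegral_const_mul _ hm]
          congr 1
          have hψ : CellConst L (j + i) (P.indicator fun _ => (1 : ℝ≥0∞)) :=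
            ((cellConst_mem_cell L j x).indicator fun _ _ _ => rfl).mono (Nat.le_add_right j i)
          have := lintegral_mul_cellDens hL d μ hψ
          rw [lintegral_indicator_const hPm, one_mul] at this
          rw [← this, ← lintegral_indicator hPm]
          refine lintegral_congr fun y => ?_
          by_cases hy : y ∈ P <;> simp [hy]
      _ = _ := by rw [escale_add_rpow]; ring
  refine (ENNReal.tsum_le_tsum hterm).trans (le_of_eq ?_)
  rw [ENNReal.tsum_mul_left, ENNReal.tsum_geometric]
  ring

/-- Contribution of the cells of large density. -/
lemma tsum_setLIntegral_large_le (hL : 0 < L) {d s : ℝ} (hd : d < N) (hs : 1 < s)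
    (μ : Measure (Euc N)) [IsFiniteMeasure μ] {C : ℝ≥0∞} (hC : C ≠ ∞)
    (hfin : maxDensMeasure d s L μ univ ≠ ∞)
    (h : ∀ E, MeasurableSet E → cellEnergy d s L ((maxDensMeasure d s L μ).restrict E) ≤
      C * maxDensMeasure d s L μ E) (lam : ℝ≥0∞) (j : ℕ) (x : Euc N)
    (hlam : ∀ i ≤ j, cellDens d L μ i x ≤ lam) :
    ∑' i, ∫⁻ y in cell L j x, {y | lam < cellDens d L μ (j + i) y}.indicator
        (fun y => cellDens d L μ (j + i) y ^ s) y ≤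
      2 * ((1 - 2 ^ (-(N - d)))⁻¹ * (2 * C + 1) ^ (1 / s) * μ (cell L j x)) := by
  have hs0 : 0 < s := by linarith
  set W : ℝ≥0∞ := (1 - 2 ^ (-(N - d)))⁻¹ with hW
  have hWt : W ≠ ∞ := inv_one_sub_two_rpow_neg_ne_top (by linarith)
  have hW0 : W ≠ 0 := by
    rw [hW, ENNReal.inv_ne_zero]
    exact ne_top_of_le_ne_top ENNReal.one_ne_top tsub_le_self
  set ν := maxDensMeasure d s L μ with hν
  set P := cell L j x with hP
  have hPm : MeasurableSet P := measurableSet_cell _ _ _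
  set a := cellDens d L μ with ha
  have ham : ∀ i, Measurable (a i) := fun i => measurable_cellDens d L μ i
  have hac : ∀ i, CellConst L i (a i) := fun i => cellConst_cellDens d L μ i
  set F : ℕ → Set (Euc N) := fun i => {y | lam < a i y} with hF
  have hFm : ∀ i, MeasurableSet (F i) := fun i => measurableSet_lt measurable_const (ham i)
  set X := ∑' i, ∫⁻ y in P, (F (j + i)).indicator (fun y => a (j + i) y ^ s) y with hX
  set e : ℕ → Euc N → ℝ≥0∞ := fun k y => ∑' i, ∫⁻ z in cell L k y, a (k + i) z ^ s with he
  have hec : ∀ k, CellConst L k (e k) := fun k =>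
    (cellConst_cell L k).comp fun Q => ∑' i, ∫⁻ z in Q, a (k + i) z ^ s
  have heν : ∀ k y, e k y ≤ W * ν (cell L k y) := fun k y =>
    tsum_setLIntegral_le_maxDensMeasure hL hs μ k y
  have hXt : X ≠ ∞ := by
    refine ne_top_of_le_ne_top (b := e j x) ?_ ?_
    · exact ne_top_of_le_ne_top (ENNReal.mul_ne_top hWt
        (ne_top_of_le_ne_top hfin (measure_mono (subset_univ _)))) (heν j x)
    · exact ENNReal.tsum_le_tsum fun i => lintegral_mono fun y => indicator_le_self _ _ _
  set E := P ∩ ⋃ i, F (j + i) with hE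
  have hEm : MeasurableSet E := hPm.inter (MeasurableSet.iUnion fun i => hFm _)
  have hνE : ν E ≤ X := by
    rw [hν, maxDensMeasure_apply _ _ _ _ hEm, hX,
      ← lintegral_tsum fun i => (((ham _).pow_const s).indicator (hFm _)).aemeasurable]
    refine le_trans (setLIntegral_mono' hEm fun y hy => ?_) (lintegral_mono_set inter_subset_left)
    obtain ⟨i₀, hi₀⟩ := mem_iUnion.1 hy.2
    have key : ∀ i, a i y ^ s ≤
        ∑' i, (F (j + i)).indicator (fun y => a (j + i) y ^ s) y := by
      have hbig : ∀ i, y ∈ F (j + i) → a (j + i) y ^ s ≤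
          ∑' i, (F (j + i)).indicator (fun y => a (j + i) y ^ s) y := by
        intro i hi
        refine le_trans (le_of_eq ?_) (ENNReal.le_tsum i)
        rw [indicator_of_mem hi]
      intro i
      by_cases hi : lam < a i y
      · have hji : j ≤ i := by
          by_contra! hlt
          have h1 : a i y = a i x := hac i y x (cell_anti hlt.le x hy.1)
          exact absurd (h1 ▸ hi) (not_lt.2 (hlam i hlt.le))
        obtain ⟨k, rfl⟩ := Nat.exists_eq_add_of_le hji
        exact hbig k hi
      · exact (ENNReal.rpow_le_rpow ((not_lt.1 hi).trans (le_of_lt hi₀)) hs0.le).trans (hbig i₀ hi₀)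
    rw [← ENNReal.le_rpow_inv_iff hs0]
    refine iSup_le fun i => ?_
    rw [ENNReal.le_rpow_inv_iff hs0]
    exact key i
  set C' : ℝ≥0∞ := W * (2 * C + 1) ^ (1 / s) with hC'
  have hC't : C' ≠ ∞ := ENNReal.mul_ne_top hWt
    (ENNReal.rpow_ne_top_of_nonneg (by positivity) (by finiteness))
  have hC'0 : C' ≠ 0 := mul_ne_zero hW0 (ENNReal.rpow_pos (by simp) (by finiteness)).ne'
  set G : ℕ → Set (Euc N) := fun i => {y | e i y ≤ C' * μ (cell L i y)} with hG
  have hGm : ∀ i, MeasurableSet (G i) := fun i => measurableSet_le (hec i).measurable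
    (((cellConst_cell L i).comp fun Q => C' * μ Q).measurable)
  set φ : ℕ → Euc N → ℝ≥0∞ := fun i => (F i ∩ G i).indicator fun y => a i y ^ s with hφ
  have hφm : ∀ i, Measurable (φ i) := fun i =>
    ((ham i).pow_const s).indicator ((hFm i).inter (hGm i))
  have hgood : ∑' i, ∫⁻ y in P, φ (j + i) y ≤ C' * μ P := by
    refine tsum_lintegral_cell_le_of_packing (τ := C' • μ) hφm (fun k y => ?_) j x
    by_cases hk : y ∈ G k
    · right
      refine le_trans ?_ (show e k y ≤ C' * μ (cell L k y) from hk)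
      exact ENNReal.tsum_le_tsum fun i => lintegral_mono fun z => indicator_le_self _ _ _
    · left
      intro z hz
      refine indicator_of_notMem (fun hzG => hk ?_) _
      have h1 : e k z = e k y := hec k z y hz
      have h2 : cell L k z = cell L k y := cell_eq_of_mem hz
      have h3 : e k z ≤ C' * μ (cell L k z) := hzG.2
      rwa [h1, h2] at h3
  have hbad : ∑' i, ∫⁻ y in P, (F (j + i) \ G (j + i)).indicator (fun y => a (j + i) y ^ s) y ≤
      2⁻¹ * X := by
    have hpt : ∀ i, ∀ y ∈ P, (F (j + i) \ G (j + i)).indicator (fun y => a (j + i) y ^ s) y ≤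
        (2 * C + 1)⁻¹ * cellDens d L (ν.restrict E) (j + i) y ^ s := by
      intro i y hy
      by_cases hyF : y ∈ F (j + i) \ G (j + i)
      · rw [indicator_of_mem hyF]
        have hsub : cell L (j + i) y ⊆ E := by
          refine subset_inter (cell_subset_of_mem (Nat.le_add_right j i) hy) fun z hz => ?_
          refine mem_iUnion.2 ⟨i, ?_⟩
          have : a (j + i) z = a (j + i) y := hac _ z y hz
          change lam < a (j + i) z
          rw [this]
          exact hyF.1
        have h1 : C' * μ (cell L (j + i) y) ≤ W * ν (cell L (j + i) y) :=
          (not_le.1 hyF.2).le.trans (heν _ _)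
        have h2 : C' * a (j + i) y ≤ W * cellDens d L (ν.restrict E) (j + i) y := by
          simp only [ha, cellDens]
          rw [Measure.restrict_apply (measurableSet_cell _ _ _), inter_eq_left.2 hsub,
            ← mul_assoc, ← mul_assoc]
          exact mul_le_mul_left h1 _
        have h3 : (2 * C + 1) ^ (1 / s) * a (j + i) y ≤ cellDens d L (ν.restrict E) (j + i) y := by
          rw [hC', mul_assoc] at h2
          exact (ENNReal.mul_le_mul_iff_right hW0 hWt).1 h2
        have h4 := ENNReal.rpow_le_rpow h3 hs0.le
        rw [ENNReal.mul_rpow_of_nonneg _ _ hs0.le, ← ENNReal.rpow_mul, one_div_mul_cancel hs0.ne',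
          ENNReal.rpow_one] at h4
        rw [← ENNReal.div_eq_inv_mul]
        rw [ENNReal.le_div_iff_mul_le (Or.inl (by simp)) (Or.inl (by finiteness)), mul_comm]
        exact h4
      · rw [indicator_of_notMem hyF]; exact zero_le
    calc _ ≤ ∑' i, (2 * C + 1)⁻¹ * ∫⁻ y, cellDens d L (ν.restrict E) (j + i) y ^ s := by
          refine ENNReal.tsum_le_tsum fun i => ?_
          rw [← lintegral_const_mul _ ((measurable_cellDens _ _ _ _).pow_const s)]
          exact (setLIntegral_mono' hPm (hpt i)).trans (setLIntegral_le_lintegral _ _)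
      _ ≤ (2 * C + 1)⁻¹ * cellEnergy d s L (ν.restrict E) := by
          rw [ENNReal.tsum_mul_left]
          refine mul_le_mul_right ?_ _
          exact ENNReal.tsum_comp_le_tsum_of_injective (add_right_injective j)
            (fun k => ∫⁻ y, cellDens d L (ν.restrict E) k y ^ s)
      _ ≤ (2 * C + 1)⁻¹ * (C * X) :=
          mul_le_mul_right ((h E hEm).trans (mul_le_mul_right hνE _)) _
      _ ≤ _ := by
          rw [← mul_assoc]
          refine mul_le_mul_left ?_ _
          rw [← ENNReal.div_eq_inv_mul]
          refine ENNReal.div_le_of_le_mul ?_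
          calc C = 2⁻¹ * (2 * C) := by
                rw [← mul_assoc, ENNReal.inv_mul_cancel (by norm_num) (by norm_num), one_mul]
            _ ≤ _ := mul_le_mul_right le_self_add _
  have hsum : X ≤ C' * μ P + 2⁻¹ * X := by
    refine le_trans ?_ (add_le_add hgood hbad)
    rw [hX, ← ENNReal.tsum_add]
    refine ENNReal.tsum_le_tsum fun i => ?_
    rw [← lintegral_add_left (hφm _)]
    refine lintegral_mono fun y => ?_
    by_cases h1 : y ∈ F (j + i) <;> by_cases h2 : y ∈ G (j + i) <;> simp [hφ, h1, h2]
  have h5 : 2⁻¹ * X ≤ C' * μ P := by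
    have hh : 2⁻¹ * X + 2⁻¹ * X = X := by rw [← add_mul, ENNReal.inv_two_add_inv_two, one_mul]
    refine ENNReal.le_of_add_le_add_right (a := 2⁻¹ * X) (by finiteness) ?_
    rwa [hh]
  calc X = 2 * (2⁻¹ * X) := by
        rw [← mul_assoc, ENNReal.mul_inv_cancel (by norm_num) (by norm_num), one_mul]
    _ ≤ 2 * (C' * μ P) := mul_le_mul_right h5 _

/-- If the power of the dyadic maximal function satisfies the testing condition then so does the
measure itself. -/
theorem cellTesting_of_maxDensMeasure (hL : 0 < L) {d s : ℝ} (hd : d < N) (hs : 1 < s)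
    (μ : Measure (Euc N)) [IsFiniteMeasure μ] (hfin : maxDensMeasure d s L μ univ ≠ ∞)
    (h : CellTesting d s L (maxDensMeasure d s L μ)) : CellTesting d s L μ := by
  obtain ⟨C, hC, h⟩ := h
  have hs0 : 0 < s := by linarith
  set W : ℝ≥0∞ := (1 - 2 ^ (-(N - d)))⁻¹ with hW
  have hWt : W ≠ ∞ := inv_one_sub_two_rpow_neg_ne_top (by linarith)
  refine cellTesting_of_tsum_setLIntegral_le hs
    (C := W * C ^ (1 / s) + 2 * (W * (2 * C + 1) ^ (1 / s))) ?_ fun j x => ?_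
  · have : 0 ≤ 1 / s := by positivity
    finiteness
  obtain ⟨i₁, hi₁, hmax⟩ := Finset.exists_max_image (Finset.range (j + 1))
    (fun i => cellDens d L μ i x) ⟨0, by simp⟩
  set lam := cellDens d L μ i₁ x with hlam
  have h1 := tsum_setLIntegral_small_le hL (d := d) hs μ lam j x
  have h2 := tsum_setLIntegral_large_le hL hd hs μ hC hfin h lam j x
    fun i hi => hmax i (Finset.mem_range.2 (by lia))
  have h3 : lam ^ (s - 1) * escale L j ^ (N - d) ≤ C ^ (1 / s) := by
    refine le_trans (mul_le_mul_right (ENNReal.rpow_le_rpow ?_ (by linarith)) _)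
      (cellDens_rpow_mul_le hL hs hfin h i₁ x)
    have := Finset.mem_range.1 hi₁
    exact escale_anti hL (by lia)
  have hm : ∀ i, Measurable fun y => {y | cellDens d L μ (j + i) y ≤ lam}.indicator
      (fun y => cellDens d L μ (j + i) y ^ s) y := fun i =>
    ((measurable_cellDens d L μ (j + i)).pow_const s).indicator
      (measurableSet_le (measurable_cellDens d L μ (j + i)) measurable_const)
  calc _ ≤ _ := ENNReal.tsum_le_tsum fun i => lintegral_mono (f := fun y =>
        cellDens d L μ (j + i) y ^ s) (g := fun y =>
        {y | cellDens d L μ (j + i) y ≤ lam}.indicator (fun y => cellDens d L μ (j + i) y ^ s) y +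
        {y | lam < cellDens d L μ (j + i) y}.indicator
          (fun y => cellDens d L μ (j + i) y ^ s) y) fun y => by
          by_cases hy : cellDens d L μ (j + i) y ≤ lam
          · simp [hy]
          · simp [not_le.1 hy]
    _ = _ := by
        simp only [lintegral_add_left (hm _)]
        exact ENNReal.tsum_add
    _ ≤ _ := add_le_add h1 h2
    _ ≤ _ := by
        rw [add_mul, mul_assoc W (C ^ (1 / s)), mul_assoc 2, ← hW]
        exact add_le_add_left (mul_le_mul_right (mul_le_mul_left h3 _) _) _

/-- The relations between the exponents of the equivalence theorem. -/
structure WolffExponents (N : ℕ) (α β p q1 q2 e x1 y1 s σ : ℝ) : Prop where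
  one_lt_p : 1 < p
  e_eq : e = 1 / (p - 1)
  x1_eq : x1 = e * (N - α * p)
  y1_eq : y1 = e * (N - β * p)
  q1_pos : 0 < q1
  q2_pos : 0 < q2
  x1_pos : 0 < x1
  x1_lt_y1 : x1 < y1
  s_eq : s = e * (q1 + q2)
  one_lt_s : 1 < s
  σ_pos : 0 < σ
  σ_lt : σ < N
  sum_eq : q1 * x1 + q2 * y1 = (N - σ) * s
  q2_mul_lt : q2 * y1 < N * min 1 (e * q2)

namespace WolffExponents

variable {α β p q1 q2 e x1 y1 s σ : ℝ}

lemma e_pos (h : WolffExponents N α β p q1 q2 e x1 y1 s σ) : 0 < e := by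
  have := h.one_lt_p
  rw [h.e_eq]
  have : 0 < p - 1 := by linarith
  positivity

lemma s_pos (h : WolffExponents N α β p q1 q2 e x1 y1 s σ) : 0 < s :=
  zero_lt_one.trans h.one_lt_s

lemma y1_pos (h : WolffExponents N α β p q1 q2 e x1 y1 s σ) : 0 < y1 := h.x1_pos.trans h.x1_lt_y1

lemma N_pos (h : WolffExponents N α β p q1 q2 e x1 y1 s σ) : 0 < N := by
  have : (0 : ℝ) < N := h.σ_pos.trans h.σ_lt
  exact_mod_cast this

lemma mean_mul (h : WolffExponents N α β p q1 q2 e x1 y1 s σ) :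
    (α * q1 + β * q2) / (q1 + q2) * p = σ := by
  have := h.q1_pos
  have := h.q2_pos
  have he := h.e_pos
  have h1 := h.sum_eq
  rw [h.x1_eq, h.y1_eq, h.s_eq] at h1
  have h2 : e * (α * q1 * p + β * q2 * p - σ * (q1 + q2)) = 0 := by linarith
  have h3 := (mul_eq_zero.1 h2).resolve_left he.ne'
  field_simp
  linarith

/-- The testing condition controls the integrals of products of Wolff potentials. -/
theorem exists_lintegral_wolff_le (h : WolffExponents N α β p q1 q2 e x1 y1 s σ) (hL : 0 < L)
    {μ : Measure (Euc N)} [SFinite μ] (hT : CellTesting (N - σ) s L μ) :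
    ∃ C : ℝ≥0∞, C ≠ ∞ ∧ ∀ E, MeasurableSet E →
      ∫⁻ y, wolff α p (ENNReal.ofReal L) (μ.restrict E) y ^ q1 *
        wolff β p (ENNReal.ofReal L) (μ.restrict E) y ^ q2 ≤ C * μ E := by
  have hq1 := h.q1_pos
  have hq2 := h.q2_pos
  have := h.x1_pos
  have := h.y1_pos
  obtain ⟨C, hC, hW⟩ := exists_lintegral_tsum_ballTerm_le h.e_pos hq1 hq2 h.x1_lt_y1
    h.s_eq h.sum_eq h.q2_mul_lt
  obtain ⟨C', hC', hT⟩ := hT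
  refine ⟨(2 ^ x1) ^ q1 * (2 ^ y1) ^ q2 * (C * C'), by finiteness, fun E hE => ?_⟩
  set S := fun y => ∑' j, ballTerm e x1 L (μ.restrict E) j y
  set T := fun y => ∑' j, ballTerm e y1 L (μ.restrict E) j y
  calc _ ≤ ∫⁻ y, (2 ^ x1) ^ q1 * (2 ^ y1) ^ q2 * (S y ^ q1 * T y ^ q2) := by
        refine lintegral_mono fun y => ?_
        rw [mul_mul_mul_comm, ← ENNReal.mul_rpow_of_nonneg _ _ hq1.le,
          ← ENNReal.mul_rpow_of_nonneg _ _ hq2.le]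
        refine mul_le_mul' (ENNReal.rpow_le_rpow ?_ hq1.le) (ENNReal.rpow_le_rpow ?_ hq2.le)
        · have := wolff_le_tsum_ballTerm h.one_lt_p (by rw [← h.e_eq]; exact h.x1_eq) h.x1_pos hL
            (μ.restrict E) y
          rwa [← h.e_eq] at this
        · have := wolff_le_tsum_ballTerm h.one_lt_p (by rw [← h.e_eq]; exact h.y1_eq) h.y1_pos hL
            (μ.restrict E) y
          rwa [← h.e_eq] at this
    _ = (2 ^ x1) ^ q1 * (2 ^ y1) ^ q2 * ∫⁻ y, S y ^ q1 * T y ^ q2 :=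
        lintegral_const_mul' _ _ (by finiteness)
    _ ≤ _ := by
        rw [mul_assoc _ (C * C') (μ E)]
        refine mul_le_mul_right ((hW L hL _).trans ?_) _
        rw [mul_assoc]
        exact mul_le_mul_right (hT E hE) _

/-- Single-scale lower bound for the product of Wolff potentials. -/
lemma exists_measure_ball_rpow_le_wolff (h : WolffExponents N α β p q1 q2 e x1 y1 s σ) (m : ℕ) :
    ∃ C : ℝ≥0∞, C ≠ ∞ ∧ ∀ L : ℝ, 0 < L → ∀ (μ : Measure (Euc N)) (k : ℝ), k ≤ 2 ^ m →
      ∀ j x, (μ (ball x (k * dscale (dscale L (m + 1)) j)) *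
          escale (dscale L (m + 1)) j ^ (-((N : ℝ) - σ))) ^ s ≤
        C * wolff ((α * q1 + β * q2) / (q1 + q2)) p (ENNReal.ofReal L) μ x ^ (q1 + q2) := by
  have hs := h.s_pos
  have hd : 0 < (N : ℝ) - σ := by linarith [h.σ_lt]
  have he := h.e_pos
  have hq : 0 < q1 + q2 := add_pos h.q1_pos h.q2_pos
  set d := (N : ℝ) - σ with hd'
  refine ⟨((2 ^ d) ^ m) ^ s * (2 ^ (e * d + 1)) ^ (q1 + q2), by finiteness,
    fun L hL μ k hk j x => ?_⟩
  have h1 := ballTerm_le_wolff (α := (α * q1 + β * q2) / (q1 + q2)) (z := e * d) h.one_lt_p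
    (by rw [h.mean_mul, ← h.e_eq]) (by positivity) hL μ (Nat.le_add_left 1 j) x
  rw [← h.e_eq] at h1
  have h2 := ENNReal.rpow_le_rpow h1 hq.le
  rw [ENNReal.mul_rpow_of_nonneg _ _ hq.le] at h2
  rw [mul_assoc]
  refine le_trans ?_ (mul_le_mul_right h2 _)
  have h3 : ballTerm e (e * d) L μ (j + 1) x ^ (q1 + q2) =
      (μ (ball x (dscale L (j + 1))) * escale L (j + 1) ^ (-d)) ^ s := by
    rw [ballTerm, h.s_eq, ENNReal.rpow_mul, ENNReal.mul_rpow_of_nonneg _ _ he.le,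
      ← ENNReal.rpow_mul (escale L (j + 1))]
    congr 3; ring
  rw [h3, ← ENNReal.mul_rpow_of_nonneg _ _ hs.le]
  refine ENNReal.rpow_le_rpow ?_ hs.le
  rw [escale_dscale, show m + 1 + j = j + 1 + m by ring, escale_add_rpow, neg_neg]
  calc _ ≤ μ (ball x (dscale L (j + 1))) * (escale L (j + 1) ^ (-d) * (2 ^ d) ^ m) :=
        mul_le_mul_left (measure_mono (ball_subset_ball (mul_dscale_dscale_le hL hk j))) _
    _ = _ := by ring

lemma exists_iSup_cellDens_rpow_le_wolff (h : WolffExponents N α β p q1 q2 e x1 y1 s σ) {m : ℕ}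
    (hm : (N : ℝ) + 1 ≤ 2 ^ m) :
    ∃ C : ℝ≥0∞, C ≠ ∞ ∧ ∀ L : ℝ, 0 < L → ∀ (μ : Measure (Euc N)) x,
      (⨆ j, cellDens (N - σ) (dscale L (m + 1)) μ j x) ^ s ≤
        C * wolff ((α * q1 + β * q2) / (q1 + q2)) p (ENNReal.ofReal L) μ x ^ (q1 + q2) := by
  obtain ⟨C, hC, hw⟩ := h.exists_measure_ball_rpow_le_wolff m
  refine ⟨C, hC, fun L hL μ x => ?_⟩
  rw [← ENNReal.le_rpow_inv_iff h.s_pos]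
  refine iSup_le fun j => ?_
  rw [ENNReal.le_rpow_inv_iff h.s_pos]
  refine le_trans (ENNReal.rpow_le_rpow ?_ h.s_pos.le) (hw L hL μ _ hm j x)
  exact mul_le_mul_left (measure_mono (cell_subset_ball (dscale_pos hL _) j x)) _

end WolffExponents

/-- A point of the cell containing `x` depending only on that cell. -/
def cellPoint (L : ℝ) (j : ℕ) (x : Euc N) : Euc N :=
  Function.invFun (cellIndex L j) (cellIndex L j x)

lemma cellPoint_mem_cell (L : ℝ) (j : ℕ) (x : Euc N) : cellPoint L j x ∈ cell L j x :=
  Function.invFun_eq (f := cellIndex L j) ⟨x, rfl⟩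

lemma cellConst_cellPoint (L : ℝ) (j : ℕ) : CellConst L j (cellPoint (N := N) L j) :=
  fun x y h => by unfold cellPoint; rw [h]

lemma dist_cellPoint_le (hL : 0 < L) (j : ℕ) {x y : Euc N} (hy : y ∈ cell L j x) :
    dist y (cellPoint L j x) ≤ N * dscale L j := by
  refine dist_le_of_mem_cell hL ?_
  rwa [cell_eq_of_mem (cellPoint_mem_cell L j x)]

namespace WolffExponents

variable {α β p q1 q2 e x1 y1 s σ : ℝ}

/-- Testing on balls for the Wolff potential implies the testing condition. -/
theorem cellTesting_of_wolff_ball (h : WolffExponents N α β p q1 q2 e x1 y1 s σ) (hL : 0 < L)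
    {μ : Measure (Euc N)} [IsFiniteMeasure μ] {C : ℝ≥0∞} (hC : C ≠ ∞)
    (hw : ∀ x t, 0 < t → ∫⁻ y, wolff ((α * q1 + β * q2) / (q1 + q2)) p (ENNReal.ofReal L)
      (μ.restrict (ball x t)) y ^ (q1 + q2) ≤ C * μ (ball x t)) :
    CellTesting (N - σ) s L μ := by
  set d := (N : ℝ) - σ with hd
  have hN := h.N_pos
  have hs := h.s_pos
  obtain ⟨m, hm⟩ : ∃ m : ℕ, (N : ℝ) + 1 ≤ 2 ^ m := pow_unbounded_of_one_lt _ one_lt_two |>.imp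
    fun _ => le_of_lt
  obtain ⟨A, hA, hsup⟩ := h.exists_iSup_cellDens_rpow_le_wolff hm
  obtain ⟨B, hB, hnb⟩ := exists_lintegral_ball_le_cellDens N (5 * N) (d := d) hs
  set L' := dscale L (m + 1) with hL'
  have hL'0 : 0 < L' := dscale_pos hL _
  set W : ℝ≥0∞ := (1 - 2 ^ (-(N - d)))⁻¹ with hW
  have hWt : W ≠ ∞ := inv_one_sub_two_rpow_neg_ne_top (by rw [hd]; linarith [h.σ_pos])
  refine CellTesting.of_dscale hL h.one_lt_s (m := m + 1)
    ⟨B * (W * (A * C)) * carlesonConst s, ?_, fun E hE => ?_⟩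
  · have := carlesonConst_ne_top h.one_lt_s
    finiteness
  set H : ℕ → Euc N → ℝ≥0∞ := fun j x => μ (ball (cellPoint L' j x) (4 * N * dscale L' j)) with hH
  have key := cellEnergy_le_of_carleson (L := L') (d := d) h.one_lt_s (κ := μ.restrict E) (h := H)
    (C := B * (W * (A * C))) (fun j x => measure_ne_top _ _) (fun j x => ?_)
    (fun j => (cellConst_cellPoint L' j).comp fun z => μ (ball z (4 * N * dscale L' j)))
    fun j x => ?_
  · simpa using key
  · refine (Measure.restrict_apply_le _ _).trans (measure_mono fun y hy => ?_)
    have h1 := dist_cellPoint_le hL'0 j hy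
    have h2 := dscale_pos hL'0 j
    have h3 : (0 : ℝ) < N := by exact_mod_cast hN
    rw [mem_ball]
    nlinarith [mul_pos h3 h2]
  · have hpos := dscale_pos hL'0 j
    have hN' : (0 : ℝ) < N := by exact_mod_cast hN
    set Bh := ball (cellPoint L' j x) (4 * N * dscale L' j) with hBh
    have hpt : ∀ i, ∀ y ∈ cell L' j x, H (j + i) y ≤
        μ.restrict Bh (ball y ((5 * N : ℕ) * dscale L' (j + i))) := by
      intro i y hy
      have hpos' := dscale_pos hL'0 (j + i)
      rw [Measure.restrict_apply measurableSet_ball]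
      have hc := cellPoint_mem_cell L' (j + i) y
      refine measure_mono (subset_inter ?_ ?_)
      · refine ball_subset_ball' ?_
        have := dist_le_of_mem_cell hL'0 hc
        push_cast
        linarith
      · rcases Nat.eq_zero_or_pos i with rfl | hi
        · rw [hBh, ← cellConst_cellPoint L' j y x hy]
          rfl
        · refine ball_subset_ball' ?_
          have h1 := dist_cellPoint_le hL'0 j (cell_subset_of_mem (Nat.le_add_right j i) hy hc)
          have h2 : 2 * dscale L' (j + i) ≤ dscale L' j := by
            rw [dscale_succ L' j]
            have := dscale_anti hL'0 (show j + 1 ≤ j + i by lia)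
            linarith
          have h3 := mul_le_mul_of_nonneg_left h2 hN'.le
          nlinarith [mul_pos hN' hpos]
    calc _ ≤ ∑' i, escale L' (j + i) ^ (-(d * s)) *
          ∫⁻ y, μ.restrict Bh (ball y ((5 * N : ℕ) * dscale L' (j + i))) ^ s := by
          refine ENNReal.tsum_le_tsum fun i => ?_
          rw [← lintegral_const_mul' _ _ (escale_rpow_ne_top hL'0 _ _)]
          refine (setLIntegral_mono' (measurableSet_cell _ _ _) fun y hy => ?_).trans
            (setLIntegral_le_lintegral _ _)
          rw [ENNReal.mul_rpow_of_nonneg _ _ hs.le, ← ENNReal.rpow_mul, mul_comm, neg_mul]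
          exact mul_le_mul_right (ENNReal.rpow_le_rpow (hpt i y hy) hs.le) _
      _ ≤ ∑' i, B * ∫⁻ y, cellDens d L' (μ.restrict Bh) (j + i) y ^ s :=
          ENNReal.tsum_le_tsum fun i => hnb L' hL'0 _ _
      _ ≤ B * cellEnergy d s L' (μ.restrict Bh) := by
          rw [ENNReal.tsum_mul_left]
          exact mul_le_mul_right (ENNReal.tsum_comp_le_tsum_of_injective (add_right_injective j)
            (fun k => ∫⁻ y, cellDens d L' (μ.restrict Bh) k y ^ s)) _
      _ ≤ B * (W * (A * (C * μ Bh))) := by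
          refine mul_le_mul_right ((cellEnergy_le_lintegral_iSup hL'0 h.one_lt_s _).trans
            (mul_le_mul_right ?_ _)) _
          refine (lintegral_mono fun y => hsup L hL _ y).trans ?_
          rw [lintegral_const_mul' _ _ hA]
          exact mul_le_mul_right (hw _ _ (by positivity)) _
      _ = _ := by rw [← mul_assoc A, ← mul_assoc W, ← mul_assoc B]

end WolffExponents

/-- Balls have finite Bessel capacity. -/
lemma besselCap_closedBall_ne_top {σ s' : ℝ} (hσ : 0 < σ) (hσN : σ < N) (hs' : 0 < s')
    (x₀ : Euc N) {r : ℝ} (hr : 0 < r) : besselCap N σ s' (closedBall x₀ r) ≠ ∞ := by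
  have hN : 0 < N := by exact_mod_cast hσ.trans hσN
  have : Nonempty (Fin N) := ⟨⟨0, hN⟩⟩
  obtain ⟨c, hc, hker⟩ := exists_le_besselKernel hσ hσN (2 * r)
  set k := c * (2 * r) ^ (-((N : ℝ) - σ)) with hk
  have hk0 : 0 < k := by positivity
  set B := ball x₀ r with hB
  have hB0 : volume B ≠ 0 := (measure_ball_pos volume x₀ hr).ne'
  have hBt : volume B ≠ ∞ := measure_ball_lt_top.ne
  set M := (ENNReal.ofReal k * volume B)⁻¹ with hM
  have hkB : ENNReal.ofReal k * volume B ≠ 0 := mul_ne_zero (by simpa using hk0) hB0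
  have hMt : M ≠ ∞ := by simpa [hM] using hkB
  have htest : besselCap N σ s' (closedBall x₀ r) ≤
      ∫⁻ y, (B.indicator (fun _ => M) y) ^ s' := by
    refine iInf_le_of_le _ (iInf_le_of_le (measurable_const.indicator measurableSet_ball)
      (iInf_le _ fun x hx => ?_))
    calc (1 : ℝ≥0∞) = ∫⁻ y, B.indicator (fun _ => ENNReal.ofReal k * M) y := by
          rw [lintegral_indicator_const measurableSet_ball, mul_right_comm,
            ENNReal.mul_inv_cancel hkB (by finiteness)]
      _ ≤ _ := by
          refine lintegral_mono_ae ?_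
          filter_upwards [ae_ne_of_pos hN x] with y hy
          by_cases hyB : y ∈ B
          · rw [indicator_of_mem hyB, indicator_of_mem hyB]
            refine mul_le_mul_left (ENNReal.ofReal_le_ofReal ?_) _
            have hxy : ‖x - y‖ ≤ 2 * r := by
              rw [← dist_eq_norm]
              have h1 := mem_closedBall.1 hx
              have h2 := mem_ball'.1 hyB
              linarith [dist_triangle x x₀ y]
            refine le_trans ?_ (hker (x - y) (sub_ne_zero.2 hy) hxy)
            refine mul_le_mul_of_nonneg_left ?_ hc.le
            exact Real.rpow_le_rpow_of_nonpos (norm_pos_iff.2 (sub_ne_zero.2 hy)) hxy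
              (by linarith)
          · rw [indicator_of_notMem hyB]
            exact zero_le
  refine ne_top_of_le_ne_top ?_ htest
  have : ∀ y, (B.indicator (fun _ => M) y) ^ s' = B.indicator (fun _ => M ^ s') y := fun y => by
    by_cases hyB : y ∈ B
    · rw [indicator_of_mem hyB, indicator_of_mem hyB]
    · rw [indicator_of_notMem hyB, indicator_of_notMem hyB, ENNReal.zero_rpow_of_pos hs']
  simp only [this]
  rw [lintegral_indicator_const measurableSet_ball]
  have := ENNReal.rpow_ne_top_of_nonneg hs'.le hMt
  finiteness

lemma wolff_eq_zero {α p : ℝ} (hp : 1 < p) {μ : Measure (Euc N)} {x : Euc N}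
    (h : μ (ball x L) = 0) : wolff α p (ENNReal.ofReal L) μ x = 0 := by
  have he : 0 < 1 / (p - 1) := by
    have : 0 < p - 1 := by linarith
    positivity
  rw [wolff_ofReal_eq hp, setLIntegral_congr_fun (g := fun _ => 0) measurableSet_Ioo fun ρ hρ => ?_]
  · simp
  · simp only
    rw [measure_mono_null (ball_subset_ball hρ.2.le) h, ENNReal.zero_rpow_of_pos he, zero_mul]

/-- The product of the Wolff potentials of orders `α` and `β`, raised to the powers `q1`, `q2`. -/
def wolffMul (α β p q1 q2 L : ℝ) (μ : Measure (Euc N)) (x : Euc N) : ℝ≥0∞ :=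
  wolff α p (ENNReal.ofReal L) μ x ^ q1 * wolff β p (ENNReal.ofReal L) μ x ^ q2

lemma wolffMul_eq_zero {α β p q1 q2 : ℝ} (hp : 1 < p) (hq1 : 0 < q1) {μ : Measure (Euc N)}
    {x₀ : Euc N} {r : ℝ} (hμ : μ (ball x₀ r)ᶜ = 0) {x : Euc N} (hx : x ∉ ball x₀ (r + L)) :
    wolffMul α β p q1 q2 L μ x = 0 := by
  rw [wolffMul, wolff_eq_zero hp (measure_mono_null (fun y hy => ?_) hμ),
    ENNReal.zero_rpow_of_pos hq1, zero_mul]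
  rw [mem_compl_iff, mem_ball]
  rw [mem_ball] at hx hy
  rw [dist_comm] at hy
  linarith [dist_triangle x y x₀]

lemma measurable_wolffMul {α β p q1 q2 : ℝ} (hp : 1 < p) (μ : Measure (Euc N)) [SFinite μ] :
    Measurable (wolffMul α β p q1 q2 L μ) :=
  ((measurable_wolff hp μ).pow_const _).mul ((measurable_wolff hp μ).pow_const _)

namespace WolffExponents

variable {α β p q1 q2 e x1 y1 s σ : ℝ}

/-- A capacitary bound for the product of the Wolff potentials implies the testing condition. -/
theorem cellTesting_of_setLIntegral_wolffMul_le (h : WolffExponents N α β p q1 q2 e x1 y1 s σ)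
    (hL : 0 < L) {μ : Measure (Euc N)} [IsFiniteMeasure μ] {x₀ : Euc N} {r : ℝ} (hr : 0 < r)
    (hμ : μ (ball x₀ r)ᶜ = 0) {C : ℝ≥0∞} (hC : C ≠ ∞)
    (hcap : ∀ K, IsCompact K →
      ∫⁻ x in K, wolffMul α β p q1 q2 L μ x ≤ C * besselCap N σ (s / (s - 1)) K) :
    CellTesting (N - σ) s L μ := by
  have hs := h.one_lt_s
  have hs' : 0 < s / (s - 1) := div_pos h.s_pos (by linarith)
  obtain ⟨m, hm⟩ : ∃ m : ℕ, (N : ℝ) + 1 ≤ 2 ^ m := pow_unbounded_of_one_lt _ one_lt_two |>.imp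
    fun _ => le_of_lt
  obtain ⟨A, hA, hsup⟩ := h.exists_iSup_cellDens_rpow_le_wolff hm
  have hpt : ∀ x, (⨆ j, cellDens (N - σ) (dscale L (m + 1)) μ j x) ^ s ≤
      A * wolffMul α β p q1 q2 L μ x := fun x =>
    (hsup L hL μ x).trans (mul_le_mul_right (wolff_rpow_le_mul h.one_lt_p h.q1_pos h.q2_pos μ x) _)
  set ν := maxDensMeasure (N - σ) s (dscale L (m + 1)) μ with hν
  have hνK : ∀ K, IsCompact K → ν K ≤ A * C * besselCap N σ (s / (s - 1)) K := by
    intro K hK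
    rw [hν, maxDensMeasure_apply _ _ _ _ hK.measurableSet, mul_assoc]
    refine (lintegral_mono hpt).trans ?_
    rw [lintegral_const_mul' _ _ hA]
    exact mul_le_mul_right (hcap K hK) _
  have hout : ν (closedBall x₀ (r + L))ᶜ = 0 := by
    rw [hν, maxDensMeasure_apply _ _ _ _ measurableSet_closedBall.compl,
      setLIntegral_congr_fun (g := fun _ => 0) measurableSet_closedBall.compl fun x hx => ?_]
    · simp
    · have := hpt x
      rw [wolffMul_eq_zero h.one_lt_p h.q1_pos hμ fun hx' => hx (ball_subset_closedBall hx'),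
        mul_zero] at this
      exact le_antisymm this zero_le
  have hfin : ν univ ≠ ∞ := by
    rw [← measure_add_measure_compl (s := closedBall x₀ (r + L)) measurableSet_closedBall, hout,
      add_zero]
    refine ne_top_of_le_ne_top ?_ (hνK _ (isCompact_closedBall _ _))
    have := besselCap_closedBall_ne_top h.σ_pos h.σ_lt hs' x₀ (add_pos hr hL)
    finiteness
  have : IsFiniteMeasure ν := ⟨hfin.lt_top⟩
  have hL' := dscale_pos hL (m + 1)
  refine CellTesting.of_dscale hL hs (m := m + 1) ?_
  exact cellTesting_of_maxDensMeasure hL' (by linarith [h.σ_pos]) hs μ hfin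
    (cellTesting_of_le_besselCap h.σ_pos h.σ_lt hs hL' (by finiteness) hνK)

end WolffExponents

/-- Averages over a ball of powers of the small-scale part of the discretized Wolff potential. -/
lemma exists_setLIntegral_tsum_ballTerm_rpow_le {e z q : ℝ} (he : 0 < e) (hq : 0 < q)
    (hz : q * z < N * min 1 (e * q)) :
    ∃ C : ℝ≥0∞, C ≠ ∞ ∧ ∀ L : ℝ, 0 < L → ∀ (μ : Measure (Euc N)) [SFinite μ] (i : ℕ) (x : Euc N),
      ∫⁻ y in ball x (dscale L i), (∑' k, ballTerm e z L μ (i + k) y) ^ q ≤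
        C * (escale L i ^ (N : ℝ) *
          (μ (ball x (2 * dscale L i)) ^ e * escale L i ^ (-z)) ^ q) := by
  set ε := (N * min 1 (e * q) - q * z) / 2 with hε
  have hε0 : 0 < ε := by rw [hε]; linarith
  obtain ⟨C, hC, hsum⟩ := exists_tsum_rpow_le hq hε0
  have hV := volume_unit_ball_ne_top N
  have hW : (1 - (2 : ℝ≥0∞) ^ (-ε))⁻¹ ≠ ∞ := inv_one_sub_two_rpow_neg_ne_top hε0
  refine ⟨C * (volume (ball (0 : Euc N) 1) * (1 - 2 ^ (-ε))⁻¹), by finiteness,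
    fun L hL μ _ i x => ?_⟩
  set m := μ (ball x (2 * dscale L i)) with hm
  have hmeas : ∀ k, Measurable fun y => ((2 : ℝ≥0∞) ^ ε) ^ k * ballTerm e z L μ (i + k) y ^ q :=
    fun k => ((measurable_ballTerm e z L μ _).pow_const q).const_mul _
  have hterm : ∀ k, ∫⁻ y in ball x (dscale L i),
      ((2 : ℝ≥0∞) ^ ε) ^ k * ballTerm e z L μ (i + k) y ^ q ≤
      (volume (ball (0 : Euc N) 1) *
        (escale L i ^ (N : ℝ) * (m ^ e * escale L i ^ (-z)) ^ q)) * (2 ^ (-ε)) ^ k := by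
    intro k
    have hpt : ∀ y, ((2 : ℝ≥0∞) ^ ε) ^ k * ballTerm e z L μ (i + k) y ^ q =
        (((2 : ℝ≥0∞) ^ ε) ^ k * escale L (i + k) ^ (-z * q)) *
          μ (ball y (dscale L (i + k))) ^ (e * q) := fun y => by
      rw [ballTerm, ENNReal.mul_rpow_of_nonneg _ _ hq.le, ← ENNReal.rpow_mul, ← ENNReal.rpow_mul]
      ring
    have ht := escale_rpow_ne_top hL (i + k) (-z * q)
    simp only [hpt]
    rw [lintegral_const_mul' _ _ (by finiteness)]
    refine (mul_le_mul_right (setLIntegral_ball_rpow_le hL μ (mul_pos he hq) i k x) _).trans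
      (le_of_eq ?_)
    rw [escale_add_rpow, ENNReal.mul_rpow_of_nonneg _ _ hq.le, ← ENNReal.rpow_mul,
      ← ENNReal.rpow_mul, ← hm]
    have h2 : ((2 : ℝ≥0∞) ^ (-ε)) ^ k = ((2 : ℝ≥0∞) ^ ε) ^ k * (2 ^ (-(-z * q))) ^ k *
        (2 ^ (-(N * min 1 (e * q)))) ^ k := by
      rw [← mul_pow, ← mul_pow, ← ENNReal.rpow_add _ _ (by simp) (by simp),
        ← ENNReal.rpow_add _ _ (by simp) (by simp)]
      congr 2
      rw [hε]; ring
    rw [h2]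
    ring
  calc _ ≤ ∫⁻ y in ball x (dscale L i),
        C * ∑' k, ((2 : ℝ≥0∞) ^ ε) ^ k * ballTerm e z L μ (i + k) y ^ q :=
        lintegral_mono fun y => hsum _
    _ = C * ∑' k, ∫⁻ y in ball x (dscale L i),
          ((2 : ℝ≥0∞) ^ ε) ^ k * ballTerm e z L μ (i + k) y ^ q := by
        rw [lintegral_const_mul' _ _ hC, lintegral_tsum fun k => (hmeas k).aemeasurable]
    _ ≤ C * ∑' k, (volume (ball (0 : Euc N) 1) *
        (escale L i ^ (N : ℝ) * (m ^ e * escale L i ^ (-z)) ^ q)) * (2 ^ (-ε)) ^ k :=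
        mul_le_mul_right (ENNReal.tsum_le_tsum hterm) _
    _ = _ := by
        rw [ENNReal.tsum_mul_left, ENNReal.tsum_geometric]
        ring

/-- The Wolff potential is bounded away from the support of the measure. -/
lemma wolff_le_of_measure_ball_eq_zero {α p z : ℝ} (hp : 1 < p)
    (hz : z = 1 / (p - 1) * ((N : ℝ) - α * p)) (hz0 : 0 < z) {μ : Measure (Euc N)}
    {x : Euc N} {δ : ℝ} (hδ : 0 < δ) (h : μ (ball x δ) = 0) :
    wolff α p (ENNReal.ofReal L) μ x ≤
      μ univ ^ (1 / (p - 1)) * ENNReal.ofReal (δ ^ (-z - 1)) * ENNReal.ofReal L := by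
  have he : 0 < 1 / (p - 1) := by
    have : 0 < p - 1 := by linarith
    positivity
  rw [wolff_ofReal_eq hp, ← hz]
  have hvol : volume (Ioo 0 L) = ENNReal.ofReal L := by rw [Real.volume_Ioo, sub_zero]
  rw [← hvol, ← setLIntegral_const]
  refine setLIntegral_mono' measurableSet_Ioo fun ρ hρ => ?_
  rcases le_or_gt ρ δ with hρδ | hρδ
  · rw [measure_mono_null (ball_subset_ball hρδ) h, ENNReal.zero_rpow_of_pos he, zero_mul]
    exact zero_le
  · refine mul_le_mul' (ENNReal.rpow_le_rpow (measure_mono (subset_univ _)) he.le)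
      (ENNReal.ofReal_le_ofReal ?_)
    exact Real.rpow_le_rpow_of_nonpos hδ hρδ.le (by linarith)

namespace WolffExponents

variable {α β p q1 q2 e x1 y1 s σ : ℝ}

lemma ae_restrict_wolff_lt_top (h : WolffExponents N α β p q1 q2 e x1 y1 s σ) (hL : 0 < L)
    (μ : Measure (Euc N)) [IsFiniteMeasure μ] (x₀ : Euc N) :
    ∀ᵐ x ∂volume.restrict (ball x₀ L), wolff β p (ENNReal.ofReal L) μ x < ∞ := by
  have hq2 := h.q2_pos
  obtain ⟨C, hC, hav⟩ := exists_setLIntegral_tsum_ballTerm_rpow_le h.e_pos hq2 h.q2_mul_lt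
  have h1 := hav L hL μ 0 x₀
  rw [dscale_zero] at h1
  simp only [zero_add] at h1
  have hm : Measurable fun y => (∑' k, ballTerm e y1 L μ k y) ^ q2 :=
    (Measurable.tsum fun k => measurable_ballTerm e y1 L μ k).pow_const _
  have hfin : ∫⁻ y in ball x₀ L, (∑' k, ballTerm e y1 L μ k y) ^ q2 ≠ ∞ := by
    refine ne_top_of_le_ne_top ?_ h1
    have := escale_rpow_ne_top hL 0 (N : ℝ)
    have := escale_rpow_ne_top hL 0 (-y1)
    have := h.e_pos.le
    have := hq2.le
    finiteness
  filter_upwards [ae_lt_top hm hfin] with y hy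
  rw [ENNReal.rpow_lt_top_iff_of_pos hq2] at hy
  have := wolff_le_tsum_ballTerm h.one_lt_p (by rw [← h.e_eq]; exact h.y1_eq) h.y1_pos hL μ y
  rw [← h.e_eq] at this
  refine this.trans_lt ?_
  have := h.y1_pos.le
  exact ENNReal.mul_lt_top (by finiteness) hy

/-- The product of the Wolff potentials is bounded away from the support of the measure. -/
lemma exists_wolffMul_le (h : WolffExponents N α β p q1 q2 e x1 y1 s σ) {μ : Measure (Euc N)}
    [IsFiniteMeasure μ] {δ : ℝ} (hδ : 0 < δ) :
    ∃ M : ℝ≥0∞, M ≠ ∞ ∧ ∀ x, μ (ball x δ) = 0 → wolffMul α β p q1 q2 L μ x ≤ M := by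
  have hq1 := h.q1_pos.le
  have hq2 := h.q2_pos.le
  have he := h.e_pos.le
  refine ⟨(μ univ ^ (1 / (p - 1)) * ENNReal.ofReal (δ ^ (-x1 - 1)) * ENNReal.ofReal L) ^ q1 *
    (μ univ ^ (1 / (p - 1)) * ENNReal.ofReal (δ ^ (-y1 - 1)) * ENNReal.ofReal L) ^ q2, ?_,
    fun x hx => ?_⟩
  · rw [← h.e_eq]
    finiteness
  · exact mul_le_mul'
      (ENNReal.rpow_le_rpow (wolff_le_of_measure_ball_eq_zero h.one_lt_p
        (by rw [← h.e_eq]; exact h.x1_eq) h.x1_pos hδ hx) hq1)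
      (ENNReal.rpow_le_rpow (wolff_le_of_measure_ball_eq_zero h.one_lt_p
        (by rw [← h.e_eq]; exact h.y1_eq) h.y1_pos hδ hx) hq2)

/-- A supersolution-type bound forces the product of the Wolff potentials to be integrable. -/
lemma lintegral_wolffMul_ne_top (h : WolffExponents N α β p q1 q2 e x1 y1 s σ) {R : ℝ}
    (hR : 0 < R) {μ : Measure (Euc N)} [IsFiniteMeasure μ] {x₀ : Euc N}
    (hμ : μ (ball x₀ R)ᶜ = 0) {C : ℝ≥0∞} (hC : C ≠ ∞)
    (hsol : ∀ᵐ x ∂volume.restrict (ball x₀ (2 * R)), wolff β p (ENNReal.ofReal (4 * R))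
      (volume.withDensity (wolffMul α β p q1 q2 (4 * R) μ)) x ≤
        C * wolff β p (ENNReal.ofReal (4 * R)) μ x) :
    ∫⁻ x, wolffMul α β p q1 q2 (4 * R) μ x ≠ ∞ := by
  have hL : 0 < 4 * R := by linarith
  set f := wolffMul α β p q1 q2 (4 * R) μ with hf
  obtain ⟨M, hM, hbd⟩ := h.exists_wolffMul_le (L := 4 * R) (μ := μ) (half_pos hR)
  obtain ⟨x, hx, hxs, hxt⟩ : ∃ x ∈ ball x₀ (R / 4),
      wolff β p (ENNReal.ofReal (4 * R)) (volume.withDensity f) x ≤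
        C * wolff β p (ENNReal.ofReal (4 * R)) μ x ∧
      wolff β p (ENNReal.ofReal (4 * R)) μ x < ∞ := by
    have : (ae (volume.restrict (ball x₀ (R / 4)))).NeBot :=
      ae_restrict_neBot.2 (measure_ball_pos volume x₀ (by linarith)).ne'
    have h1 := ae_restrict_of_ae_restrict_of_subset
      (ball_subset_ball (x := x₀) (show R / 4 ≤ 2 * R by linarith)) hsol
    have h2 := ae_restrict_of_ae_restrict_of_subset
      (ball_subset_ball (x := x₀) (show R / 4 ≤ 4 * R by linarith))
      (h.ae_restrict_wolff_lt_top hL μ x₀)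
    obtain ⟨x, hx⟩ := ((ae_restrict_mem measurableSet_ball).and (h1.and h2)).exists
    exact ⟨x, hx⟩
  have hball : ∫⁻ y in ball x₀ (3 * R / 2), f y ≠ ∞ := by
    have h1 := ballTerm_le_wolff h.one_lt_p (by rw [← h.e_eq]; exact h.y1_eq) h.y1_pos hL
      (volume.withDensity f) le_rfl x
    have hy := h.y1_pos.le
    have h2 : ballTerm (1 / (p - 1)) y1 (4 * R) (volume.withDensity f) 1 x ≠ ∞ :=
      ne_top_of_le_ne_top (by finiteness) (h1.trans (mul_le_mul_right hxs _))
    rw [ballTerm, ← h.e_eq] at h2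
    have h3 : (volume.withDensity f) (ball x (dscale (4 * R) 1)) ≠ ∞ := by
      intro h4
      rw [h4, ENNReal.top_rpow_of_pos h.e_pos,
        ENNReal.top_mul (escale_rpow_ne_zero hL 1 _)] at h2
      exact h2 rfl
    rw [withDensity_apply _ measurableSet_ball] at h3
    refine ne_top_of_le_ne_top h3 (lintegral_mono_set (ball_subset_ball' ?_))
    have h5 : dscale (4 * R) 1 = 2 * R := by rw [dscale]; ring
    rw [h5]
    have := mem_ball'.1 hx
    linarith
  rw [← lintegral_add_compl f (measurableSet_ball (x := x₀) (ε := 3 * R / 2))]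
  refine ENNReal.add_ne_top.2 ⟨hball, ?_⟩
  refine ne_top_of_le_ne_top (b := ∫⁻ y, (ball x₀ (5 * R)).indicator (fun _ => M) y) ?_ ?_
  · rw [lintegral_indicator_const measurableSet_ball]
    have : volume (ball x₀ (5 * R)) ≠ ∞ := measure_ball_lt_top.ne
    finiteness
  · refine (setLIntegral_mono' measurableSet_ball.compl fun y hy => ?_).trans
      (setLIntegral_le_lintegral _ _)
    by_cases hy5 : y ∈ ball x₀ (5 * R)
    · rw [indicator_of_mem hy5]
      refine hbd y (measure_mono_null (fun w hw => ?_) hμ)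
      rw [mem_compl_iff, mem_ball] at hy ⊢
      rw [mem_ball'] at hw
      linarith [dist_triangle y w x₀]
    · rw [hf, wolffMul_eq_zero h.one_lt_p h.q1_pos hμ (by rwa [show R + 4 * R = 5 * R by ring])]
      exact zero_le

end WolffExponents

lemma cellDens_add (d : ℝ) (μ ν : Measure (Euc N)) (j : ℕ) (x : Euc N) :
    cellDens d L (μ + ν) j x = cellDens d L μ j x + cellDens d L ν j x := by
  simp only [cellDens, Measure.add_apply, add_mul]

lemma cellDens_volume (hL : 0 < L) (d : ℝ) (j : ℕ) (x : Euc N) :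
    cellDens d L volume j x = escale L j ^ ((N : ℝ) - d) := by
  rw [cellDens, volume_cell hL, ← escale_rpow_add hL, sub_eq_add_neg]

namespace WolffExponents

variable {α β p q1 q2 e x1 y1 s σ : ℝ}

/-- A pair of pointwise bounds for iterated Wolff potentials implies the testing condition for
the measure whose density is the product of the Wolff potentials. -/
lemma cellTesting_withDensity_wolffMul (h : WolffExponents N α β p q1 q2 e x1 y1 s σ) {R : ℝ}
    (hR : 0 < R) {μ : Measure (Euc N)} [IsFiniteMeasure μ] {x₀ : Euc N}
    (hμ : μ (ball x₀ R)ᶜ = 0) {C : ℝ≥0∞} (hC : C ≠ ∞)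
    (hfin : ∫⁻ x, wolffMul α β p q1 q2 (4 * R) μ x ≠ ∞)
    (hsol : ∀ᵐ x ∂volume.restrict (ball x₀ (2 * R)),
      wolffMul α β p q1 q2 (4 * R) (volume.withDensity (wolffMul α β p q1 q2 (4 * R) μ)) x ≤
        C * wolffMul α β p q1 q2 (4 * R) μ x) :
    ∃ L > 0, CellTesting (N - σ) s L (volume.withDensity (wolffMul α β p q1 q2 (4 * R) μ)) := by
  have hL : 0 < 4 * R := by linarith
  have hs := h.s_pos
  have hσ := h.σ_pos
  set f := wolffMul α β p q1 q2 (4 * R) μ with hf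
  have hfm : Measurable f := measurable_wolffMul h.one_lt_p μ
  set ν := volume.withDensity f with hν
  obtain ⟨M, hM, hbd⟩ := h.exists_wolffMul_le (L := 4 * R) (μ := μ) (half_pos hR)
  obtain ⟨m, hm⟩ : ∃ m : ℕ, 4 * ((N : ℝ) + 1) ≤ 2 ^ m :=
    pow_unbounded_of_one_lt _ one_lt_two |>.imp fun _ => le_of_lt
  have hN0 : (0 : ℝ) ≤ N := N.cast_nonneg
  obtain ⟨A, hA, hsup⟩ := h.exists_iSup_cellDens_rpow_le_wolff (m := m) (by linarith)
  set L' := dscale (4 * R) (m + 1) with hL'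
  have hL'0 : 0 < L' := dscale_pos hL _
  set d := (N : ℝ) - σ with hd
  set D := escale L' 0 ^ σ with hD
  have hDt : D ≠ ∞ := escale_rpow_ne_top hL'0 _ _
  have hvol : ∀ j x, cellDens d L' volume j x ≤ D := fun j x => by
    rw [cellDens_volume hL'0, hd, sub_sub_cancel]
    exact ENNReal.rpow_le_rpow (escale_anti hL'0 (Nat.zero_le j)) hσ.le
  set κ := ν + volume with hκ
  have hκcell : ∀ j x, κ (cell L' j x) ≠ ∞ := fun j x => by
    rw [hκ, Measure.add_apply, volume_cell hL'0]
    refine ENNReal.add_ne_top.2 ⟨ne_top_of_le_ne_top hfin ?_, escale_rpow_ne_top hL'0 _ _⟩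
    rw [hν, withDensity_apply _ (measurableSet_cell _ _ _)]
    exact setLIntegral_le_lintegral _ _
  set B := 2 ^ s * A * C + (2 ^ s * D ^ s + ((M + 1) * D) ^ s) with hB
  have hBt : B ≠ ∞ := by
    have := hs.le
    finiteness
  have hpt : ∀ᵐ x, (⨆ j, cellDens d L' κ j x) ^ s ≤ B * (f x + 1) := by
    have hin := (ae_restrict_iff' measurableSet_ball).1 hsol
    filter_upwards [hin] with x hx
    by_cases hxB : x ∈ ball x₀ (2 * R)
    · have h1 : (⨆ j, cellDens d L' κ j x) ≤ 2 * max (⨆ j, cellDens d L' ν j x) D := by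
        refine iSup_le fun j => ?_
        rw [hκ, cellDens_add, two_mul]
        exact add_le_add ((le_iSup (fun j => cellDens d L' ν j x) j).trans (le_max_left _ _))
          ((hvol j x).trans (le_max_right _ _))
      have h2 : (⨆ j, cellDens d L' ν j x) ^ s ≤ A * (C * f x) :=
        (hsup _ hL ν x).trans (mul_le_mul_right
          ((wolff_rpow_le_mul h.one_lt_p h.q1_pos h.q2_pos ν x).trans (hx hxB)) _)
      have h3 : max (⨆ j, cellDens d L' ν j x) D ^ s ≤ A * (C * f x) + D ^ s := by
        rcases max_cases (⨆ j, cellDens d L' ν j x) D with ⟨hmax, -⟩ | ⟨hmax, -⟩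
        · rw [hmax]; exact h2.trans le_self_add
        · rw [hmax]; exact le_add_self
      calc _ ≤ (2 * max (⨆ j, cellDens d L' ν j x) D) ^ s := ENNReal.rpow_le_rpow h1 hs.le
        _ ≤ 2 ^ s * (A * (C * f x) + D ^ s) := by
            rw [ENNReal.mul_rpow_of_nonneg _ _ hs.le]
            exact mul_le_mul_right h3 _
        _ = 2 ^ s * A * C * f x + 2 ^ s * D ^ s * 1 := by ring
        _ ≤ B * f x + B * 1 := by
            refine add_le_add (mul_le_mul_left le_self_add _) (mul_le_mul_left ?_ _)
            rw [hB]
            exact le_self_add.trans le_add_self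
        _ = B * (f x + 1) := by ring
    · have h1 : (⨆ j, cellDens d L' κ j x) ≤ (M + 1) * D := by
        refine iSup_le fun j => ?_
        have hsub : ∀ y ∈ cell L' j x, f y ≤ M := fun y hy => by
          refine hbd y (measure_mono_null (fun w hw => ?_) hμ)
          have h2 := mem_ball.1 (cell_subset_ball hL'0 j x hy)
          have h3 := mul_dscale_dscale_le hL hm j
          have h4 : dscale (4 * R) (j + 1) ≤ 2 * R := by
            refine (dscale_anti hL (Nat.le_add_left 1 j)).trans (le_of_eq ?_)
            rw [dscale]; ring
          rw [mem_compl_iff, mem_ball]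
          rw [mem_ball] at hxB
          rw [mem_ball'] at hw
          rw [dist_comm] at h2
          have h5 := dist_triangle x y x₀
          have h6 := dist_triangle y w x₀
          rw [← hL'] at h3
          linarith
        have hνc : cellDens d L' ν j x ≤ M * cellDens d L' volume j x := by
          rw [cellDens, cellDens, ← mul_assoc, hν, withDensity_apply _ (measurableSet_cell _ _ _),
            ← setLIntegral_const]
          exact mul_le_mul_left (setLIntegral_mono' (measurableSet_cell _ _ _) hsub) _
        rw [hκ, cellDens_add, add_mul, one_mul]
        exact add_le_add (hνc.trans (mul_le_mul_right (hvol j x) _)) (hvol j x)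
      calc _ ≤ ((M + 1) * D) ^ s * 1 := by
            rw [mul_one]
            exact ENNReal.rpow_le_rpow h1 hs.le
        _ ≤ B * (f x + 1) := by
            refine mul_le_mul' ?_ le_add_self
            rw [hB]
            exact le_add_self.trans le_add_self
  set W : ℝ≥0∞ := (1 - 2 ^ (-(N - d)))⁻¹ with hW
  have hWt : W ≠ ∞ := inv_one_sub_two_rpow_neg_ne_top (by rw [hd]; linarith)
  refine ⟨L', hL'0, W * B * carlesonConst s, ?_, fun E hE => ?_⟩
  · have := carlesonConst_ne_top h.one_lt_s
    finiteness
  have key := cellEnergy_le_of_carleson (L := L') (d := d) h.one_lt_s (κ := ν.restrict E)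
    (h := fun j x => κ (cell L' j x)) (C := W * B) hκcell
    (fun j x => (Measure.restrict_apply_le _ _).trans (by
      rw [hκ, Measure.add_apply]; exact le_self_add))
    (fun j => (cellConst_cell L' j).comp κ) fun j x => ?_
  · simpa using key
  · refine (tsum_setLIntegral_cellDens_rpow_le hL'0 h.one_lt_s κ j x).trans ?_
    rw [mul_assoc]
    refine mul_le_mul_right ?_ _
    have hκ' : κ (cell L' j x) = ∫⁻ y in cell L' j x, (f y + 1) := by
      rw [lintegral_add_right _ measurable_const, setLIntegral_one, hκ, Measure.add_apply, hν,
        withDensity_apply _ (measurableSet_cell _ _ _)]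
    rw [hκ', ← lintegral_const_mul' _ _ hBt]
    refine lintegral_mono_ae ((ae_restrict_of_ae hpt).mono fun y hy => le_trans ?_ hy)
    refine ENNReal.rpow_le_rpow ?_ hs.le
    exact iSup_le fun i => le_iSup (fun j => cellDens d L' κ j y) (j + i)

/-- A pair of pointwise bounds for iterated Wolff potentials implies the capacitary bound for the
product of the Wolff potentials. -/
theorem exists_setLIntegral_wolffMul_le_besselCap
    (h : WolffExponents N α β p q1 q2 e x1 y1 s σ) {R : ℝ} (hR : 0 < R) {μ : Measure (Euc N)}
    [IsFiniteMeasure μ] {x₀ : Euc N} (hμ : μ (ball x₀ R)ᶜ = 0) {C : ℝ≥0∞} (hC : C ≠ ∞)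
    (hsol : ∀ᵐ x ∂volume.restrict (ball x₀ (2 * R)),
      wolff α p (ENNReal.ofReal (4 * R))
          (volume.withDensity (wolffMul α β p q1 q2 (4 * R) μ)) x ≤
        C * wolff α p (ENNReal.ofReal (4 * R)) μ x ∧
      wolff β p (ENNReal.ofReal (4 * R))
          (volume.withDensity (wolffMul α β p q1 q2 (4 * R) μ)) x ≤
        C * wolff β p (ENNReal.ofReal (4 * R)) μ x) :
    ∃ C' : ℝ≥0∞, C' ≠ ∞ ∧ ∀ K, IsCompact K →
      ∫⁻ x in K, wolffMul α β p q1 q2 (4 * R) μ x ≤ C' * besselCap N σ (s / (s - 1)) K := by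
  have hq1 := h.q1_pos.le
  have hq2 := h.q2_pos.le
  have hfin := h.lintegral_wolffMul_ne_top hR hμ hC (hsol.mono fun _ hx => hx.2)
  obtain ⟨L, hL, hT⟩ := h.cellTesting_withDensity_wolffMul hR hμ (C := C ^ q1 * C ^ q2)
    (by finiteness) hfin (hsol.mono fun x hx => by
      rw [wolffMul, wolffMul, mul_mul_mul_comm, ← ENNReal.mul_rpow_of_nonneg _ _ hq1,
        ← ENNReal.mul_rpow_of_nonneg _ _ hq2]
      exact mul_le_mul' (ENNReal.rpow_le_rpow hx.1 hq1) (ENNReal.rpow_le_rpow hx.2 hq2))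
  have : IsFiniteMeasure (volume.withDensity (wolffMul α β p q1 q2 (4 * R) μ)) :=
    isFiniteMeasure_withDensity hfin
  obtain ⟨C', hC', hcap⟩ := exists_le_besselCap_of_cellTesting h.σ_pos h.σ_lt h.one_lt_s hL hT
  refine ⟨C', hC', fun K hK => ?_⟩
  have := hcap K hK.measurableSet
  rwa [withDensity_apply _ hK.measurableSet] at this

end WolffExponents

/-- Sums dominated by a growing geometric sequence. -/
lemma exists_sum_range_le_rpow_neg {ε : ℝ} (hε : 0 < ε) (hL : 0 < L) :
    ∃ C > 0, ∀ (K : ℝ) (u : ℕ → ℝ) (i : ℕ), 0 ≤ K →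
      (∀ l ≤ i, u l ≤ K * dscale L l ^ (-ε)) →
      ∑ l ∈ Finset.range (i + 1), u l ≤ C * K * dscale L i ^ (-ε) := by
  set r := (2 : ℝ) ^ (-ε) with hr
  have hr1 : r < 1 := Real.rpow_lt_one_of_one_lt_of_neg one_lt_two (by linarith)
  have hr0 : 0 < r := by positivity
  refine ⟨(1 - r)⁻¹, inv_pos.2 (by linarith), fun K u i hK hu => ?_⟩
  have hrC : (1 - r)⁻¹ * r + 1 = (1 - r)⁻¹ := by
    have : 1 - r ≠ 0 := by linarith
    field_simp
    ring
  have hC1 : 1 ≤ (1 - r)⁻¹ := (one_le_inv₀ (by linarith)).2 (by linarith)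
  induction i with
  | zero =>
    rw [zero_add, Finset.sum_range_one]
    have h1 : 0 ≤ K * dscale L 0 ^ (-ε) :=
      mul_nonneg hK (Real.rpow_nonneg (dscale_pos hL 0).le _)
    calc u 0 ≤ 1 * (K * dscale L 0 ^ (-ε)) := by rw [one_mul]; exact hu 0 le_rfl
      _ ≤ (1 - r)⁻¹ * (K * dscale L 0 ^ (-ε)) := mul_le_mul_of_nonneg_right hC1 h1
      _ = _ := by ring
  | succ i ih =>
    rw [Finset.sum_range_succ]
    have h1 : dscale L i ^ (-ε) = r * dscale L (i + 1) ^ (-ε) := by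
      rw [dscale_succ, Real.mul_rpow (by norm_num) (dscale_pos hL _).le]
    have h2 := ih fun l hl => hu l (hl.trans (Nat.le_succ i))
    have h3 := hu (i + 1) le_rfl
    rw [h1] at h2
    calc _ ≤ (1 - r)⁻¹ * K * (r * dscale L (i + 1) ^ (-ε)) + K * dscale L (i + 1) ^ (-ε) :=
          add_le_add h2 h3
      _ = ((1 - r)⁻¹ * r + 1) * K * dscale L (i + 1) ^ (-ε) := by ring
      _ = _ := by rw [hrC]

/-- A power of a larger number is controlled by its increment. -/
lemma rpow_le_rpow_add_mul {a S u : ℝ} (hS : 0 ≤ S) (hu : 0 ≤ u) (h : 0 < S + u) :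
    (S + u) ^ a ≤ S ^ a + max 1 a * (u * (S + u) ^ (a - 1)) := by
  set t := S / (S + u) with ht
  have ht0 : 0 ≤ t := by positivity
  have ht1 : t ≤ 1 := (div_le_one h).2 (by linarith)
  have hu' : u = (S + u) * (1 - t) := by rw [ht]; field_simp; ring
  have hS' : S = (S + u) * t := by rw [ht]; field_simp
  have key : 1 ≤ t ^ a + max 1 a * (1 - t) := by
    rcases le_total a 1 with h1 | h1
    · rw [max_eq_left h1, one_mul]
      have : t ≤ t ^ a := by
        simpa using Real.rpow_le_rpow_of_exponent_ge_of_imp ht0 ht1 h1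
          (fun _ h => absurd h one_ne_zero)
      linarith
    · rw [max_eq_right h1]
      have := one_add_mul_self_le_rpow_one_add (s := t - 1) (by linarith) h1
      rw [add_sub_cancel] at this
      linarith
  have hSa : S ^ a = (S + u) ^ a * t ^ a := by
    rw [← Real.mul_rpow h.le ht0, ← hS']
  have hua : u * (S + u) ^ (a - 1) = (S + u) ^ a * (1 - t) := by
    nth_rewrite 1 [hu']
    rw [Real.rpow_sub h, Real.rpow_one]
    field_simp
  rw [hSa, hua]
  have := mul_le_mul_of_nonneg_left key (Real.rpow_nonneg h.le a)
  linarith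

/-- Sums of a sequence satisfying a contracting recursive inequality. -/
lemma sum_range_le_of_le_mul_add {r C : ℝ} (hr0 : 0 ≤ r) (hr1 : r < 1) {Y u : ℕ → ℝ}
    (hY : ∀ i, 0 ≤ Y i) (h0 : Y 0 ≤ C * u 0) (h : ∀ i, Y (i + 1) ≤ r * Y i + C * u (i + 1))
    (n : ℕ) : ∑ i ∈ Finset.range (n + 1), Y i ≤ C / (1 - r) * ∑ i ∈ Finset.range (n + 1), u i := by
  have key : (1 - r) * ∑ i ∈ Finset.range (n + 1), Y i + r * Y n ≤
      C * ∑ i ∈ Finset.range (n + 1), u i := by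
    induction n with
    | zero => simp only [zero_add, Finset.sum_range_one]; linarith
    | succ n ih =>
      rw [Finset.sum_range_succ, Finset.sum_range_succ (f := u), mul_add, mul_add]
      linarith [h n]
  rw [div_mul_eq_mul_div, le_div_iff₀ (by linarith)]
  have := mul_nonneg hr0 (hY n)
  linarith

lemma dscale_rpow_le {θ : ℝ} (hθ : 0 ≤ θ) (hL : 0 < L) (i : ℕ) : dscale L i ^ θ ≤ L ^ θ := by
  refine Real.rpow_le_rpow (dscale_pos hL i).le ?_ hθ
  simpa [dscale_zero] using dscale_anti hL (Nat.zero_le i)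

/-- Rewriting a power bound with a smaller exponent. -/
lemma mul_dscale_rpow_le {x y M : ℝ} (hM : 0 ≤ M) (hxy : y ≤ x) (hL : 0 < L) (i : ℕ) :
    M * dscale L i ^ x ≤ M * L ^ (x - y) * dscale L i ^ y := by
  have h1 : dscale L i ^ x = dscale L i ^ (x - y) * dscale L i ^ y := by
    rw [← Real.rpow_add (dscale_pos hL i)]; congr 1; ring
  rw [h1, mul_assoc]
  refine mul_le_mul_of_nonneg_left (mul_le_mul_of_nonneg_right
    (dscale_rpow_le (by linarith) hL i) ?_) hM
  exact Real.rpow_nonneg (dscale_pos hL i).le _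

/-- A pair of sequences of the type of the summands of two discretized Wolff potentials. -/
structure TailSeq (A B Q M L : ℝ) (u v : ℕ → ℝ) : Prop where
  u_nonneg : ∀ i, 0 ≤ u i
  u_zero_pos : 0 < u 0
  v_eq : ∀ i, v i = u i * dscale L i ^ (-(A - B))
  u_le : ∀ i, u i ≤ M * dscale L i ^ (A - Q)

namespace TailSeq

variable {A B Q M a c : ℝ} {u v : ℕ → ℝ}

lemma v_nonneg (h : TailSeq A B Q M L u v) (hL : 0 < L) (i : ℕ) : 0 ≤ v i := by
  rw [h.v_eq]
  exact mul_nonneg (h.u_nonneg i) (Real.rpow_nonneg (dscale_pos hL i).le _)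

lemma u_eq (h : TailSeq A B Q M L u v) (hL : 0 < L) (i : ℕ) :
    u i = v i * dscale L i ^ (A - B) := by
  rw [h.v_eq, mul_assoc, ← Real.rpow_add (dscale_pos hL i), neg_add_cancel, Real.rpow_zero, mul_one]

lemma v_le (h : TailSeq A B Q M L u v) (hL : 0 < L) (i : ℕ) :
    v i ≤ M * dscale L i ^ (-(Q - B)) := by
  rw [h.v_eq]
  refine (mul_le_mul_of_nonneg_right (h.u_le i)
    (Real.rpow_nonneg (dscale_pos hL i).le _)).trans (le_of_eq ?_)
  rw [mul_assoc, ← Real.rpow_add (dscale_pos hL i)]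
  congr 2; ring

lemma sum_u_pos (h : TailSeq A B Q M L u v) (i : ℕ) : 0 < ∑ l ∈ Finset.range (i + 1), u l :=
  h.u_zero_pos.trans_le
    (Finset.single_le_sum (f := u) (fun l _ => h.u_nonneg l) (Finset.mem_range.2 (by lia)))

lemma sum_v_pos (h : TailSeq A B Q M L u v) (hL : 0 < L) (i : ℕ) :
    0 < ∑ l ∈ Finset.range (i + 1), v l := by
  refine lt_of_lt_of_le ?_
    (Finset.single_le_sum (f := v) (fun l _ => h.v_nonneg hL l)
      (Finset.mem_range.2 (Nat.succ_pos i)))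
  rw [h.v_eq]
  exact mul_pos h.u_zero_pos (Real.rpow_pos_of_pos (dscale_pos hL 0) _)

lemma mul_sum_v_le (h : TailSeq A B Q M L u v) (hL : 0 < L) (hBA : B < A) (i : ℕ) :
    dscale L i ^ (A - B) * ∑ l ∈ Finset.range (i + 1), v l ≤
      ∑ l ∈ Finset.range (i + 1), u l := by
  rw [Finset.mul_sum]
  refine Finset.sum_le_sum fun l hl => ?_
  rw [h.u_eq hL l, mul_comm]
  refine mul_le_mul_of_nonneg_left (Real.rpow_le_rpow (dscale_pos hL i).le
    (dscale_anti hL ?_) (by linarith)) (h.v_nonneg hL l)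
  have := Finset.mem_range.1 hl
  lia

end TailSeq

section Tails

variable {A B Q a c : ℝ}

lemma exists_sum_v_le (hBQ : B < Q) (hL : 0 < L) (M : ℝ) :
    ∃ K > 0, ∀ u v, TailSeq A B Q M L u v → ∀ i,
      ∑ l ∈ Finset.range (i + 1), v l ≤ K * dscale L i ^ (-(Q - B)) := by
  obtain ⟨C, hC, hsum⟩ := exists_sum_range_le_rpow_neg (ε := Q - B) (by linarith) hL
  refine ⟨C * max M 1, mul_pos hC (by positivity), fun u v h i => ?_⟩
  refine hsum _ _ _ (by positivity) fun l _ => (h.v_le hL l).trans ?_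
  exact mul_le_mul_of_nonneg_right (le_max_left _ _) (Real.rpow_nonneg (dscale_pos hL l).le _)

lemma exists_sum_u_le {δ : ℝ} (hδ : 0 < δ) (hδQ : -δ ≤ A - Q) (hL : 0 < L) (M : ℝ) :
    ∃ K > 0, ∀ u v, TailSeq A B Q M L u v → ∀ i,
      ∑ l ∈ Finset.range (i + 1), u l ≤ K * dscale L i ^ (-δ) := by
  obtain ⟨C, hC, hsum⟩ := exists_sum_range_le_rpow_neg hδ hL
  refine ⟨C * (max M 1 * L ^ (A - Q - -δ)), by positivity, fun u v h i => ?_⟩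
  refine hsum _ _ _ (by positivity) fun l _ => (h.u_le l).trans ?_
  refine le_trans ?_ (mul_dscale_rpow_le (by positivity) hδQ hL l)
  exact mul_le_mul_of_nonneg_right (le_max_left _ _) (Real.rpow_nonneg (dscale_pos hL l).le _)

lemma exists_rpow_mul_sum_u_le (hc : 0 < c) (hac : 1 < a + c) (hBA : B < A) (hBQ : B < Q)
    (hQ : (a + c - 1) * Q ≤ a * A + c * B) (hcQ : c * (Q - B) < Q) (hL : 0 < L) (M : ℝ) :
    ∃ K ≥ 0, ∀ u v, TailSeq A B Q M L u v → ∀ i,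
      dscale L i ^ A * ((∑ l ∈ Finset.range (i + 1), u l) ^ (a - 1) *
        (∑ l ∈ Finset.range (i + 1), v l) ^ c) ≤ K := by
  obtain ⟨K, hK, hT⟩ := exists_sum_v_le (A := A) hBQ hL M
  rcases le_or_gt a 1 with ha1 | ha1
  · refine ⟨K ^ (a + c - 1) * L ^ (a * A + c * B - (a + c - 1) * Q), by positivity,
      fun u v h i => ?_⟩
    have hl := dscale_pos hL i
    have hS := h.sum_u_pos i
    have hT0 := h.sum_v_pos hL i
    have hTi := hT u v h i
    have hST := h.mul_sum_v_le hL hBA i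
    set S := ∑ l ∈ Finset.range (i + 1), u l
    set T := ∑ l ∈ Finset.range (i + 1), v l
    set ℓ := dscale L i
    calc ℓ ^ A * (S ^ (a - 1) * T ^ c) ≤ ℓ ^ A * ((ℓ ^ (A - B) * T) ^ (a - 1) * T ^ c) := by
          gcongr ?_ * (?_ * ?_)
          exact Real.rpow_le_rpow_of_nonpos (by positivity) hST (by linarith)
      _ = ℓ ^ (A + (A - B) * (a - 1)) * T ^ (a + c - 1) := by
          rw [Real.mul_rpow (by positivity) hT0.le, ← Real.rpow_mul hl.le, Real.rpow_add hl,
            show a + c - 1 = (a - 1) + c by ring, Real.rpow_add hT0]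
          ring
      _ ≤ ℓ ^ (A + (A - B) * (a - 1)) * (K * ℓ ^ (-(Q - B))) ^ (a + c - 1) := by
          gcongr
      _ = K ^ (a + c - 1) * ℓ ^ (a * A + c * B - (a + c - 1) * Q) := by
          rw [Real.mul_rpow hK.le (by positivity), ← Real.rpow_mul hl.le, mul_left_comm,
            ← Real.rpow_add hl]
          congr 2; ring
      _ ≤ _ := by
          refine mul_le_mul_of_nonneg_left (dscale_rpow_le (by linarith) hL i) (by positivity)
  · set δ := (A - c * (Q - B)) / (a - 1) with hδ
    have hδ' : (a - 1) * δ = A - c * (Q - B) := by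
      rw [hδ, mul_div_cancel₀]; linarith
    have ha1' : 0 < a - 1 := by linarith
    have hδ0 : 0 < δ := by
      refine div_pos ?_ ha1'
      rcases le_or_gt Q A with h | h
      · linarith
      · nlinarith [mul_pos ha1' (sub_pos.2 h)]
    have hδQ : -δ ≤ A - Q := by
      refine le_of_mul_le_mul_left ?_ ha1'
      nlinarith
    obtain ⟨K', hK', hSle⟩ := exists_sum_u_le (B := B) hδ0 hδQ hL M
    refine ⟨K' ^ (a - 1) * K ^ c, by positivity, fun u v h i => ?_⟩
    have hl := dscale_pos hL i
    have hS := h.sum_u_pos i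
    have hT0 := h.sum_v_pos hL i
    have hTi := hT u v h i
    have hSi := hSle u v h i
    set S := ∑ l ∈ Finset.range (i + 1), u l
    set T := ∑ l ∈ Finset.range (i + 1), v l
    set ℓ := dscale L i
    calc ℓ ^ A * (S ^ (a - 1) * T ^ c)
        ≤ ℓ ^ A * ((K' * ℓ ^ (-δ)) ^ (a - 1) * (K * ℓ ^ (-(Q - B))) ^ c) := by
          gcongr
      _ = K' ^ (a - 1) * K ^ c * (ℓ ^ A * ℓ ^ (-δ * (a - 1)) * ℓ ^ (-(Q - B) * c)) := by
          rw [Real.mul_rpow hK.le (by positivity), Real.mul_rpow hK'.le (by positivity),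
            ← Real.rpow_mul hl.le, ← Real.rpow_mul hl.le]
          ring
      _ = K' ^ (a - 1) * K ^ c := by
          rw [← Real.rpow_add hl, ← Real.rpow_add hl,
            show A + -δ * (a - 1) + -(Q - B) * c = 0 by linarith, Real.rpow_zero, mul_one]

lemma exists_rpow_mul_sum_v_le (ha : 0 < a) (hac : 1 < a + c) (hB : 0 < B)
    (hBQ : B < Q)
    (hQ : (a + c - 1) * Q ≤ a * A + c * B) (hcQ : c * (Q - B) < Q) (hL : 0 < L) (M : ℝ) :
    ∃ K ≥ 0, ∀ u v, TailSeq A B Q M L u v → ∀ i,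
      dscale L i ^ B * ((∑ l ∈ Finset.range (i + 1), u l) ^ a *
        (∑ l ∈ Finset.range (i + 1), v l) ^ (c - 1)) ≤ K := by
  obtain ⟨K, hK, hT⟩ := exists_sum_v_le (A := A) hBQ hL M
  rcases le_or_gt 1 c with hc1 | hc1
  · set δ := (Q - c * (Q - B)) / a with hδ
    have hδ' : a * δ = Q - c * (Q - B) := by
      rw [hδ, mul_div_cancel₀]; exact ha.ne'
    have hδ0 : 0 < δ := div_pos (by linarith) ha
    have hδQ : -δ ≤ A - Q := by
      refine le_of_mul_le_mul_left ?_ ha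
      nlinarith
    obtain ⟨K', hK', hSle⟩ := exists_sum_u_le (B := B) hδ0 hδQ hL M
    refine ⟨K' ^ a * K ^ (c - 1), by positivity, fun u v h i => ?_⟩
    have hl := dscale_pos hL i
    have hS := h.sum_u_pos i
    have hT0 := h.sum_v_pos hL i
    have hTi := hT u v h i
    have hSi := hSle u v h i
    set S := ∑ l ∈ Finset.range (i + 1), u l
    set T := ∑ l ∈ Finset.range (i + 1), v l
    set ℓ := dscale L i
    calc ℓ ^ B * (S ^ a * T ^ (c - 1))
        ≤ ℓ ^ B * ((K' * ℓ ^ (-δ)) ^ a * (K * ℓ ^ (-(Q - B))) ^ (c - 1)) := by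
          have : 0 ≤ c - 1 := by linarith
          gcongr
      _ = K' ^ a * K ^ (c - 1) * (ℓ ^ B * ℓ ^ (-δ * a) * ℓ ^ (-(Q - B) * (c - 1))) := by
          rw [Real.mul_rpow hK.le (by positivity), Real.mul_rpow hK'.le (by positivity),
            ← Real.rpow_mul hl.le, ← Real.rpow_mul hl.le]
          ring
      _ = K' ^ a * K ^ (c - 1) := by
          rw [← Real.rpow_add hl, ← Real.rpow_add hl,
            show B + -δ * a + -(Q - B) * (c - 1) = 0 by linarith, Real.rpow_zero, mul_one]
  · set t := (1 - c) / a with ht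
    have hta : a * t = 1 - c := by rw [ht, mul_div_cancel₀]; exact ha.ne'
    have ht0 : 0 < t := div_pos (by linarith) ha
    have ht1 : t < 1 := (div_lt_one ha).2 (by linarith)
    have hBa : 0 < B / a := by positivity
    have hBa' : a * (B / a) = B := by field_simp
    set θ := t * (A - B) + (1 - t) * (A - Q) with hθ
    have hθB : -(B / a) ≤ θ := by
      refine le_of_mul_le_mul_left ?_ ha
      rw [hθ]
      have : a * (t * (A - B) + (1 - t) * (A - Q)) =
          (a * t) * (A - B) + (a - a * t) * (A - Q) := by ring
      rw [this, hta]
      nlinarith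
    obtain ⟨C, hC, hsum⟩ := exists_sum_range_le_rpow_neg hBa hL
    refine ⟨(C * (max M 1 ^ (1 - t) * L ^ (θ - -(B / a)))) ^ a, by positivity, fun u v h i => ?_⟩
    have hl := dscale_pos hL i
    have hS := h.sum_u_pos i
    have hT0 := h.sum_v_pos hL i
    have hSi : ∑ l ∈ Finset.range (i + 1), u l ≤
        C * ((∑ l ∈ Finset.range (i + 1), v l) ^ t * max M 1 ^ (1 - t) * L ^ (θ - -(B / a))) *
          dscale L i ^ (-(B / a)) := by
      refine hsum _ _ _ (by positivity) fun l hli => ?_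
      refine le_trans ?_ (mul_dscale_rpow_le (by positivity) hθB hL l)
      have hl' := dscale_pos hL l
      rcases (h.u_nonneg l).eq_or_lt with h0 | h0
      · rw [← h0]; positivity
      have hul : u l ≤ (∑ l ∈ Finset.range (i + 1), v l) * dscale L l ^ (A - B) := by
        rw [h.u_eq hL l]
        refine mul_le_mul_of_nonneg_right (Finset.single_le_sum (f := v)
          (fun l _ => h.v_nonneg hL l) (Finset.mem_range.2 (by lia))) (by positivity)
      have hul' : u l ≤ max M 1 * dscale L l ^ (A - Q) :=
        (h.u_le l).trans (mul_le_mul_of_nonneg_right (le_max_left _ _) (by positivity))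
      set T := ∑ l ∈ Finset.range (i + 1), v l
      calc u l = u l ^ t * u l ^ (1 - t) := by
            rw [← Real.rpow_add h0, add_sub_cancel, Real.rpow_one]
        _ ≤ (T * dscale L l ^ (A - B)) ^ t * (max M 1 * dscale L l ^ (A - Q)) ^ (1 - t) := by
            have : 0 ≤ 1 - t := by linarith
            gcongr
        _ = _ := by
            rw [Real.mul_rpow hT0.le (by positivity), Real.mul_rpow (by positivity)
              (by positivity), ← Real.rpow_mul hl'.le, ← Real.rpow_mul hl'.le, hθ,
              Real.rpow_add hl', mul_comm t, mul_comm (1 - t)]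
            ring
    set S := ∑ l ∈ Finset.range (i + 1), u l
    set T := ∑ l ∈ Finset.range (i + 1), v l
    set ℓ := dscale L i
    set G := C * (max M 1 ^ (1 - t) * L ^ (θ - -(B / a)))
    have hG : 0 ≤ G := by positivity
    calc ℓ ^ B * (S ^ a * T ^ (c - 1))
        ≤ ℓ ^ B * ((G * T ^ t * ℓ ^ (-(B / a))) ^ a * T ^ (c - 1)) := by
          gcongr
          exact hSi.trans (le_of_eq (by simp only [G]; ring))
      _ = G ^ a * (ℓ ^ B * ℓ ^ (-(B / a) * a)) * (T ^ (t * a) * T ^ (c - 1)) := by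
          rw [Real.mul_rpow (by positivity) (by positivity), Real.mul_rpow hG (by positivity),
            ← Real.rpow_mul hl.le, ← Real.rpow_mul hT0.le]
          ring
      _ = G ^ a := by
          rw [← Real.rpow_add hl, ← Real.rpow_add hT0,
            show B + -(B / a) * a = 0 by linarith, show t * a + (c - 1) = 0 by linarith,
            Real.rpow_zero, Real.rpow_zero, mul_one, mul_one]

/-- The weighted sums of products of powers of the partial sums are controlled by the sums. -/
lemma exists_sum_rpow_mul_sum_le (ha : 0 < a) (hc : 0 < c) (hac : 1 < a + c) (hB : 0 < B)
    (hBA : B < A) (hBQ : B < Q) (hQ : (a + c - 1) * Q ≤ a * A + c * B) (hcQ : c * (Q - B) < Q)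
    (hL : 0 < L) (M : ℝ) :
    ∃ K ≥ 0, ∀ u v, TailSeq A B Q M L u v → ∀ n,
      ∑ i ∈ Finset.range (n + 1), dscale L i ^ A * ((∑ l ∈ Finset.range (i + 1), u l) ^ a *
        (∑ l ∈ Finset.range (i + 1), v l) ^ c) ≤ K * ∑ i ∈ Finset.range (n + 1), u i ∧
      ∑ i ∈ Finset.range (n + 1), dscale L i ^ B * ((∑ l ∈ Finset.range (i + 1), u l) ^ a *
        (∑ l ∈ Finset.range (i + 1), v l) ^ c) ≤ K * ∑ i ∈ Finset.range (n + 1), v i := by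
  obtain ⟨K₁, hK₁, h₁⟩ := exists_rpow_mul_sum_u_le hc hac hBA hBQ hQ hcQ hL M
  obtain ⟨K₂, hK₂, h₂⟩ := exists_rpow_mul_sum_v_le ha hac hB hBQ hQ hcQ hL M
  set G := max 1 a * K₁ + max 1 c * K₂ with hG
  have hA : 0 < A := hB.trans hBA
  have hpow : ∀ t : ℝ, 0 < t → (2 : ℝ) ^ (-t) < 1 := fun t ht =>
    Real.rpow_lt_one_of_one_lt_of_neg one_lt_two (by linarith)
  have hG0 : 0 ≤ G := by positivity
  have hrA := hpow A hA
  have hrB := hpow B hB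
  have hGA : 0 ≤ G / (1 - 2 ^ (-A)) := div_nonneg hG0 (by linarith)
  have hGB : 0 ≤ G / (1 - 2 ^ (-B)) := div_nonneg hG0 (by linarith)
  refine ⟨G / (1 - 2 ^ (-A)) + G / (1 - 2 ^ (-B)), by positivity, fun u v h n => ?_⟩
  set S : ℕ → ℝ := fun i => ∑ l ∈ Finset.range (i + 1), u l with hS
  set T : ℕ → ℝ := fun i => ∑ l ∈ Finset.range (i + 1), v l with hT
  have hS0 : ∀ i, 0 < S i := h.sum_u_pos
  have hT0 : ∀ i, 0 < T i := h.sum_v_pos hL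
  have hl : ∀ i, 0 < dscale L i := dscale_pos hL
  have hu := h.u_nonneg
  have hv := h.v_nonneg hL
  have hSs : ∀ i, S (i + 1) = S i + u (i + 1) := fun i => Finset.sum_range_succ u (i + 1)
  have hTs : ∀ i, T (i + 1) = T i + v (i + 1) := fun i => Finset.sum_range_succ v (i + 1)
  have hswap : ∀ i, v i * dscale L i ^ A = u i * dscale L i ^ B := fun i => by
    rw [h.u_eq hL i, mul_assoc, ← Real.rpow_add (hl i), sub_add_cancel]
  have h₁ : ∀ i, dscale L i ^ A * (S i ^ (a - 1) * T i ^ c) ≤ K₁ := h₁ u v h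
  have h₂ : ∀ i, dscale L i ^ B * (S i ^ a * T i ^ (c - 1)) ≤ K₂ := h₂ u v h
  have hone : ∀ b : ℝ, (1 : ℝ) ≤ max 1 b := fun b => le_max_left _ _
  have hstep : ∀ i, S (i + 1) ^ a * T (i + 1) ^ c ≤ S i ^ a * T i ^ c +
      (max 1 a * (u (i + 1) * (S (i + 1) ^ (a - 1) * T (i + 1) ^ c)) +
        max 1 c * (v (i + 1) * (S (i + 1) ^ a * T (i + 1) ^ (c - 1)))) := by
    intro i
    have e1 := rpow_le_rpow_add_mul (a := a) (hS0 i).le (hu (i + 1)) (by rw [← hSs]; exact hS0 _)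
    have e2 := rpow_le_rpow_add_mul (a := c) (hT0 i).le (hv (i + 1)) (by rw [← hTs]; exact hT0 _)
    rw [← hSs] at e1
    rw [← hTs] at e2
    have p1 := Real.rpow_nonneg (hT0 (i + 1)).le c
    have p2 := Real.rpow_nonneg (hS0 i).le a
    have p3 : S i ^ a ≤ S (i + 1) ^ a :=
      Real.rpow_le_rpow (hS0 i).le (by rw [hSs]; linarith [hu (i + 1)]) ha.le
    have p4 := Real.rpow_nonneg (hT0 (i + 1)).le (c - 1)
    have p5 := hv (i + 1)
    have p6 : 0 ≤ max 1 c * (v (i + 1) * T (i + 1) ^ (c - 1)) := by positivity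
    have m1 := mul_le_mul_of_nonneg_right e1 p1
    have m2 := mul_le_mul_of_nonneg_left e2 p2
    have m3 := mul_le_mul_of_nonneg_right p3 p6
    linarith
  constructor
  · refine (sum_range_le_of_le_mul_add (r := 2 ^ (-A)) (C := G) (u := u) (by positivity) hrA
      (fun i => ?_) ?_ (fun i => ?_) n).trans (mul_le_mul_of_nonneg_right (by linarith)
        (Finset.sum_nonneg fun i _ => hu i))
    · exact mul_nonneg (Real.rpow_nonneg (hl i).le _)
        (mul_nonneg (Real.rpow_nonneg (hS0 i).le _) (Real.rpow_nonneg (hT0 i).le _))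
    · have hS00 : S 0 = u 0 := by simp [hS]
      have e1 : S 0 ^ a = u 0 * S 0 ^ (a - 1) := by
        rw [Real.rpow_sub (hS0 0), Real.rpow_one, ← hS00]
        field_simp [(hS0 0).ne']
      change dscale L 0 ^ A * (S 0 ^ a * T 0 ^ c) ≤ G * u 0
      have e2 := mul_le_mul_of_nonneg_left (h₁ 0) (hu 0)
      have e3 : K₁ ≤ G := by
        have := mul_le_mul_of_nonneg_right (hone a) hK₁
        have : 0 ≤ max 1 c * K₂ := by positivity
        linarith
      have e4 := mul_le_mul_of_nonneg_right e3 (hu 0)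
      rw [e1]
      linarith
    · change dscale L (i + 1) ^ A * (S (i + 1) ^ a * T (i + 1) ^ c) ≤
        2 ^ (-A) * (dscale L i ^ A * (S i ^ a * T i ^ c)) + G * u (i + 1)
      have e0 : (2 : ℝ) ^ (-A) * dscale L i ^ A = dscale L (i + 1) ^ A := by
        rw [dscale_succ L i, Real.mul_rpow (by norm_num) (hl _).le, ← mul_assoc,
          ← Real.rpow_add (by norm_num), neg_add_cancel, Real.rpow_zero, one_mul]
      rw [← mul_assoc (2 ^ (-A) : ℝ), e0]
      have e1 := mul_le_mul_of_nonneg_left (hstep i) (Real.rpow_nonneg (hl (i + 1)).le A)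
      have e2 := mul_le_mul_of_nonneg_left (h₁ (i + 1)) (mul_nonneg
        (zero_le_one.trans (hone a)) (hu (i + 1)))
      have e3 := mul_le_mul_of_nonneg_left (h₂ (i + 1)) (mul_nonneg
        (zero_le_one.trans (hone c)) (hu (i + 1)))
      have e4 : dscale L (i + 1) ^ A * (max 1 c * (v (i + 1) * (S (i + 1) ^ a *
          T (i + 1) ^ (c - 1)))) = max 1 c * u (i + 1) *
          (dscale L (i + 1) ^ B * (S (i + 1) ^ a * T (i + 1) ^ (c - 1))) := by
        linear_combination (max 1 c * (S (i + 1) ^ a * T (i + 1) ^ (c - 1))) * hswap (i + 1)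
      linarith
  · refine (sum_range_le_of_le_mul_add (r := 2 ^ (-B)) (C := G) (u := v) (by positivity) hrB
      (fun i => ?_) ?_ (fun i => ?_) n).trans (mul_le_mul_of_nonneg_right (by linarith)
        (Finset.sum_nonneg fun i _ => hv i))
    · exact mul_nonneg (Real.rpow_nonneg (hl i).le _)
        (mul_nonneg (Real.rpow_nonneg (hS0 i).le _) (Real.rpow_nonneg (hT0 i).le _))
    · have hT00 : T 0 = v 0 := by simp [hT]
      have e1 : T 0 ^ c = v 0 * T 0 ^ (c - 1) := by
        rw [Real.rpow_sub (hT0 0), Real.rpow_one, ← hT00]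
        field_simp [(hT0 0).ne']
      change dscale L 0 ^ B * (S 0 ^ a * T 0 ^ c) ≤ G * v 0
      have e2 := mul_le_mul_of_nonneg_left (h₂ 0) (hv 0)
      have e3 : K₂ ≤ G := by
        have := mul_le_mul_of_nonneg_right (hone c) hK₂
        have : 0 ≤ max 1 a * K₁ := by positivity
        linarith
      have e4 := mul_le_mul_of_nonneg_right e3 (hv 0)
      rw [e1]
      linarith
    · change dscale L (i + 1) ^ B * (S (i + 1) ^ a * T (i + 1) ^ c) ≤
        2 ^ (-B) * (dscale L i ^ B * (S i ^ a * T i ^ c)) + G * v (i + 1)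
      have e0 : (2 : ℝ) ^ (-B) * dscale L i ^ B = dscale L (i + 1) ^ B := by
        rw [dscale_succ L i, Real.mul_rpow (by norm_num) (hl _).le, ← mul_assoc,
          ← Real.rpow_add (by norm_num), neg_add_cancel, Real.rpow_zero, one_mul]
      rw [← mul_assoc (2 ^ (-B) : ℝ), e0]
      have e1 := mul_le_mul_of_nonneg_left (hstep i) (Real.rpow_nonneg (hl (i + 1)).le B)
      have e2 := mul_le_mul_of_nonneg_left (h₁ (i + 1)) (mul_nonneg
        (zero_le_one.trans (hone a)) (hv (i + 1)))
      have e3 := mul_le_mul_of_nonneg_left (h₂ (i + 1)) (mul_nonneg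
        (zero_le_one.trans (hone c)) (hv (i + 1)))
      have e4 : dscale L (i + 1) ^ B * (max 1 a * (u (i + 1) * (S (i + 1) ^ (a - 1) *
          T (i + 1) ^ c))) = max 1 a * v (i + 1) *
          (dscale L (i + 1) ^ A * (S (i + 1) ^ (a - 1) * T (i + 1) ^ c)) := by
        linear_combination (-(max 1 a * (S (i + 1) ^ (a - 1) * T (i + 1) ^ c))) * hswap (i + 1)
      linarith

end Tails

/-- The testing condition forces a power decay of the measure of small balls. -/
lemma exists_measure_ball_rpow_le_of_cellTesting {d s : ℝ} (hs : 1 < s) (hL : 0 < L)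
    {μ : Measure (Euc N)} [IsFiniteMeasure μ] (hT : CellTesting d s L μ) :
    ∃ C : ℝ≥0∞, C ≠ ∞ ∧ ∀ j x,
      μ (ball x (dscale L j)) ^ (s - 1) ≤ C * escale L j ^ (d * s - N) := by
  have hs0 : 0 < s := by linarith
  obtain ⟨C, hC, hT⟩ := hT
  obtain ⟨B, hB, hb⟩ := exists_lintegral_ball_le_cellDens N 2 (d := d) hs0
  have hv0 := volume_unit_ball_ne_zero N
  have hvt := volume_unit_ball_ne_top N
  refine ⟨B * C * (volume (ball (0 : Euc N) 1))⁻¹, by finiteness, fun j x => ?_⟩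
  set A := μ (ball x (dscale L j)) with hA
  rcases eq_or_ne A 0 with h0 | h0
  · rw [h0, ENNReal.zero_rpow_of_pos (by linarith)]
    exact zero_le
  have hAt : A ≠ ∞ := measure_ne_top _ _
  have hl := dscale_pos hL j
  have h1 : escale L j ^ (-(d * s)) *
      (A ^ s * (volume (ball (0 : Euc N) 1) * escale L j ^ (N : ℝ))) ≤ B * (C * A) := by
    calc _ = escale L j ^ (-(d * s)) * ∫⁻ _ in ball x (dscale L j), A ^ s := by
          rw [setLIntegral_const, volume_ball_dscale hL]
      _ ≤ escale L j ^ (-(d * s)) * ∫⁻ y,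
          (μ.restrict (ball x (dscale L j))) (ball y ((2 : ℕ) * dscale L j)) ^ s := by
        refine mul_le_mul_right ((setLIntegral_mono' measurableSet_ball fun y hy => ?_).trans
          (setLIntegral_le_lintegral _ _)) _
        refine ENNReal.rpow_le_rpow ?_ hs0.le
        rw [Measure.restrict_apply measurableSet_ball, hA]
        refine measure_mono fun w hw => ⟨?_, hw⟩
        rw [mem_ball] at hw hy ⊢
        rw [dist_comm] at hy
        push_cast
        linarith [dist_triangle w x y]
      _ ≤ _ := hb L hL j _
      _ ≤ _ := mul_le_mul_right ((ENNReal.le_tsum j).trans (hT _ measurableSet_ball)) _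
  have h2 : A ^ s = A ^ (s - 1) * A := by
    rw [ENNReal.rpow_sub _ _ h0 hAt, ENNReal.rpow_one, ENNReal.div_mul_cancel h0 hAt]
  have h3 : escale L j ^ (N : ℝ) * escale L j ^ (-(d * s)) * escale L j ^ (d * s - N) = 1 := by
    rw [← escale_rpow_add hL, ← escale_rpow_add hL]
    ring_nf
    exact ENNReal.rpow_zero
  rw [← ENNReal.mul_le_mul_iff_left h0 hAt]
  calc A ^ (s - 1) * A = escale L j ^ (-(d * s)) *
        (A ^ s * (volume (ball (0 : Euc N) 1) * escale L j ^ (N : ℝ))) *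
        ((volume (ball (0 : Euc N) 1))⁻¹ * escale L j ^ (d * s - N)) := by
        calc _ = A ^ s * (volume (ball (0 : Euc N) 1) * (volume (ball (0 : Euc N) 1))⁻¹) *
              (escale L j ^ (N : ℝ) * escale L j ^ (-(d * s)) * escale L j ^ (d * s - N)) := by
              rw [h2, h3, ENNReal.mul_inv_cancel hv0 hvt]; ring
          _ = _ := by ring
    _ ≤ B * (C * A) * ((volume (ball (0 : Euc N) 1))⁻¹ * escale L j ^ (d * s - N)) :=
        mul_le_mul_left h1 _
    _ = _ := by ring

/-- The decay exponent may be capped at the dimension. -/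
lemma exists_measure_ball_le_of_cellTesting {σ s : ℝ} (hs : 1 < s) (hL : 0 < L)
    {μ : Measure (Euc N)} [IsFiniteMeasure μ] (hT : CellTesting (N - σ) s L μ) :
    ∃ C : ℝ≥0∞, C ≠ ∞ ∧ ∀ j x,
      μ (ball x (dscale L j)) ≤ C * escale L j ^ (N - min (σ * s / (s - 1)) N) := by
  have hs1 : 0 < s - 1 := by linarith
  rcases le_total (σ * s / (s - 1)) N with h | h
  · obtain ⟨C, hC, hd⟩ := exists_measure_ball_rpow_le_of_cellTesting hs hL hT
    refine ⟨C ^ (s - 1)⁻¹, ENNReal.rpow_ne_top_of_nonneg (by positivity) hC, fun j x => ?_⟩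
    have h1 := (ENNReal.le_rpow_inv_iff hs1).2 (hd j x)
    rw [ENNReal.mul_rpow_of_nonneg _ _ (by positivity), ← ENNReal.rpow_mul] at h1
    rw [min_eq_left h]
    convert h1 using 3
    field_simp
    ring
  · refine ⟨μ univ, measure_ne_top _ _, fun j x => ?_⟩
    rw [min_eq_right h, sub_self, ENNReal.rpow_zero, mul_one]
    exact measure_mono (subset_univ _)

/-- Doubling the radii of the balls centred at a point that sees the whole mass at the top scale. -/
lemma sum_double_le_sum_ballTerm {e z : ℝ} (he : 0 ≤ e)
    {μ : Measure (Euc N)} {x : Euc N} (hx : μ (ball x L) = μ univ) (n : ℕ) :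
    ∑ j ∈ Finset.range (n + 1), μ (ball x (2 * dscale L j)) ^ e * escale L j ^ (-z) ≤
      (2 ^ z + 1) * ∑ j ∈ Finset.range (n + 1), ballTerm e z L μ j x := by
  rw [Finset.sum_range_succ', add_mul, one_mul]
  refine add_le_add ?_ ?_
  · rw [Finset.mul_sum]
    refine le_trans (le_of_eq (Finset.sum_congr rfl fun j _ => ?_))
      (Finset.sum_le_sum_of_subset (Finset.range_subset_range.2 n.le_succ))
    rw [← dscale_succ, escale_add_rpow, neg_neg, pow_one, ballTerm]
    ring
  · refine le_trans ?_ (Finset.single_le_sum (f := fun j => ballTerm e z L μ j x)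
      (fun _ _ => zero_le) (Finset.mem_range.2 n.succ_pos))
    rw [ballTerm, dscale_zero, hx]
    exact mul_le_mul_left (ENNReal.rpow_le_rpow (measure_mono (subset_univ _)) he) _

lemma double_le_sum_ballTerm {e z : ℝ} (he : 0 ≤ e)
    {μ : Measure (Euc N)} {x : Euc N} (hx : μ (ball x L) = μ univ) (n : ℕ) :
    μ (ball x (2 * dscale L n)) ^ e * escale L n ^ (-z) ≤
      (2 ^ z + 1) * ∑ j ∈ Finset.range (n + 1), ballTerm e z L μ j x :=
  le_trans (Finset.single_le_sum
    (f := fun j => μ (ball x (2 * dscale L j)) ^ e * escale L j ^ (-z))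
    (fun _ _ => zero_le) (Finset.mem_range.2 n.lt_succ_self))
    (sum_double_le_sum_ballTerm he hx n)

lemma sum_ballTerm_le_of_mem_ball {e z : ℝ} (he : 0 ≤ e) (hL : 0 < L)
    {μ : Measure (Euc N)} {x : Euc N} (hx : μ (ball x L) = μ univ) (n : ℕ) {y : Euc N}
    (hy : y ∈ ball x (dscale L n)) :
    ∑ j ∈ Finset.range (n + 1), ballTerm e z L μ j y ≤
      (2 ^ z + 1) * ∑ j ∈ Finset.range (n + 1), ballTerm e z L μ j x := by
  refine (Finset.sum_le_sum fun j hj => ?_).trans (sum_double_le_sum_ballTerm he hx n)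
  refine mul_le_mul_left (ENNReal.rpow_le_rpow (measure_mono fun w hw => ?_) he) _
  have := dscale_anti hL (Nat.lt_succ_iff.1 (Finset.mem_range.1 hj))
  rw [mem_ball] at hw hy ⊢
  linarith [dist_triangle w y x]

lemma wolff_le_sum_add_tsum {α p e z : ℝ} (hp : 1 < p) (he : e = 1 / (p - 1))
    (hz : z = e * ((N : ℝ) - α * p)) (hz0 : 0 < z) (hL : 0 < L)
    {μ : Measure (Euc N)} {x : Euc N} (hx : μ (ball x L) = μ univ) (n : ℕ) {y : Euc N}
    (hy : y ∈ ball x (dscale L n)) :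
    wolff α p (ENNReal.ofReal L) μ y ≤ 2 ^ z * (2 ^ z + 1) *
      (∑ j ∈ Finset.range (n + 1), ballTerm e z L μ j x +
        ∑' k, ballTerm e z L μ (n + 1 + k) y) := by
  have he0 : 0 ≤ e := by
    have : 0 < p - 1 := by linarith
    rw [he]; positivity
  refine (wolff_le_tsum_ballTerm hp (by rw [← he]; exact hz) hz0 hL μ y).trans ?_
  rw [← he, mul_assoc]
  refine mul_le_mul_right ?_ _
  rw [← ENNReal.summable.sum_add_tsum_nat_add' (k := n + 1), mul_add]
  refine add_le_add (sum_ballTerm_le_of_mem_ball he0 hL hx n hy) ?_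
  simp only [add_comm _ (n + 1)]
  exact le_mul_of_one_le_left zero_le le_add_self

/-- Near the centre, the small scale part of the Wolff potential only sees the doubled ball. -/
lemma tsum_ballTerm_le_wolff_restrict {α p e z : ℝ} (hp : 1 < p) (he : e = 1 / (p - 1))
    (hz : z = e * ((N : ℝ) - α * p)) (hz0 : 0 < z) (hL : 0 < L)
    {μ : Measure (Euc N)} {x : Euc N} (n : ℕ) {y : Euc N} (hy : y ∈ ball x (dscale L n)) :
    ∑' k, ballTerm e z L μ (n + 1 + k) y ≤
      2 ^ (z + 1) * wolff α p (ENNReal.ofReal L) (μ.restrict (ball x (2 * dscale L n))) y := by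
  have h1 := tsum_ballTerm_le_wolff hp (by rw [← he]; exact hz) hz0 hL
    (μ.restrict (ball x (2 * dscale L n))) y
  rw [← he] at h1
  refine le_trans ?_ h1
  refine le_trans (le_of_eq (tsum_congr fun k => ?_))
    (ENNReal.tsum_comp_le_tsum_of_injective (add_right_injective n)
      fun k => ballTerm e z L (μ.restrict (ball x (2 * dscale L n))) (k + 1) y)
  rw [show n + 1 + k = n + k + 1 by ring, ballTerm, ballTerm,
    Measure.restrict_apply measurableSet_ball, inter_eq_left.2]
  intro w hw
  have := dscale_anti hL (show n ≤ n + k + 1 by omega)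
  rw [mem_ball] at hw hy ⊢
  linarith [dist_triangle w y x]

lemma ballTerm_eq_mul {e z z' : ℝ} (hL : 0 < L) (μ : Measure (Euc N)) (j : ℕ) (x : Euc N) :
    ballTerm e z L μ j x = escale L j ^ (z' - z) * ballTerm e z' L μ j x := by
  rw [ballTerm, ballTerm, mul_left_comm, ← escale_rpow_add hL]
  ring_nf

lemma tsum_ballTerm_le_mul_tsum {e z z' : ℝ} (hz : z ≤ z') (hL : 0 < L) (μ : Measure (Euc N))
    (n : ℕ) (y : Euc N) :
    ∑' k, ballTerm e z L μ (n + 1 + k) y ≤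
      escale L n ^ (z' - z) * ∑' k, ballTerm e z' L μ (n + 1 + k) y := by
  rw [← ENNReal.tsum_mul_left]
  refine ENNReal.tsum_le_tsum fun k => ?_
  rw [ballTerm_eq_mul (z' := z') hL]
  exact mul_le_mul_left (ENNReal.rpow_le_rpow (escale_anti hL (by omega)) (by linarith)) _

lemma mul_sum_ballTerm_le {e z z' : ℝ} (hz : z ≤ z') (hL : 0 < L) (μ : Measure (Euc N))
    (n : ℕ) (x : Euc N) :
    escale L n ^ (z' - z) * ∑ j ∈ Finset.range (n + 1), ballTerm e z' L μ j x ≤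
      ∑ j ∈ Finset.range (n + 1), ballTerm e z L μ j x := by
  rw [Finset.mul_sum]
  refine Finset.sum_le_sum fun j hj => ?_
  rw [ballTerm_eq_mul (z := z) (z' := z') hL]
  exact mul_le_mul_left (ENNReal.rpow_le_rpow
    (escale_anti hL (Nat.lt_succ_iff.1 (Finset.mem_range.1 hj))) (by linarith)) _

lemma add_rpow_le_two_rpow_mul {q : ℝ} (hq : 0 ≤ q) (a b : ℝ≥0∞) :
    (a + b) ^ q ≤ 2 ^ q * (a ^ q + b ^ q) := by
  rcases le_total a b with h | h
  · calc (a + b) ^ q ≤ (2 * b) ^ q :=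
          ENNReal.rpow_le_rpow (by rw [two_mul]; exact add_le_add_left h b) hq
      _ = 2 ^ q * b ^ q := ENNReal.mul_rpow_of_nonneg _ _ hq
      _ ≤ _ := mul_le_mul_right le_add_self _
  · calc (a + b) ^ q ≤ (2 * a) ^ q :=
          ENNReal.rpow_le_rpow (by rw [two_mul]; exact add_le_add_right h a) hq
      _ = 2 ^ q * a ^ q := ENNReal.mul_rpow_of_nonneg _ _ hq
      _ ≤ _ := mul_le_mul_right le_self_add _

lemma add_rpow_mul_add_rpow_le {q1 q2 : ℝ} (hq1 : 0 ≤ q1) (hq2 : 0 ≤ q2) {S T U V r : ℝ≥0∞}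
    (hU : U ≤ r * V) (hT : r * T ≤ S) :
    (S + U) ^ q1 * (T + V) ^ q2 ≤ 2 ^ q1 * 2 ^ q2 *
      (2 * (S ^ q1 * T ^ q2) + S ^ q1 * V ^ q2 + 2 * (U ^ q1 * V ^ q2)) := by
  have h1 : U ^ q1 * T ^ q2 ≤ U ^ q1 * V ^ q2 + S ^ q1 * T ^ q2 := by
    rcases le_total T V with h | h
    · exact (mul_le_mul_right (ENNReal.rpow_le_rpow h hq2) _).trans le_self_add
    · exact (mul_le_mul_left (ENNReal.rpow_le_rpow
        (hU.trans ((mul_le_mul_right h r).trans hT)) hq1) _).trans le_add_self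
  calc _ ≤ 2 ^ q1 * (S ^ q1 + U ^ q1) * (2 ^ q2 * (T ^ q2 + V ^ q2)) :=
        mul_le_mul' (add_rpow_le_two_rpow_mul hq1 _ _) (add_rpow_le_two_rpow_mul hq2 _ _)
    _ = 2 ^ q1 * 2 ^ q2 *
        (S ^ q1 * T ^ q2 + S ^ q1 * V ^ q2 + (U ^ q1 * T ^ q2 + U ^ q1 * V ^ q2)) := by ring
    _ ≤ 2 ^ q1 * 2 ^ q2 * (S ^ q1 * T ^ q2 + S ^ q1 * V ^ q2 +
        (U ^ q1 * V ^ q2 + S ^ q1 * T ^ q2 + U ^ q1 * V ^ q2)) :=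
        mul_le_mul_right (add_le_add_right (add_le_add_left h1 _) _) _
    _ = _ := by ring

variable {α β p q1 q2 e x1 y1 s σ : ℝ}

namespace WolffExponents

/-- The mass that the product of the two Wolff potentials gives to dyadic balls. -/
lemma exists_setLIntegral_ball_wolffMul_le (h : WolffExponents N α β p q1 q2 e x1 y1 s σ)
    (hL : 0 < L) {μ : Measure (Euc N)} [IsFiniteMeasure μ] (hT : CellTesting (N - σ) s L μ) :
    ∃ C : ℝ≥0∞, C ≠ ∞ ∧ ∀ x, μ (ball x L) = μ univ → ∀ n,
      ∫⁻ y in ball x (dscale L n), wolffMul α β p q1 q2 L μ y ≤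
        C * (μ (ball x (2 * dscale L n)) + escale L n ^ (N : ℝ) *
          ((∑ j ∈ Finset.range (n + 1), ballTerm e x1 L μ j x) ^ q1 *
            (∑ j ∈ Finset.range (n + 1), ballTerm e y1 L μ j x) ^ q2)) := by
  have hq1 := h.q1_pos.le
  have hq2 := h.q2_pos.le
  have hx1 := h.x1_pos
  have hy1 := h.y1_pos
  have he := h.e_pos.le
  obtain ⟨C1, hC1, hav⟩ := exists_setLIntegral_tsum_ballTerm_rpow_le h.e_pos h.q2_pos h.q2_mul_lt
  obtain ⟨C2, hC2, hW⟩ := h.exists_lintegral_wolff_le hL hT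
  set K : ℝ≥0∞ := (2 ^ x1 * (2 ^ x1 + 1)) ^ q1 * (2 ^ y1 * (2 ^ y1 + 1)) ^ q2 *
    (2 ^ q1 * 2 ^ q2) with hK
  set K' : ℝ≥0∞ := (2 ^ (x1 + 1)) ^ q1 * (2 ^ (y1 + 1)) ^ q2 with hK'
  set v := volume (ball (0 : Euc N) 1)
  have hv : v ≠ ∞ := volume_unit_ball_ne_top N
  have hKt : K ≠ ∞ := by
    have := hx1.le
    have := hy1.le
    finiteness
  have hKt' : K' ≠ ∞ := by
    have : 0 ≤ x1 + 1 := by linarith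
    have : 0 ≤ y1 + 1 := by linarith
    finiteness
  refine ⟨K * (2 * v + C1 * (2 ^ y1 + 1) ^ q2 + 2 * K' * C2), ?_, fun x hx n => ?_⟩
  · have := hy1.le
    finiteness
  set S := ∑ j ∈ Finset.range (n + 1), ballTerm e x1 L μ j x
  set T := ∑ j ∈ Finset.range (n + 1), ballTerm e y1 L μ j x
  set V : Euc N → ℝ≥0∞ := fun y => ∑' k, ballTerm e y1 L μ (n + k) y
  set E := ball x (2 * dscale L n)
  set G : Euc N → ℝ≥0∞ := wolffMul α β p q1 q2 L (μ.restrict E)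
  have hV : Measurable V := Measurable.tsum fun k => measurable_ballTerm e y1 L μ (n + k)
  have hpt : ∀ y ∈ ball x (dscale L n), wolffMul α β p q1 q2 L μ y ≤
      K * (2 * (S ^ q1 * T ^ q2) + S ^ q1 * V y ^ q2 + 2 * K' * G y) := by
    intro y hy
    set U := ∑' k, ballTerm e x1 L μ (n + 1 + k) y
    set V' := ∑' k, ballTerm e y1 L μ (n + 1 + k) y
    have hVV : V' ≤ V y := by
      refine le_trans (le_of_eq (tsum_congr fun k => ?_))
        (ENNReal.tsum_comp_le_tsum_of_injective (add_right_injective 1)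
          fun k => ballTerm e y1 L μ (n + k) y)
      rw [add_assoc]
    have hUV : U ^ q1 * V' ^ q2 ≤ K' * G y := by
      calc _ ≤ (2 ^ (x1 + 1) * wolff α p (ENNReal.ofReal L) (μ.restrict E) y) ^ q1 *
            (2 ^ (y1 + 1) * wolff β p (ENNReal.ofReal L) (μ.restrict E) y) ^ q2 :=
            mul_le_mul'
              (ENNReal.rpow_le_rpow (tsum_ballTerm_le_wolff_restrict h.one_lt_p h.e_eq h.x1_eq hx1
                hL n hy) hq1)
              (ENNReal.rpow_le_rpow (tsum_ballTerm_le_wolff_restrict h.one_lt_p h.e_eq h.y1_eq hy1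
                hL n hy) hq2)
        _ = K' * G y := by
            rw [ENNReal.mul_rpow_of_nonneg _ _ hq1, ENNReal.mul_rpow_of_nonneg _ _ hq2,
              mul_mul_mul_comm]
            rfl
    calc wolffMul α β p q1 q2 L μ y ≤ (2 ^ x1 * (2 ^ x1 + 1) * (S + U)) ^ q1 *
          (2 ^ y1 * (2 ^ y1 + 1) * (T + V')) ^ q2 :=
          mul_le_mul'
            (ENNReal.rpow_le_rpow (wolff_le_sum_add_tsum h.one_lt_p h.e_eq h.x1_eq hx1
              hL hx n hy) hq1)
            (ENNReal.rpow_le_rpow (wolff_le_sum_add_tsum h.one_lt_p h.e_eq h.y1_eq hy1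
              hL hx n hy) hq2)
      _ = (2 ^ x1 * (2 ^ x1 + 1)) ^ q1 * (2 ^ y1 * (2 ^ y1 + 1)) ^ q2 *
          ((S + U) ^ q1 * (T + V') ^ q2) := by
          rw [ENNReal.mul_rpow_of_nonneg _ _ hq1, ENNReal.mul_rpow_of_nonneg _ _ hq2,
              mul_mul_mul_comm]
      _ ≤ (2 ^ x1 * (2 ^ x1 + 1)) ^ q1 * (2 ^ y1 * (2 ^ y1 + 1)) ^ q2 * (2 ^ q1 * 2 ^ q2 *
          (2 * (S ^ q1 * T ^ q2) + S ^ q1 * V' ^ q2 + 2 * (U ^ q1 * V' ^ q2))) :=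
          mul_le_mul_right (add_rpow_mul_add_rpow_le hq1 hq2
            (tsum_ballTerm_le_mul_tsum h.x1_lt_y1.le hL μ n y)
            (mul_sum_ballTerm_le h.x1_lt_y1.le hL μ n x)) _
      _ = K * (2 * (S ^ q1 * T ^ q2) + S ^ q1 * V' ^ q2 + 2 * (U ^ q1 * V' ^ q2)) := by
          rw [hK, mul_assoc _ (2 ^ q1 * 2 ^ q2)]
      _ ≤ _ := by
          rw [mul_assoc 2 K']
          exact mul_le_mul_right (add_le_add
            (add_le_add_right (mul_le_mul_right (ENNReal.rpow_le_rpow hVV hq2) _) _)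
            (mul_le_mul_right hUV _)) _
  have hVint : ∫⁻ y in ball x (dscale L n), V y ^ q2 ≤
      C1 * (2 ^ y1 + 1) ^ q2 * (escale L n ^ (N : ℝ) * T ^ q2) := by
    refine (hav L hL μ n x).trans ?_
    calc _ ≤ C1 * (escale L n ^ (N : ℝ) * ((2 ^ y1 + 1) * T) ^ q2) :=
          mul_le_mul_right (mul_le_mul_right (ENNReal.rpow_le_rpow
            (double_le_sum_ballTerm he hx n) hq2) _) _
      _ = _ := by rw [ENNReal.mul_rpow_of_nonneg _ _ hq2]; ring
  have hGint : ∫⁻ y in ball x (dscale L n), G y ≤ C2 * μ E :=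
    (setLIntegral_le_lintegral _ _).trans (hW E measurableSet_ball)
  have hGm : Measurable G := measurable_wolffMul h.one_lt_p _
  calc _ ≤ ∫⁻ y in ball x (dscale L n),
        K * (2 * (S ^ q1 * T ^ q2) + S ^ q1 * V y ^ q2 + 2 * K' * G y) :=
        setLIntegral_mono' measurableSet_ball hpt
    _ = K * (2 * (S ^ q1 * T ^ q2) * (v * escale L n ^ (N : ℝ)) +
        S ^ q1 * ∫⁻ y in ball x (dscale L n), V y ^ q2) +
        K * (2 * K' * ∫⁻ y in ball x (dscale L n), G y) := by
        rw [lintegral_const_mul' _ _ hKt, lintegral_add_right _ (hGm.const_mul _),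
          lintegral_add_left measurable_const, setLIntegral_const, volume_ball_dscale hL,
          lintegral_const_mul _ (hV.pow_const _), lintegral_const_mul _ hGm, mul_add]
    _ ≤ K * (2 * (S ^ q1 * T ^ q2) * (v * escale L n ^ (N : ℝ)) +
        S ^ q1 * (C1 * (2 ^ y1 + 1) ^ q2 * (escale L n ^ (N : ℝ) * T ^ q2))) +
        K * (2 * K' * (C2 * μ E)) :=
        add_le_add (mul_le_mul_right (add_le_add_right (mul_le_mul_right hVint _) _) _)
          (mul_le_mul_right (mul_le_mul_right hGint _) _)
    _ = K * (2 * v + C1 * (2 ^ y1 + 1) ^ q2) *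
          (escale L n ^ (N : ℝ) * (S ^ q1 * T ^ q2)) + K * (2 * K' * C2) * μ E := by ring
    _ ≤ K * (2 * v + C1 * (2 ^ y1 + 1) ^ q2 + 2 * K' * C2) *
          (escale L n ^ (N : ℝ) * (S ^ q1 * T ^ q2)) +
        K * (2 * v + C1 * (2 ^ y1 + 1) ^ q2 + 2 * K' * C2) * μ E :=
        add_le_add (mul_le_mul_left (mul_le_mul_right le_self_add _) _)
          (mul_le_mul_left (mul_le_mul_right le_add_self _) _)
    _ = _ := by ring

end WolffExponents

lemma ballTerm_ne_top {e z : ℝ} (he : 0 ≤ e) (hL : 0 < L) (μ : Measure (Euc N))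
    [IsFiniteMeasure μ] (j : ℕ) (x : Euc N) : ballTerm e z L μ j x ≠ ∞ :=
  ENNReal.mul_ne_top (ENNReal.rpow_ne_top_of_nonneg he (measure_ne_top _ _))
    (escale_rpow_ne_top hL j _)

lemma escale_rpow_mul_sum_rpow_eq {A a c : ℝ} (ha : 0 ≤ a) (hc : 0 ≤ c) (hL : 0 < L) (n : ℕ)
    {f g : ℕ → ℝ≥0∞} (hf : ∀ i, f i ≠ ∞) (hg : ∀ i, g i ≠ ∞) :
    escale L n ^ A * ((∑ l ∈ Finset.range (n + 1), f l) ^ a *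
      (∑ l ∈ Finset.range (n + 1), g l) ^ c) =
    ENNReal.ofReal (dscale L n ^ A * ((∑ l ∈ Finset.range (n + 1), (f l).toReal) ^ a *
      (∑ l ∈ Finset.range (n + 1), (g l).toReal) ^ c)) := by
  have hl := dscale_pos hL n
  have hf0 : 0 ≤ ∑ l ∈ Finset.range (n + 1), (f l).toReal :=
    Finset.sum_nonneg fun _ _ => ENNReal.toReal_nonneg
  have hg0 : 0 ≤ ∑ l ∈ Finset.range (n + 1), (g l).toReal :=
    Finset.sum_nonneg fun _ _ => ENNReal.toReal_nonneg
  rw [ENNReal.ofReal_mul (by positivity), ENNReal.ofReal_mul (by positivity),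
    ← ENNReal.ofReal_rpow_of_nonneg hf0 ha, ← ENNReal.ofReal_rpow_of_nonneg hg0 hc,
    ENNReal.ofReal_sum_of_nonneg fun _ _ => ENNReal.toReal_nonneg,
    ENNReal.ofReal_sum_of_nonneg fun _ _ => ENNReal.toReal_nonneg, escale_rpow_eq hL]
  simp only [ENNReal.ofReal_toReal (hf _), ENNReal.ofReal_toReal (hg _)]

/-- A measure whose mass on dyadic balls is controlled by another measure up to an error with
summable contributions has a controlled Wolff potential. -/
lemma wolff_le_mul_tsum_ballTerm {α z : ℝ} (hp : 1 < p) (he : e = 1 / (p - 1))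
    (hz : z = e * ((N : ℝ) - α * p)) (hz0 : 0 < z) (hL : 0 < L) {μ ν : Measure (Euc N)}
    {x : Euc N} (hx : μ (ball x L) = μ univ) {C K : ℝ≥0∞} {F : ℕ → ℝ≥0∞}
    (hν : ∀ n, ν (ball x (dscale L n)) ≤
      C * (μ (ball x (2 * dscale L n)) + escale L n ^ (N : ℝ) * F n))
    (hF : ∀ n, ∑ i ∈ Finset.range (n + 1), escale L i ^ (e * N - z) * F i ^ e ≤
      K * ∑ i ∈ Finset.range (n + 1), ballTerm e z L μ i x) :
    wolff α p (ENNReal.ofReal L) ν x ≤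
      2 ^ z * (C ^ e * 2 ^ e * ((2 ^ z + 1) + K)) * ∑' j, ballTerm e z L μ j x := by
  have he0 : 0 ≤ e := by
    have : 0 < p - 1 := by linarith
    rw [he]; positivity
  refine (wolff_le_tsum_ballTerm hp (by rw [← he]; exact hz) hz0 hL ν x).trans ?_
  rw [← he, mul_assoc]
  refine mul_le_mul_right ?_ _
  have hterm : ∀ i, ballTerm e z L ν i x ≤ C ^ e * 2 ^ e *
      (μ (ball x (2 * dscale L i)) ^ e * escale L i ^ (-z) +
        escale L i ^ (e * N - z) * F i ^ e) := by
    intro i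
    calc _ ≤ (C * (μ (ball x (2 * dscale L i)) + escale L i ^ (N : ℝ) * F i)) ^ e *
          escale L i ^ (-z) := mul_le_mul_left (ENNReal.rpow_le_rpow (hν i) he0) _
      _ ≤ C ^ e * (2 ^ e * (μ (ball x (2 * dscale L i)) ^ e +
          (escale L i ^ (N : ℝ) * F i) ^ e)) * escale L i ^ (-z) := by
          rw [ENNReal.mul_rpow_of_nonneg _ _ he0]
          exact mul_le_mul_left (mul_le_mul_right (add_rpow_le_two_rpow_mul he0 _ _) _) _
      _ = _ := by
          rw [ENNReal.mul_rpow_of_nonneg _ _ he0, ← ENNReal.rpow_mul,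
            show e * (N : ℝ) - z = (N : ℝ) * e + -z by ring, escale_rpow_add hL]
          ring
  refine ENNReal.tsum_le_of_sum_range_le fun n => ?_
  calc _ ≤ ∑ i ∈ Finset.range (n + 1), ballTerm e z L ν i x :=
        Finset.sum_le_sum_of_subset (Finset.range_subset_range.2 n.le_succ)
    _ ≤ ∑ i ∈ Finset.range (n + 1), C ^ e * 2 ^ e *
        (μ (ball x (2 * dscale L i)) ^ e * escale L i ^ (-z) +
          escale L i ^ (e * N - z) * F i ^ e) := Finset.sum_le_sum fun i _ => hterm i
    _ ≤ C ^ e * 2 ^ e * ((2 ^ z + 1) * ∑ i ∈ Finset.range (n + 1), ballTerm e z L μ i x +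
        K * ∑ i ∈ Finset.range (n + 1), ballTerm e z L μ i x) := by
        rw [← Finset.mul_sum, Finset.sum_add_distrib]
        exact mul_le_mul_right (add_le_add (sum_double_le_sum_ballTerm he0 hx n) (hF n)) _
    _ = C ^ e * 2 ^ e * (2 ^ z + 1 + K) *
        ∑ i ∈ Finset.range (n + 1), ballTerm e z L μ i x := by ring
    _ ≤ _ := mul_le_mul_right (ENNReal.sum_le_tsum _) _

lemma measure_ball_eq_univ {μ : Measure (Euc N)} {x₀ x : Euc N} {R ρ : ℝ}
    (hμ : μ (ball x₀ R)ᶜ = 0) (hx : x ∈ ball x₀ (2 * R)) (hρ : 3 * R ≤ ρ) :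
    μ (ball x ρ) = μ univ := by
  refine measure_congr (eventuallyEq_univ.2 (mem_ae_iff.2 (measure_mono_null ?_ hμ)))
  refine compl_subset_compl.2 fun y hy => ?_
  rw [mem_ball] at hx hy ⊢
  rw [dist_comm] at hx
  linarith [dist_triangle y x₀ x]

/-- Near the support, the dyadic sum with its top scale is bounded by the Wolff potential. -/
lemma tsum_ballTerm_le_mul_wolff {α z R : ℝ} (hp : 1 < p) (he : e = 1 / (p - 1))
    (hz : z = e * ((N : ℝ) - α * p)) (hz0 : 0 < z) (hR : 0 < R) {μ : Measure (Euc N)}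
    {x₀ x : Euc N} (hμ : μ (ball x₀ R)ᶜ = 0) (hx : x ∈ ball x₀ (2 * R)) :
    ∑' j, ballTerm e z (4 * R) μ j x ≤
      (4 + 2 ^ (z + 1)) * wolff α p (ENNReal.ofReal (4 * R)) μ x := by
  have hL : 0 < 4 * R := by linarith
  have he0 : 0 ≤ e := by
    have : 0 < p - 1 := by linarith
    rw [he]; positivity
  have h1 := tsum_ballTerm_le_wolff hp (by rw [← he]; exact hz) hz0 hL μ x
  rw [← he] at h1
  rw [tsum_eq_zero_add' ENNReal.summable, add_mul]
  refine add_le_add ?_ h1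
  rw [wolff_ofReal_eq hp, ← he, ← hz]
  have hpow : 4 * ((4 * R) ^ (-z - 1) * (4 * R - 3 * R)) = (4 * R) ^ (-z) := by
    rw [Real.rpow_sub_one hL.ne']
    field_simp
    ring
  have hconst : ballTerm e z (4 * R) μ 0 x =
      4 * (μ univ ^ e * ENNReal.ofReal ((4 * R) ^ (-z - 1)) * volume (Ioo (3 * R) (4 * R))) := by
    rw [Real.volume_Ioo, ballTerm, escale_rpow_eq hL, dscale_zero,
      measure_ball_eq_univ hμ hx (by linarith), ← hpow, ENNReal.ofReal_mul (by norm_num),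
      ENNReal.ofReal_mul (by positivity), ENNReal.ofReal_ofNat]
    ring
  rw [hconst, ← setLIntegral_const]
  refine mul_le_mul_right ((setLIntegral_mono' measurableSet_Ioo fun ρ hρ => ?_).trans
    (lintegral_mono_set (Ioo_subset_Ioo_left (by linarith)))) _
  rw [measure_ball_eq_univ hμ hx hρ.1.le]
  exact mul_le_mul_right (ENNReal.ofReal_le_ofReal
    (Real.rpow_le_rpow_of_nonpos (by linarith [hρ.1]) hρ.2.le (by linarith))) _

namespace WolffExponents

/-- The weighted sums of products of powers of the partial sums of the two dyadic potentials. -/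
lemma exists_sum_ballTerm_rpow_le (h : WolffExponents N α β p q1 q2 e x1 y1 s σ)
    (hL : 0 < L) {μ : Measure (Euc N)} [IsFiniteMeasure μ] (hT : CellTesting (N - σ) s L μ)
    (hμ : μ ≠ 0) :
    ∃ K : ℝ≥0∞, K ≠ ∞ ∧ ∀ x, μ (ball x L) = μ univ → ∀ n,
      ∑ i ∈ Finset.range (n + 1), escale L i ^ (e * N - x1) *
        ((∑ l ∈ Finset.range (i + 1), ballTerm e x1 L μ l x) ^ (q1 * e) *
          (∑ l ∈ Finset.range (i + 1), ballTerm e y1 L μ l x) ^ (q2 * e)) ≤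
        K * ∑ i ∈ Finset.range (n + 1), ballTerm e x1 L μ i x ∧
      ∑ i ∈ Finset.range (n + 1), escale L i ^ (e * N - y1) *
        ((∑ l ∈ Finset.range (i + 1), ballTerm e x1 L μ l x) ^ (q1 * e) *
          (∑ l ∈ Finset.range (i + 1), ballTerm e y1 L μ l x) ^ (q2 * e)) ≤
        K * ∑ i ∈ Finset.range (n + 1), ballTerm e y1 L μ i x := by
  have he := h.e_pos
  have hq1 := h.q1_pos
  have hq2 := h.q2_pos
  have hs := h.one_lt_s
  have hs1 : 0 < s - 1 := by linarith
  have hxy := h.x1_lt_y1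
  have hy := h.y1_pos
  have hN : (0 : ℝ) < N := Nat.cast_pos.2 h.N_pos
  obtain ⟨C, hC, hdec⟩ := exists_measure_ball_le_of_cellTesting hs hL hT
  set P := min (σ * s / (s - 1)) (N : ℝ) with hP
  have hPN : P ≤ N := min_le_right _ _
  have hPs : (s - 1) * P ≤ σ * s := by
    rw [mul_comm, ← le_div_iff₀ hs1]
    exact min_le_left _ _
  have hyN : y1 < e * N := by
    have h1 : q2 * y1 < N * (e * q2) :=
      h.q2_mul_lt.trans_le (mul_le_mul_of_nonneg_left (min_le_right _ _) hN.le)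
    nlinarith
  have hyN' : q2 * y1 < N := by
    have h1 := h.q2_mul_lt.trans_le (mul_le_mul_of_nonneg_left (min_le_left _ _) hN.le)
    linarith
  have hsum : q1 * e * (e * N - x1) + q2 * e * (e * N - y1) = e * (σ * s) := by
    have h1 := h.sum_eq
    have h2 := h.s_eq
    linear_combination (-e) * h1 - (e * N) * h2
  have hse : q1 * e + q2 * e = s := by rw [h.s_eq]; ring
  have hBσ : e * N - y1 < e * σ := by
    have h1 : s * (e * N - y1) < s * (e * σ) := by
      have h2 : q1 * e * (e * N - y1) < q1 * e * (e * N - x1) :=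
        mul_lt_mul_of_pos_left (by linarith) (by positivity)
      rw [← hse, add_mul]
      rw [← hse] at hsum
      linarith
    exact lt_of_mul_lt_mul_left h1 h.s_pos.le
  have hσP : σ < σ * s / (s - 1) := by
    rw [lt_div_iff₀ hs1]
    nlinarith [h.σ_pos]
  have hBQ : e * N - y1 < e * P := by
    rcases min_choice (σ * s / (s - 1)) (N : ℝ) with h1 | h1
    · rw [hP, h1]
      exact hBσ.trans (mul_lt_mul_of_pos_left hσP he)
    · rw [hP, h1]
      linarith
  have hcQ : q2 * e * (e * P - (e * N - y1)) < e * P := by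
    rcases le_total (q2 * e) 1 with h1 | h1
    · nlinarith
    · have h2 : (q2 * e - 1) * (e * P) ≤ (q2 * e - 1) * (e * N) :=
        mul_le_mul_of_nonneg_left (mul_le_mul_of_nonneg_left hPN he.le) (by linarith)
      have h3 : e * (q2 * y1) < e * N := mul_lt_mul_of_pos_left hyN' he
      linarith
  obtain ⟨K, hK, htail⟩ := exists_sum_rpow_mul_sum_le (a := q1 * e) (c := q2 * e)
    (A := e * N - x1) (B := e * N - y1) (Q := e * P) (by positivity) (by positivity)
    (by rw [hse]; exact hs) (by linarith) (by linarith) hBQ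
    (by rw [hsum, hse]; nlinarith) hcQ hL (C ^ e).toReal
  refine ⟨ENNReal.ofReal K, ENNReal.ofReal_ne_top, fun x hx n => ?_⟩
  have hu : ∀ i, ballTerm e x1 L μ i x ≠ ∞ := fun i => ballTerm_ne_top he.le hL μ i x
  have hv : ∀ i, ballTerm e y1 L μ i x ≠ ∞ := fun i => ballTerm_ne_top he.le hL μ i x
  have hseq : TailSeq (e * N - x1) (e * N - y1) (e * P) (C ^ e).toReal L
      (fun i => (ballTerm e x1 L μ i x).toReal) (fun i => (ballTerm e y1 L μ i x).toReal) := by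
    refine ⟨fun i => ENNReal.toReal_nonneg, ENNReal.toReal_pos ?_ (hu 0), fun i => ?_, fun i => ?_⟩
    · rw [ballTerm, dscale_zero, hx]
      refine mul_ne_zero ?_ (escale_rpow_ne_zero hL 0 _)
      rw [Ne, ENNReal.rpow_eq_zero_iff_of_pos he, Measure.measure_univ_eq_zero]
      exact hμ
    · rw [ballTerm_eq_mul (z := y1) (z' := x1) hL, ENNReal.toReal_mul, escale_rpow_eq hL,
        ENNReal.toReal_ofReal (Real.rpow_nonneg (dscale_pos hL i).le _), mul_comm]
      congr 2
      ring
    · have h1 : ballTerm e x1 L μ i x ≤ C ^ e * escale L i ^ (e * N - x1 - e * P) := by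
        calc _ ≤ (C * escale L i ^ (N - P)) ^ e * escale L i ^ (-x1) :=
              mul_le_mul_left (ENNReal.rpow_le_rpow (hdec i x) he.le) _
          _ = _ := by
              rw [ENNReal.mul_rpow_of_nonneg _ _ he.le, ← ENNReal.rpow_mul, mul_assoc,
                ← escale_rpow_add hL]
              congr 2
              ring
      have h2 := ENNReal.toReal_mono (ENNReal.mul_ne_top
        (ENNReal.rpow_ne_top_of_nonneg he.le hC) (escale_rpow_ne_top hL i _)) h1
      rwa [ENNReal.toReal_mul, escale_rpow_eq hL,
        ENNReal.toReal_ofReal (Real.rpow_nonneg (dscale_pos hL i).le _)] at h2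
  have hl := fun i => (dscale_pos hL i).le
  have hnn : ∀ (A : ℝ) (i : ℕ), 0 ≤ dscale L i ^ A *
      ((∑ l ∈ Finset.range (i + 1), (ballTerm e x1 L μ l x).toReal) ^ (q1 * e) *
        (∑ l ∈ Finset.range (i + 1), (ballTerm e y1 L μ l x).toReal) ^ (q2 * e)) := fun A i =>
    mul_nonneg (Real.rpow_nonneg (hl i) _) (mul_nonneg
      (Real.rpow_nonneg (Finset.sum_nonneg fun _ _ => ENNReal.toReal_nonneg) _)
      (Real.rpow_nonneg (Finset.sum_nonneg fun _ _ => ENNReal.toReal_nonneg) _))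
  have hsumu : ∀ {f : ℕ → ℝ≥0∞}, (∀ i, f i ≠ ∞) → ∑ i ∈ Finset.range (n + 1), f i =
      ENNReal.ofReal (∑ i ∈ Finset.range (n + 1), (f i).toReal) := by
    intro f hf
    rw [ENNReal.ofReal_sum_of_nonneg fun _ _ => ENNReal.toReal_nonneg]
    exact Finset.sum_congr rfl fun i _ => (ENNReal.ofReal_toReal (hf i)).symm
  have ht := htail _ _ hseq n
  rw [hsumu hu, hsumu hv, ← ENNReal.ofReal_mul hK, ← ENNReal.ofReal_mul hK]
  simp only [escale_rpow_mul_sum_rpow_eq (mul_pos hq1 he).le (mul_pos hq2 he).le hL _ hu hv]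
  rw [← ENNReal.ofReal_sum_of_nonneg fun i _ => hnn _ i,
    ← ENNReal.ofReal_sum_of_nonneg fun i _ => hnn _ i]
  exact ⟨ENNReal.ofReal_le_ofReal ht.1, ENNReal.ofReal_le_ofReal ht.2⟩

/-- Under the testing condition, the measure yields a supersolution of the integral system. -/
theorem exists_wolff_wolffMul_le (h : WolffExponents N α β p q1 q2 e x1 y1 s σ) {R : ℝ}
    (hR : 0 < R) {μ : Measure (Euc N)} [IsFiniteMeasure μ] {x₀ : Euc N}
    (hμ : μ (ball x₀ R)ᶜ = 0) (hT : CellTesting (N - σ) s (4 * R) μ) :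
    ∃ C : ℝ≥0∞, C ≠ ∞ ∧ ∀ x ∈ ball x₀ (2 * R),
      wolff α p (ENNReal.ofReal (4 * R))
        (volume.withDensity (wolffMul α β p q1 q2 (4 * R) μ)) x ≤
          C * wolff α p (ENNReal.ofReal (4 * R)) μ x ∧
      wolff β p (ENNReal.ofReal (4 * R))
        (volume.withDensity (wolffMul α β p q1 q2 (4 * R) μ)) x ≤
          C * wolff β p (ENNReal.ofReal (4 * R)) μ x := by
  have hL : 0 < 4 * R := by linarith
  have he := h.e_pos.le
  have hx1 := h.x1_pos
  have hy1 := h.y1_pos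
  rcases eq_or_ne μ 0 with h0 | h0
  · refine ⟨0, ENNReal.zero_ne_top, fun x _ => ?_⟩
    have h1 : wolffMul α β p q1 q2 (4 * R) μ = 0 := by
      funext y
      rw [wolffMul, wolff_eq_zero h.one_lt_p (by simp [h0]), ENNReal.zero_rpow_of_pos h.q1_pos,
        zero_mul]
      rfl
    have h2 : ∀ γ, wolff γ p (ENNReal.ofReal (4 * R)) (0 : Measure (Euc N)) x = 0 := fun γ =>
      wolff_eq_zero h.one_lt_p rfl
    rw [h1, withDensity_zero, h2, h2]
    exact ⟨zero_le, zero_le⟩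
  obtain ⟨C, hC, hmass⟩ := h.exists_setLIntegral_ball_wolffMul_le hL hT
  obtain ⟨K, hK, htail⟩ := h.exists_sum_ballTerm_rpow_le hL hT h0
  set D : ℝ → ℝ≥0∞ := fun z =>
    2 ^ z * (C ^ e * 2 ^ e * ((2 ^ z + 1) + K)) * (4 + 2 ^ (z + 1)) with hD
  have hDt : ∀ z, 0 < z → D z ≠ ∞ := by
    intro z hz
    have := hz.le
    have : 0 ≤ z + 1 := by linarith
    simp only [hD]
    finiteness
  refine ⟨D x1 + D y1, ENNReal.add_ne_top.2 ⟨hDt _ hx1, hDt _ hy1⟩, fun x hx => ?_⟩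
  have hxu : μ (ball x (4 * R)) = μ univ := measure_ball_eq_univ hμ hx (by linarith)
  have hν : ∀ n, (volume.withDensity (wolffMul α β p q1 q2 (4 * R) μ)) (ball x (dscale (4 * R) n))
      ≤ _ := fun n => (withDensity_apply _ measurableSet_ball).trans_le (hmass x hxu n)
  have hF := htail x hxu
  have hpow : ∀ i, ((∑ j ∈ Finset.range (i + 1), ballTerm e x1 (4 * R) μ j x) ^ q1 *
      (∑ j ∈ Finset.range (i + 1), ballTerm e y1 (4 * R) μ j x) ^ q2) ^ e =
      (∑ j ∈ Finset.range (i + 1), ballTerm e x1 (4 * R) μ j x) ^ (q1 * e) *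
      (∑ j ∈ Finset.range (i + 1), ballTerm e y1 (4 * R) μ j x) ^ (q2 * e) := fun i => by
    rw [ENNReal.mul_rpow_of_nonneg _ _ he, ENNReal.rpow_mul, ENNReal.rpow_mul]
  simp only [← hpow] at hF
  constructor
  · refine (wolff_le_mul_tsum_ballTerm h.one_lt_p h.e_eq h.x1_eq hx1 hL hxu hν
      fun n => (hF n).1).trans ?_
    refine (mul_le_mul_right (tsum_ballTerm_le_mul_wolff h.one_lt_p h.e_eq h.x1_eq hx1 hR hμ hx)
      _).trans ?_
    rw [← mul_assoc]
    exact mul_le_mul_left le_self_add _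
  · refine (wolff_le_mul_tsum_ballTerm h.one_lt_p h.e_eq h.y1_eq hy1 hL hxu hν
      fun n => (hF n).2).trans ?_
    refine (mul_le_mul_right (tsum_ballTerm_le_mul_wolff h.one_lt_p h.e_eq h.y1_eq hy1 hR hμ hx)
      _).trans ?_
    rw [← mul_assoc]
    exact mul_le_mul_left le_add_self _

end WolffExponents

lemma exists_pos_le_ofReal {C : ℝ≥0∞} (hC : C ≠ ∞) : ∃ c : ℝ, 0 < c ∧ C ≤ ENNReal.ofReal c :=
  ⟨C.toReal + 1, by positivity, by
    rw [ENNReal.le_ofReal_iff_toReal_le hC (by positivity)]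
    linarith⟩

lemma wolffExponents_of_lt {N : ℕ} {α β p q1 q2 : ℝ} (hβ : 0 < β)
    (hq1 : 0 < q1) (hq2 : 0 < q2) (hαβ : β < α) (hp : 1 < p) (hpα : p < (N : ℝ) / α)
    (hq : p - 1 < q1 + q2) (hq2' : q2 < (N : ℝ) * (p - 1) / ((N : ℝ) - β * p)) :
    WolffExponents N α β p q1 q2 (1 / (p - 1)) (1 / (p - 1) * (N - α * p))
      (1 / (p - 1) * (N - β * p)) (1 / (p - 1) * (q1 + q2))
      ((α * p * q1 + β * p * q2) / (q1 + q2)) := by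
  have hp1 : 0 < p - 1 := by linarith
  have hp0 : 0 < p := by linarith
  have he : 0 < 1 / (p - 1) := by positivity
  have hα : 0 < α := hβ.trans hαβ
  have hαN : α * p < N := by
    rw [lt_div_iff₀ hα] at hpα
    linarith
  have hβα : β * p < α * p := mul_lt_mul_of_pos_right hαβ hp0
  have hβ0 : 0 < β * p := by positivity
  have hq0 : 0 < q1 + q2 := by positivity
  refine ⟨hp, rfl, rfl, rfl, hq1, hq2, mul_pos he (by linarith),
    mul_lt_mul_of_pos_left (by linarith) he, rfl, ?_, by positivity, ?_, ?_, ?_⟩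
  · rw [one_div_mul_eq_div, one_lt_div hp1]
    exact hq
  · rw [div_lt_iff₀ hq0]
    have h1 : β * p * q2 < α * p * q2 := mul_lt_mul_of_pos_right hβα hq2
    have h2 : α * p * (q1 + q2) < N * (q1 + q2) := mul_lt_mul_of_pos_right hαN hq0
    linarith
  · field_simp
    ring
  · have hN : (0 : ℝ) < N := by linarith
    rw [mul_min_of_nonneg _ _ hN.le, lt_min_iff]
    constructor
    · rw [lt_div_iff₀ (by linarith)] at hq2'
      rw [one_div_mul_eq_div, ← mul_div_assoc, div_lt_iff₀ hp1]
      linarith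
    · have h1 : 1 / (p - 1) * q2 * (N - β * p) < 1 / (p - 1) * q2 * N :=
        mul_lt_mul_of_pos_left (by linarith) (by positivity)
      linarith

end

/-- Truncated equivalences, with Bessel capacities, for a
bounded measure supported in a ball `B_R(x₀)`. -/
theorem stmt17 (N : ℕ) (α β p q1 q2 R : ℝ) (hα : 0 < α) (hβ : 0 < β)
    (hq1 : 0 < q1) (hq2 : 0 < q2) (hαβ : β < α)
    (hp : 1 < p) (hpα : p < (N : ℝ) / α)
    (hq : p - 1 < q1 + q2) (hq2' : q2 < (N : ℝ) * (p - 1) / ((N : ℝ) - β * p))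
    (hR : 0 < R) (x0 : Euc N)
    (ω : Measure (Euc N)) [IsFiniteMeasure ω] (hsupp : ω (ball x0 R)ᶜ = 0) :
    List.TFAE [
      -- (a)
      (∃ C1 > 0, ∀ K : Set (Euc N), IsCompact K →
        ω K ≤ ENNReal.ofReal C1 *
          besselCap N ((α * p * q1 + β * p * q2) / (q1 + q2))
            ((q1 + q2) / (q1 + q2 - p + 1)) K),
      -- (b)
      (∃ C2 > 0, ∀ K : Set (Euc N), IsCompact K →
        (∫⁻ x in K, (wolff α p (ENNReal.ofReal (4 * R)) ω x) ^ q1 *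
            (wolff β p (ENNReal.ofReal (4 * R)) ω x) ^ q2) ≤
          ENNReal.ofReal C2 *
            besselCap N ((α * p * q1 + β * p * q2) / (q1 + q2))
              ((q1 + q2) / (q1 + q2 - p + 1)) K),
      -- (c)
      (∃ C3 > 0, ∀ (x : Euc N) (t : ℝ), 0 < t →
        (∫⁻ y, (wolff ((α * q1 + β * q2) / (q1 + q2)) p (ENNReal.ofReal (4 * R))
            (ω.restrict (ball x t)) y) ^ (q1 + q2)) ≤
          ENNReal.ofReal C3 * ω (ball x t)),
      -- (d)
      (∃ C4 > 0, ∀ (x : Euc N) (t : ℝ), 0 < t →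
        (∫⁻ y, (wolff α p (ENNReal.ofReal (4 * R)) (ω.restrict (ball x t)) y) ^ q1 *
            (wolff β p (ENNReal.ofReal (4 * R)) (ω.restrict (ball x t)) y) ^ q2) ≤
          ENNReal.ofReal C4 * ω (ball x t)),
      -- (e)
      (∃ C5 > 0, ∀ᵐ x ∂(volume.restrict (ball x0 (2 * R))),
        wolff α p (ENNReal.ofReal (4 * R))
            (volume.withDensity fun y =>
              (wolff α p (ENNReal.ofReal (4 * R)) ω y) ^ q1 *
                (wolff β p (ENNReal.ofReal (4 * R)) ω y) ^ q2) x ≤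
          ENNReal.ofReal C5 * wolff α p (ENNReal.ofReal (4 * R)) ω x ∧
        wolff β p (ENNReal.ofReal (4 * R))
            (volume.withDensity fun y =>
              (wolff α p (ENNReal.ofReal (4 * R)) ω y) ^ q1 *
                (wolff β p (ENNReal.ofReal (4 * R)) ω y) ^ q2) x ≤
          ENNReal.ofReal C5 * wolff β p (ENNReal.ofReal (4 * R)) ω x) ] := by
  have h := wolffExponents_of_lt hβ hq1 hq2 hαβ hp hpα hq hq2'
  have hL : 0 < 4 * R := by linarith
  have hp1 : 0 < p - 1 := by linarith
  have hs : (q1 + q2) / (q1 + q2 - p + 1) =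
      1 / (p - 1) * (q1 + q2) / (1 / (p - 1) * (q1 + q2) - 1) := by
    have h1 : 0 < q1 + q2 - p + 1 := by linarith
    have h2 : 0 < q1 + q2 - (p - 1) := by linarith
    field_simp
    ring
  rw [hs]
  tfae_have 1 → 4 := by
    rintro ⟨C, -, hC⟩
    obtain ⟨D, hD, hd⟩ := h.exists_lintegral_wolff_le hL
      (cellTesting_of_le_besselCap h.σ_pos h.σ_lt h.one_lt_s hL ENNReal.ofReal_ne_top hC)
    obtain ⟨c, hc, hDc⟩ := exists_pos_le_ofReal hD
    exact ⟨c, hc, fun x t _ => (hd _ measurableSet_ball).trans (mul_le_mul_left hDc _)⟩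
  tfae_have 4 → 3 := by
    rintro ⟨C, hC0, hC⟩
    exact ⟨C, hC0, fun x t ht =>
      (lintegral_mono fun y => wolff_rpow_le_mul hp hq1 hq2 _ y).trans (hC x t ht)⟩
  tfae_have 3 → 5 := by
    rintro ⟨C, -, hC⟩
    obtain ⟨D, hD, hd⟩ := h.exists_wolff_wolffMul_le hR hsupp
      (h.cellTesting_of_wolff_ball hL ENNReal.ofReal_ne_top hC)
    obtain ⟨c, hc, hDc⟩ := exists_pos_le_ofReal hD
    refine ⟨c, hc, (ae_restrict_mem measurableSet_ball).mono fun x hx => ?_⟩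
    exact ⟨(hd x hx).1.trans (mul_le_mul_left hDc _), (hd x hx).2.trans (mul_le_mul_left hDc _)⟩
  tfae_have 5 → 2 := by
    rintro ⟨C, -, hC⟩
    obtain ⟨D, hD, hd⟩ := h.exists_setLIntegral_wolffMul_le_besselCap hR hsupp
      ENNReal.ofReal_ne_top hC
    obtain ⟨c, hc, hDc⟩ := exists_pos_le_ofReal hD
    exact ⟨c, hc, fun K hK => (hd K hK).trans (mul_le_mul_left hDc _)⟩
  tfae_have 2 → 1 := by
    rintro ⟨C, -, hC⟩
    obtain ⟨D, hD, hd⟩ := exists_le_besselCap_of_cellTesting h.σ_pos h.σ_lt h.one_lt_s hL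
      (h.cellTesting_of_setLIntegral_wolffMul_le hL hR hsupp ENNReal.ofReal_ne_top hC)
    obtain ⟨c, hc, hDc⟩ := exists_pos_le_ofReal hD
    exact ⟨c, hc, fun K hK => (hd K hK.measurableSet).trans (mul_le_mul_left hDc _)⟩
  tfae_finish
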